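/- For every p ∈ (1, ∞), the operator norm of the discrete Hilbert transform 𝓗₀ on ℓ^p(ℤ) equals cot(π/(2p*)), where p* = max{p, p/(p−1)}. In particular it coincides with the operator norm of the continuous Hilbert transform on L^p(ℝ). -/

import Mathlib

open scoped BigOperators
open MeasureTheory

noncomputable section

/-- The ℓ^p norm of a doubly infinite complex sequence. -/
def lpNorm (p : ℝ) (a : ℤ → ℂ) : ℝ := (∑' n : ℤ, ‖a n‖ ^ p) ^ (1 / p)

/-- Membership in ℓ^p(ℤ). -/
def MemLpZ (p : ℝ) (a : ℤ → ℂ) : Prop := Summable fun n : ℤ => ‖a n‖ ^ p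

/-- The operator norm of an operator on ℓ^p(ℤ): the least admissible constant. -/
def opNormOn (p : ℝ) (T : (ℤ → ℂ) → ℤ → ℂ) : ℝ :=
  sInf {C : ℝ | 0 ≤ C ∧ ∀ a : ℤ → ℂ, MemLpZ p a → lpNorm p (T a) ≤ C * lpNorm p a}

/-- The Riesz–Titchmarsh operator: 𝓡 a_n = (1/π) Σ_{m ∈ ℤ} a_{n-m}/(m + 1/2). -/
def RT (a : ℤ → ℂ) (n : ℤ) : ℂ :=
  (1 / (Real.pi : ℂ)) * ∑' m : ℤ, a (n - m) / ((m : ℂ) + 1 / 2)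

/-- The Kak–Hilbert transform: 𝓚 a_n = (2/π) Σ_{m odd} a_{n-m}/m. -/
def KT (a : ℤ → ℂ) (n : ℤ) : ℂ :=
  (2 / (Real.pi : ℂ)) * ∑' m : {m : ℤ // Odd m}, a (n - (m : ℤ)) / ((m : ℤ) : ℂ)

/-- The discrete Hilbert transform: 𝓗₀ a_n = (1/π) Σ_{m ≠ 0} a_{n-m}/m. -/
def H0T (a : ℤ → ℂ) (n : ℤ) : ℂ :=
  (1 / (Real.pi : ℂ)) * ∑' m : {m : ℤ // m ≠ 0}, a (n - (m : ℤ)) / ((m : ℤ) : ℂ)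

/-- The operator 𝓗: 𝓗 a_n = (2/π) Σ_{m even, m ≠ 0} a_{n-m}/m. -/
def HT (a : ℤ → ℂ) (n : ℤ) : ℂ :=
  (2 / (Real.pi : ℂ)) *
    ∑' m : {m : ℤ // Even (m : ℤ) ∧ (m : ℤ) ≠ 0}, a (n - (m : ℤ)) / ((m : ℤ) : ℂ)

/-- The operator 𝓘: 𝓘 a_n = (4/π²) Σ_{m odd} a_{n-m}/m². -/
def IT (a : ℤ → ℂ) (n : ℤ) : ℂ :=
  (4 / (Real.pi : ℂ) ^ 2) * ∑' m : {m : ℤ // Odd m}, a (n - (m : ℤ)) / ((m : ℤ) : ℂ) ^ 2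

/-- p* = max(p, p/(p-1)). -/
def pstar (p : ℝ) : ℝ := max p (p / (p - 1))

/-- C_p = cot(π/(2 p*)). -/
def Cconst (p : ℝ) : ℝ := Real.cot (Real.pi / (2 * pstar p))

/-- The multiplier in Pichorides' inequality. -/
def pichoridesConst (p : ℝ) : ℝ :=
  Real.sin (Real.pi / (2 * p)) ^ (p - 1) / Real.cos (Real.pi / (2 * p))

lemma pichorides_angle_mem {p : ℝ} (hp : 1 < p) :
    0 < Real.pi / (2 * p) ∧ Real.pi / (2 * p) < Real.pi / 2 := by
  have := Real.pi_pos
  refine ⟨by positivity, ?_⟩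
  rw [div_lt_div_iff₀ (by positivity) (by positivity)]
  nlinarith

lemma pichoridesConst_pos {p : ℝ} (hp : 1 < p) : 0 < pichoridesConst p := by
  obtain ⟨h0, h1⟩ := pichorides_angle_mem hp
  have hs := Real.sin_pos_of_pos_of_lt_pi h0 (by linarith [Real.pi_pos])
  have hc := Real.cos_pos_of_mem_Ioo ⟨by linarith, h1⟩
  unfold pichoridesConst
  positivity

lemma sin_rpow_div_sin_antitoneOn {p : ℝ} (hp : 1 < p) (hp2 : p ≤ 2) :
    AntitoneOn (fun θ => Real.sin θ ^ (p - 1) / Real.sin ((p - 1) * θ))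
      (Set.Ioo 0 (Real.pi / 2)) := by
  have hpi := Real.pi_pos
  have hpos : ∀ θ ∈ Set.Ioo (0:ℝ) (Real.pi / 2), 0 < Real.sin θ ∧ 0 < Real.sin ((p - 1) * θ) := by
    rintro θ ⟨h0, h1⟩
    refine ⟨Real.sin_pos_of_pos_of_lt_pi h0 (by linarith), Real.sin_pos_of_pos_of_lt_pi ?_ ?_⟩
    · exact mul_pos (by linarith) h0
    · nlinarith
  have hd : ∀ θ ∈ Set.Ioo (0:ℝ) (Real.pi / 2),
      HasDerivAt (fun θ => Real.sin θ ^ (p - 1) / Real.sin ((p - 1) * θ))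
        (((Real.cos θ * (p - 1) * Real.sin θ ^ (p - 1 - 1)) * Real.sin ((p - 1) * θ)
          - Real.sin θ ^ (p - 1) * (Real.cos ((p - 1) * θ) * (p - 1)))
          / Real.sin ((p - 1) * θ) ^ 2) θ := by
    intro θ hθ
    obtain ⟨h1, h2⟩ := hpos θ hθ
    have ha := (Real.hasDerivAt_sin θ).rpow_const (p := p - 1) (Or.inl h1.ne')
    have hb : HasDerivAt (fun θ => Real.sin ((p - 1) * θ))
        (Real.cos ((p - 1) * θ) * (p - 1)) θ := by
      have := ((hasDerivAt_id θ).const_mul (p - 1)).sin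
      simpa using this
    exact ha.div hb h2.ne'
  apply antitoneOn_of_deriv_nonpos (convex_Ioo _ _)
  · intro θ hθ
    exact (hd θ hθ).continuousAt.continuousWithinAt
  · rw [interior_Ioo]
    intro θ hθ
    exact (hd θ hθ).differentiableAt.differentiableWithinAt
  · rw [interior_Ioo]
    intro θ hθ
    obtain ⟨h1, h2⟩ := hpos θ hθ
    rw [(hd θ hθ).deriv]
    apply div_nonpos_of_nonpos_of_nonneg _ (by positivity)
    have e : Real.sin θ ^ (p - 1) = Real.sin θ ^ (p - 1 - 1) * Real.sin θ := by
      rw [← Real.rpow_add_one h1.ne']; congr 1; ring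
    have e2 : Real.sin ((p - 1) * θ) * Real.cos θ - Real.cos ((p - 1) * θ) * Real.sin θ
        = - Real.sin ((2 - p) * θ) := by
      rw [← Real.sin_sub, ← Real.sin_neg]; congr 1; ring
    have e3 : 0 ≤ Real.sin ((2 - p) * θ) := by
      apply Real.sin_nonneg_of_nonneg_of_le_pi
      · exact mul_nonneg (by linarith) hθ.1.le
      · nlinarith [hθ.1, hθ.2]
    rw [e]
    have : Real.cos θ * (p - 1) * Real.sin θ ^ (p - 1 - 1) * Real.sin ((p - 1) * θ)
        - Real.sin θ ^ (p - 1 - 1) * Real.sin θ * (Real.cos ((p - 1) * θ) * (p - 1))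
        = (p - 1) * Real.sin θ ^ (p - 1 - 1) *
          (Real.sin ((p - 1) * θ) * Real.cos θ - Real.cos ((p - 1) * θ) * Real.sin θ) := by ring
    rw [this, e2]
    have := Real.rpow_nonneg h1.le (p - 1 - 1)
    have h3 : 0 ≤ (p - 1) * Real.sin θ ^ (p - 1 - 1) := mul_nonneg (by linarith) this
    nlinarith

lemma pichorides_angle {p : ℝ} (hp : 1 < p) (hp2 : p ≤ 2) {θ : ℝ} (h0 : 0 ≤ θ)
    (h1 : θ < Real.pi / 2) :
    Real.sin θ ^ p + pichoridesConst p * Real.cos (p * θ)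
      ≤ Real.tan (Real.pi / (2 * p)) ^ p * Real.cos θ ^ p := by
  have hpi := Real.pi_pos
  obtain ⟨g0, g1⟩ := pichorides_angle_mem hp
  set γ := Real.pi / (2 * p) with hγ
  set K := pichoridesConst p with hK
  have hpγ : p * γ = Real.pi / 2 := by rw [hγ]; field_simp
  have hcos : ∀ t ∈ Set.Ico (0:ℝ) (Real.pi / 2), 0 < Real.cos t := fun t ht =>
    Real.cos_pos_of_mem_Ioo ⟨by linarith [ht.1], ht.2⟩
  have hsin : ∀ t ∈ Set.Ioo (0:ℝ) (Real.pi / 2), 0 < Real.sin t := fun t ht =>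
    Real.sin_pos_of_pos_of_lt_pi ht.1 (by linarith [ht.2])
  have hsin2 : ∀ t ∈ Set.Ioo (0:ℝ) (Real.pi / 2), 0 < Real.sin ((p - 1) * t) := fun t ht =>
    Real.sin_pos_of_pos_of_lt_pi (mul_pos (by linarith) ht.1) (by nlinarith [ht.1, ht.2])
  let f : ℝ → ℝ := fun t => (Real.sin t ^ p + K * Real.cos (p * t)) / Real.cos t ^ p
  have hfγ : f γ = Real.tan γ ^ p := by
    have hs := hsin γ ⟨g0, g1⟩
    have hc := hcos γ ⟨g0.le, g1⟩
    simp only [f, hpγ, Real.cos_pi_div_two, Real.tan_eq_sin_div_cos, mul_zero, add_zero]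
    rw [Real.div_rpow hs.le hc.le]
  have hfc : ContinuousOn f (Set.Ico 0 (Real.pi / 2)) := by
    apply ContinuousOn.div
    · apply Continuous.continuousOn
      apply Continuous.add
      · exact Real.continuous_sin.rpow_const (fun _ => Or.inr (by linarith))
      · fun_prop
    · exact (Real.continuous_cos.rpow_const (fun _ => Or.inr (by linarith))).continuousOn
    · intro t ht
      exact (Real.rpow_pos_of_pos (hcos t ht) p).ne'
  have hfd : ∀ t ∈ Set.Ioo (0:ℝ) (Real.pi / 2), HasDerivAt f
      (p * (Real.sin t ^ (p - 1) - K * Real.sin ((p - 1) * t)) * Real.cos t ^ (p - 1)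
        / (Real.cos t ^ p) ^ 2) t := by
    intro t ht
    have hs := hsin t ht
    have hc := hcos t ⟨ht.1.le, ht.2⟩
    have d1 := (Real.hasDerivAt_sin t).rpow_const (p := p) (Or.inl hs.ne')
    have d2 := (Real.hasDerivAt_cos t).rpow_const (p := p) (Or.inl hc.ne')
    have d3 : HasDerivAt (fun t => K * Real.cos (p * t)) (K * (-Real.sin (p * t) * p)) t := by
      have := (((hasDerivAt_id t).const_mul p).cos).const_mul K
      simpa using this
    have d := (d1.add d3).div d2 (Real.rpow_pos_of_pos hc p).ne'
    refine d.congr_deriv ?_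
    congr 1
    have e1 : Real.sin t ^ p = Real.sin t ^ (p - 1) * Real.sin t := by
      rw [← Real.rpow_add_one hs.ne']; congr 1; ring
    have e2 : Real.cos t ^ p = Real.cos t ^ (p - 1) * Real.cos t := by
      rw [← Real.rpow_add_one hc.ne']; congr 1; ring
    have e3 : Real.sin ((p - 1) * t) = Real.sin (p * t) * Real.cos t - Real.cos (p * t) * Real.sin t := by
      rw [← Real.sin_sub]; congr 1; ring
    simp only [Pi.add_apply]
    rw [e1, e2, e3]
    linear_combination (p * Real.sin t ^ (p-1) * Real.cos t ^ (p-1)) * Real.sin_sq_add_cos_sq t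
  have hsgn : ∀ t ∈ Set.Ioo (0:ℝ) (Real.pi / 2),
      (t ≤ γ → 0 ≤ Real.sin t ^ (p - 1) - K * Real.sin ((p - 1) * t)) ∧
      (γ ≤ t → Real.sin t ^ (p - 1) - K * Real.sin ((p - 1) * t) ≤ 0) := by
    intro t ht
    have hk : Real.sin γ ^ (p - 1) / Real.sin ((p - 1) * γ) = K := by
      rw [hK, pichoridesConst, ← hγ]
      congr 1
      rw [← Real.sin_pi_div_two_sub, ← hpγ]; congr 1; ring
    have ha := sin_rpow_div_sin_antitoneOn hp hp2
    have hs2 := hsin2 t ht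
    constructor
    · intro h
      have := ha ht ⟨g0, g1⟩ h
      simp only [hk] at this
      rw [le_div_iff₀ hs2] at this
      linarith
    · intro h
      have := ha ⟨g0, g1⟩ ht h
      simp only [hk] at this
      rw [div_le_iff₀ hs2] at this
      linarith
  have hmain : f θ ≤ f γ := by
    rcases le_total θ γ with h | h
    · have hm : MonotoneOn f (Set.Icc 0 γ) := by
        apply monotoneOn_of_deriv_nonneg (convex_Icc _ _)
        · exact hfc.mono (fun t ht => ⟨ht.1, lt_of_le_of_lt ht.2 g1⟩)
        · rw [interior_Icc]
          intro t ht
          exact (hfd t ⟨ht.1, ht.2.trans g1⟩).differentiableAt.differentiableWithinAt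
        · rw [interior_Icc]
          intro t ht
          have ht' : t ∈ Set.Ioo (0:ℝ) (Real.pi / 2) := ⟨ht.1, ht.2.trans g1⟩
          rw [(hfd t ht').deriv]
          have := (hsgn t ht').1 ht.2.le
          have hc := hcos t ⟨ht'.1.le, ht'.2⟩
          positivity
      exact hm ⟨h0, h⟩ ⟨g0.le, le_rfl⟩ h
    · have hm : AntitoneOn f (Set.Ico γ (Real.pi / 2)) := by
        apply antitoneOn_of_deriv_nonpos (convex_Ico _ _)
        · exact hfc.mono (fun t ht => ⟨g0.le.trans ht.1, ht.2⟩)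
        · rw [interior_Ico]
          intro t ht
          exact (hfd t ⟨g0.trans ht.1, ht.2⟩).differentiableAt.differentiableWithinAt
        · rw [interior_Ico]
          intro t ht
          have ht' : t ∈ Set.Ioo (0:ℝ) (Real.pi / 2) := ⟨g0.trans ht.1, ht.2⟩
          rw [(hfd t ht').deriv]
          have := (hsgn t ht').2 ht.1.le
          have hc := hcos t ⟨ht'.1.le, ht'.2⟩
          have h3 : p * (Real.sin t ^ (p - 1) - K * Real.sin ((p - 1) * t)) ≤ 0 :=
            mul_nonpos_of_nonneg_of_nonpos (by linarith) this
          apply div_nonpos_of_nonpos_of_nonneg _ (by positivity)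
          exact mul_nonpos_of_nonpos_of_nonneg h3 (by positivity)
      exact hm ⟨le_rfl, g1⟩ ⟨h, h1⟩ h
  rw [hfγ] at hmain
  have hc := Real.rpow_pos_of_pos (hcos θ ⟨h0, h1⟩) p
  exact (div_le_iff₀ hc).1 hmain

/-- Pichorides' inequality in the right half-plane. -/
lemma pichorides_halfPlane {p : ℝ} (hp : 1 < p) (hp2 : p ≤ 2) {z : ℂ} (hz : 0 < z.re) :
    |z.im| ^ p + pichoridesConst p * (z ^ (p : ℂ)).re
      ≤ Real.tan (Real.pi / (2 * p)) ^ p * z.re ^ p := by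
  have hz0 : z ≠ 0 := by rintro rfl; simp at hz
  have hn : 0 ≤ ‖z‖ := norm_nonneg z
  have harg : |z.arg| < Real.pi / 2 := Complex.abs_arg_lt_pi_div_two_iff.2 (Or.inl hz)
  have h := pichorides_angle hp hp2 (abs_nonneg z.arg) harg
  have hre : z.re = ‖z‖ * Real.cos |z.arg| := by
    rw [Real.cos_abs, Complex.norm_mul_cos_arg]
  have hs : 0 ≤ Real.sin |z.arg| := Real.sin_nonneg_of_nonneg_of_le_pi (abs_nonneg _)
    (by linarith [Real.pi_pos])
  have hc : 0 ≤ Real.cos |z.arg| := (Real.cos_pos_of_mem_Ioo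
    ⟨by linarith [abs_nonneg z.arg, Real.pi_pos], harg⟩).le
  have him : |z.im| = ‖z‖ * Real.sin |z.arg| := by
    rw [← Complex.norm_mul_sin_arg z, abs_mul, abs_of_nonneg hn]
    congr 1
    rcases abs_cases z.arg with ⟨h1, h2⟩ | ⟨h1, h2⟩
    · rw [h1] at hs ⊢; exact abs_of_nonneg hs
    · rw [h1] at hs ⊢
      rw [Real.sin_neg] at hs ⊢
      exact abs_of_nonpos (by linarith)
  rw [him, Complex.cpow_ofReal_re, hre, Real.mul_rpow hn hs, Real.mul_rpow hn hc]
  have e : Real.cos (z.arg * p) = Real.cos (p * |z.arg|) := by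
    rcases abs_cases z.arg with ⟨h1, h2⟩ | ⟨h1, h2⟩
    · rw [h1, mul_comm]
    · rw [h1, ← Real.cos_neg]; congr 1; ring
  rw [e]
  have := mul_le_mul_of_nonneg_left h (Real.rpow_nonneg hn p)
  linarith

lemma cpow_re_nonneg {z : ℂ} (hz : 0 < z.re) {r : ℝ} (hr : |r| ≤ 1) :
    0 ≤ (z ^ (r : ℂ)).re := by
  rw [Complex.cpow_ofReal_re]
  have harg : |z.arg| < Real.pi / 2 := Complex.abs_arg_lt_pi_div_two_iff.2 (Or.inl hz)
  apply mul_nonneg (Real.rpow_nonneg (norm_nonneg _) _)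
  apply Real.cos_nonneg_of_mem_Icc
  rw [Set.mem_Icc, ← abs_le, abs_mul]
  nlinarith [abs_nonneg z.arg, abs_nonneg r]

lemma hasDerivAt_cpow_re_horizontal (r n : ℝ) {s : ℝ} (hs : 0 < s) :
    HasDerivAt (fun s : ℝ => ((((s : ℂ) + n * Complex.I) ^ (r : ℂ)).re))
      (r * (((s : ℂ) + n * Complex.I) ^ ((r - 1 : ℝ) : ℂ)).re) s := by
  have h1 : HasDerivAt (fun s : ℝ => ((s : ℂ) + n * Complex.I)) 1 s :=
    (Complex.ofRealCLM.hasDerivAt (x := s)).add_const _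
  have hm : ((s : ℂ) + n * Complex.I) ∈ Complex.slitPlane := by
    left; simpa using hs
  have h2 := (hasDerivAt_id ((s : ℂ) + n * Complex.I)).cpow_const (c := (r : ℂ)) hm
  have h3 := HasDerivAt.comp s h2 h1
  have h4 := Complex.reCLM.hasFDerivAt.comp_hasDerivAt s h3
  refine h4.congr_deriv ?_
  simp [← Complex.ofReal_one, ← Complex.ofReal_sub]

lemma cpow_re_monotoneOn {p : ℝ} (hp : 1 < p) (hp2 : p ≤ 2) (n : ℝ) :
    MonotoneOn (fun s : ℝ => ((((s : ℂ) + n * Complex.I) ^ (p : ℂ)).re)) (Set.Ioi 0) := by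
  apply monotoneOn_of_deriv_nonneg (convex_Ioi _)
  · exact fun s hs => (hasDerivAt_cpow_re_horizontal p n hs).continuousAt.continuousWithinAt
  · rw [interior_Ioi]
    exact fun s hs => (hasDerivAt_cpow_re_horizontal p n hs).differentiableAt.differentiableWithinAt
  · rw [interior_Ioi]
    intro s hs
    rw [(hasDerivAt_cpow_re_horizontal p n hs).deriv]
    apply mul_nonneg (by linarith)
    apply cpow_re_nonneg (by simpa using hs)
    rw [abs_le]; constructor <;> linarith

lemma cpow_re_convexOn {p : ℝ} (hp : 1 < p) (hp2 : p ≤ 2) (n : ℝ) :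
    ConvexOn ℝ (Set.Ioi 0) (fun s : ℝ => ((((s : ℂ) + n * Complex.I) ^ (p : ℂ)).re)) := by
  apply MonotoneOn.convexOn_of_deriv (convex_Ioi _)
  · exact fun s hs => (hasDerivAt_cpow_re_horizontal p n hs).continuousAt.continuousWithinAt
  · rw [interior_Ioi]
    exact fun s hs => (hasDerivAt_cpow_re_horizontal p n hs).differentiableAt.differentiableWithinAt
  · rw [interior_Ioi]
    have hm : MonotoneOn (fun s : ℝ => p * ((((s : ℂ) + n * Complex.I) ^ ((p - 1 : ℝ) : ℂ)).re))
        (Set.Ioi 0) := by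
      apply monotoneOn_of_deriv_nonneg (convex_Ioi _)
      · exact fun s hs => ((hasDerivAt_cpow_re_horizontal (p - 1) n hs).const_mul
          p).continuousAt.continuousWithinAt
      · rw [interior_Ioi]
        exact fun s hs => ((hasDerivAt_cpow_re_horizontal (p - 1) n hs).const_mul
          p).differentiableAt.differentiableWithinAt
      · rw [interior_Ioi]
        intro s hs
        rw [((hasDerivAt_cpow_re_horizontal (p - 1) n hs).const_mul p).deriv]
        apply mul_nonneg (by linarith)
        apply mul_nonneg (by linarith)
        apply cpow_re_nonneg (by simpa using hs)
        rw [abs_le]; constructor <;> linarith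
    exact hm.congr (fun s hs => (hasDerivAt_cpow_re_horizontal p n hs).deriv.symm)

lemma norm_cpow_taylor_two_le {p δ : ℝ} (hp2 : p ≤ 2) (hδ : 0 < δ) :
    ∃ M : ℝ, 0 ≤ M ∧ ∀ ζ σ : ℂ, δ ≤ ζ.re → ‖σ‖ ≤ δ / 2 →
      ‖(ζ + σ) ^ (p : ℂ) - ζ ^ (p : ℂ) - p * ζ ^ ((p : ℂ) - 1) * σ
        - p * (p - 1) / 2 * ζ ^ ((p : ℂ) - 1 - 1) * σ ^ 2‖ ≤ M * ‖σ‖ ^ 3 := by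
  refine ⟨|p| * |p - 1| * |p - 2| * (δ / 2) ^ (p - 3), by positivity, ?_⟩
  set M := |p| * |p - 1| * |p - 2| * (δ / 2) ^ (p - 3) with hM
  intro ζ σ hζ hσ
  set s := Metric.closedBall (0 : ℂ) ‖σ‖ with hs
  have hcs : Convex ℝ s := convex_closedBall _ _
  have h0s : (0 : ℂ) ∈ s := by simp [hs]
  have hσs : σ ∈ s := by simp [hs]
  have hns : ∀ x ∈ s, ‖x‖ ≤ ‖σ‖ := fun x hx => by simpa [hs] using hx
  have hre : ∀ x ∈ s, δ / 2 ≤ (ζ + x).re := by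
    intro x hx
    have h1 := hns x hx
    have h2 := (abs_le.1 (Complex.abs_re_le_norm x)).1
    simp only [Complex.add_re]; linarith
  have hslit : ∀ x ∈ s, ζ + x ∈ Complex.slitPlane := fun x hx =>
    Or.inl (by linarith [hre x hx])
  have hder : ∀ (c : ℂ), ∀ x ∈ s,
      HasDerivAt (fun x => (ζ + x) ^ c) (c * (ζ + x) ^ (c - 1)) x := by
    intro c x hx
    have h1 : HasDerivAt (fun x : ℂ => ζ + x) 1 x := (hasDerivAt_id x).const_add ζ
    have h2 := h1.cpow_const (c := c) (hslit x hx)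
    simpa using h2
  have hb3 : ∀ x ∈ s, ‖(p : ℂ) * (p - 1) * ((p - 1 - 1) * (ζ + x) ^ ((p : ℂ) - 1 - 1 - 1))‖
      ≤ M := by
    intro x hx
    have h1 : (p : ℂ) - 1 - 1 - 1 = ((p - 3 : ℝ) : ℂ) := by push_cast; ring
    have h2 : (p : ℂ) * (p - 1) * ((p - 1 - 1) * (ζ + x) ^ ((p : ℂ) - 1 - 1 - 1))
        = ((p * (p - 1) * (p - 2) : ℝ) : ℂ) * (ζ + x) ^ ((p - 3 : ℝ) : ℂ) := by
      rw [h1]; push_cast; ring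
    rw [h2, norm_mul, Complex.norm_real, Real.norm_eq_abs, abs_mul, abs_mul, hM]
    apply mul_le_mul_of_nonneg_left _ (by positivity)
    have hz : ζ + x ≠ 0 := Complex.slitPlane_ne_zero (hslit x hx)
    rw [Complex.norm_cpow_of_ne_zero hz]
    simp only [Complex.ofReal_re, Complex.ofReal_im, mul_zero, Real.exp_zero, div_one]
    apply Real.rpow_le_rpow_of_nonpos (by positivity)
    · exact (hre x hx).trans ((le_abs_self _).trans (Complex.abs_re_le_norm _))
    · linarith
  have hb2 : ∀ x ∈ s, ‖(p : ℂ) * (p - 1) * (ζ + x) ^ ((p : ℂ) - 1 - 1)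
      - p * (p - 1) * ζ ^ ((p : ℂ) - 1 - 1)‖ ≤ M * ‖σ‖ := by
    intro x hx
    have h := hcs.norm_image_sub_le_of_norm_hasDerivWithin_le
      (f := fun x => (p : ℂ) * (p - 1) * (ζ + x) ^ ((p : ℂ) - 1 - 1))
      (fun y hy => ((hder ((p : ℂ) - 1 - 1) y hy).const_mul _).hasDerivWithinAt)
      hb3 h0s hx
    simp only [add_zero, sub_zero] at h
    exact h.trans (mul_le_mul_of_nonneg_left (hns x hx) (by positivity))
  have hb1 : ∀ x ∈ s, ‖(p : ℂ) * (ζ + x) ^ ((p : ℂ) - 1) - p * ζ ^ ((p : ℂ) - 1)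
      - p * (p - 1) * ζ ^ ((p : ℂ) - 1 - 1) * x‖ ≤ M * ‖σ‖ ^ 2 := by
    intro x hx
    have h := hcs.norm_image_sub_le_of_norm_hasDerivWithin_le
      (f := fun x => (p : ℂ) * (ζ + x) ^ ((p : ℂ) - 1)
        - p * (p - 1) * ζ ^ ((p : ℂ) - 1 - 1) * x)
      (f' := fun x => (p : ℂ) * (p - 1) * (ζ + x) ^ ((p : ℂ) - 1 - 1)
        - p * (p - 1) * ζ ^ ((p : ℂ) - 1 - 1))
      (fun y hy => by
        have h1 := ((hder ((p : ℂ) - 1) y hy).const_mul (p : ℂ)).sub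
          ((hasDerivAt_id y).const_mul ((p : ℂ) * (p - 1) * ζ ^ ((p : ℂ) - 1 - 1)))
        refine (h1.congr_deriv ?_).hasDerivWithinAt
        ring)
      hb2 h0s hx
    simp only [add_zero, sub_zero, mul_zero] at h
    have h2 : M * ‖σ‖ * ‖x‖ ≤ M * ‖σ‖ ^ 2 := by
      rw [pow_two, ← mul_assoc]
      exact mul_le_mul_of_nonneg_left (hns x hx) (by positivity)
    refine le_trans (le_of_eq ?_) (h.trans h2)
    congr 1; ring
  have h := hcs.norm_image_sub_le_of_norm_hasDerivWithin_le
    (f := fun x => (ζ + x) ^ (p : ℂ) - p * ζ ^ ((p : ℂ) - 1) * x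
      - p * (p - 1) / 2 * ζ ^ ((p : ℂ) - 1 - 1) * x ^ 2)
    (f' := fun x => (p : ℂ) * (ζ + x) ^ ((p : ℂ) - 1) - p * ζ ^ ((p : ℂ) - 1)
      - p * (p - 1) * ζ ^ ((p : ℂ) - 1 - 1) * x)
    (fun y hy => by
      have h1 := ((hder (p : ℂ) y hy).sub
        ((hasDerivAt_id y).const_mul ((p : ℂ) * ζ ^ ((p : ℂ) - 1)))).sub
        ((hasDerivAt_pow 2 y).const_mul ((p : ℂ) * (p - 1) / 2 * ζ ^ ((p : ℂ) - 1 - 1)))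
      refine (h1.congr_deriv ?_).hasDerivWithinAt
      simp; ring)
    hb1 h0s hσs
  simp only [add_zero, sub_zero, mul_zero] at h
  refine le_trans (le_of_eq ?_) (h.trans (le_of_eq (by ring)))
  congr 1; ring

/-- The real part of the `p`-th power of `z`, reflected and shifted so that it is subharmonic
on the plane. -/
def foldedPow (p δ : ℝ) (z : ℂ) : ℝ :=
  ((((|z.re| + δ : ℝ) : ℂ) + z.im * Complex.I) ^ (p : ℂ)).re

lemma cpow_re_le_foldedPow {p δ : ℝ} (hp : 1 < p) (hp2 : p ≤ 2) (hδ : 0 < δ) {z : ℂ}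
    (hz : -δ < z.re) : ((z + δ) ^ (p : ℂ)).re ≤ foldedPow p δ z := by
  have h := cpow_re_monotoneOn hp hp2 z.im (a := z.re + δ) (b := |z.re| + δ)
    (by simp; linarith) (by simp only [Set.mem_Ioi]; positivity) (by linarith [le_abs_self z.re])
  refine le_trans (le_of_eq ?_) h
  congr 2
  apply Complex.ext <;> simp

lemma foldedPow_four_point {p δ : ℝ} (hp : 1 < p) (hp2 : p ≤ 2) (hδ : 0 < δ) :
    ∃ M : ℝ, 0 ≤ M ∧ ∀ z τ : ℂ, ‖τ‖ ≤ δ / 2 →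
      4 * foldedPow p δ z - M * ‖τ‖ ^ 3 ≤
        foldedPow p δ (z + τ) + foldedPow p δ (z - τ)
        + foldedPow p δ (z + Complex.I * τ) + foldedPow p δ (z - Complex.I * τ) := by
  obtain ⟨M, hM, hT⟩ := norm_cpow_taylor_two_le hp2 hδ
  refine ⟨4 * M, by positivity, ?_⟩
  have key : ∀ z τ : ℂ, 0 ≤ z.re → ‖τ‖ ≤ δ / 2 →
      4 * foldedPow p δ z - 4 * M * ‖τ‖ ^ 3 ≤
        foldedPow p δ (z + τ) + foldedPow p δ (z - τ)
        + foldedPow p δ (z + Complex.I * τ) + foldedPow p δ (z - Complex.I * τ) := by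
    intro z τ hz hτ
    have hlow : ∀ σ : ℂ, ‖σ‖ ≤ δ / 2 →
        (((z + δ) + σ) ^ (p : ℂ)).re ≤ foldedPow p δ (z + σ) := by
      intro σ hσ
      have h1 := (abs_le.1 (Complex.abs_re_le_norm σ)).1
      have h2 := cpow_re_le_foldedPow hp hp2 hδ (z := z + σ) (by simp; linarith)
      rwa [show z + δ + σ = z + σ + δ by ring]
    have h0 : foldedPow p δ z = ((z + δ) ^ (p : ℂ)).re := by
      unfold foldedPow
      rw [abs_of_nonneg hz]
      congr 2
      apply Complex.ext <;> simp
    have hζ : δ ≤ (z + δ).re := by simpa using hz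
    have hIτ : ‖Complex.I * τ‖ = ‖τ‖ := by simp
    set ζ := z + (δ : ℂ)
    have hre : ∀ σ : ℂ, ‖σ‖ = ‖τ‖ → (ζ ^ (p : ℂ) + p * ζ ^ ((p : ℂ) - 1) * σ
        + p * (p - 1) / 2 * ζ ^ ((p : ℂ) - 1 - 1) * σ ^ 2).re - M * ‖τ‖ ^ 3
        ≤ foldedPow p δ (z + σ) := by
      intro σ hσ
      have h1 := hT ζ σ hζ (hσ.trans_le hτ)
      have h2 := (abs_le.1 ((Complex.abs_re_le_norm _).trans h1)).1
      have h3 := hlow σ (hσ.trans_le hτ)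
      rw [hσ] at h2
      simp only [Complex.add_re, Complex.sub_re] at h2 ⊢
      linarith
    have a1 := hre τ rfl
    have a2 := hre (-τ) (norm_neg _)
    have a3 := hre (Complex.I * τ) hIτ
    have a4 := hre (-(Complex.I * τ)) (by rw [norm_neg, hIτ])
    rw [← sub_eq_add_neg] at a2 a4
    have hsum : (ζ ^ (p : ℂ) + p * ζ ^ ((p : ℂ) - 1) * τ
        + p * (p - 1) / 2 * ζ ^ ((p : ℂ) - 1 - 1) * τ ^ 2).re
        + (ζ ^ (p : ℂ) + p * ζ ^ ((p : ℂ) - 1) * (-τ)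
        + p * (p - 1) / 2 * ζ ^ ((p : ℂ) - 1 - 1) * (-τ) ^ 2).re
        + (ζ ^ (p : ℂ) + p * ζ ^ ((p : ℂ) - 1) * (Complex.I * τ)
        + p * (p - 1) / 2 * ζ ^ ((p : ℂ) - 1 - 1) * (Complex.I * τ) ^ 2).re
        + (ζ ^ (p : ℂ) + p * ζ ^ ((p : ℂ) - 1) * (-(Complex.I * τ))
        + p * (p - 1) / 2 * ζ ^ ((p : ℂ) - 1 - 1) * (-(Complex.I * τ)) ^ 2).re
        = 4 * (ζ ^ (p : ℂ)).re := by
      rw [← Complex.add_re, ← Complex.add_re, ← Complex.add_re]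
      have : (4 : ℝ) * (ζ ^ (p : ℂ)).re = (4 * ζ ^ (p : ℂ)).re := by simp
      rw [this]
      congr 1
      linear_combination ((p : ℂ) * (p - 1) * ζ ^ ((p : ℂ) - 1 - 1) * τ ^ 2) * Complex.I_sq
    rw [h0]
    linarith
  intro z τ hτ
  rcases le_total 0 z.re with hz | hz
  · exact key z τ hz hτ
  · have hrefl : ∀ w : ℂ, foldedPow p δ (-(starRingEnd ℂ) w) = foldedPow p δ w := by
      intro w; simp [foldedPow]
    have h := key (-(starRingEnd ℂ) z) (-(starRingEnd ℂ) τ) (by simpa using hz) (by simpa using hτ)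
    rw [← hrefl (z + τ), ← hrefl (z - τ), ← hrefl (z + Complex.I * τ),
      ← hrefl (z - Complex.I * τ), ← hrefl z]
    have e1 : -(starRingEnd ℂ) (z + τ) = -(starRingEnd ℂ) z + -(starRingEnd ℂ) τ := by simp; ring
    have e2 : -(starRingEnd ℂ) (z - τ) = -(starRingEnd ℂ) z - -(starRingEnd ℂ) τ := by simp; ring
    have e3 : -(starRingEnd ℂ) (z + Complex.I * τ)
        = -(starRingEnd ℂ) z - Complex.I * -(starRingEnd ℂ) τ := by simp; ring
    have e4 : -(starRingEnd ℂ) (z - Complex.I * τ)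
        = -(starRingEnd ℂ) z + Complex.I * -(starRingEnd ℂ) τ := by simp; ring
    rw [e1, e2, e3, e4]
    simp only [norm_neg, RCLike.norm_conj] at h
    linarith

lemma foldedPow_convexOn {p δ : ℝ} (hp : 1 < p) (hp2 : p ≤ 2) (hδ : 0 < δ) (n : ℝ) :
    ConvexOn ℝ Set.univ (fun x : ℝ => foldedPow p δ (x + n * Complex.I)) := by
  have himg : (fun x : ℝ => |x| + δ) '' Set.univ ⊆ Set.Ioi 0 := by
    rintro _ ⟨x, -, rfl⟩
    simp only [Set.mem_Ioi]; positivity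
  have habs : ConvexOn ℝ Set.univ (fun x : ℝ => |x| + δ) := by
    have : ConvexOn ℝ Set.univ (fun x : ℝ => ‖x‖) := convexOn_univ_norm
    exact this.add_const δ
  have himg2 : Convex ℝ ((fun x : ℝ => |x| + δ) '' Set.univ) := by
    rw [Set.image_univ]
    apply IsPreconnected.convex
    exact isPreconnected_range (by fun_prop)
  have := ConvexOn.comp ((cpow_re_convexOn hp hp2 n).subset himg himg2) habs
    ((cpow_re_monotoneOn hp hp2 n).mono himg)
  refine this.congr (fun x _ => ?_)
  simp [foldedPow]

section

open scoped ContDiff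

open scoped ContDiff

/-- The signed area of the parallelogram spanned by two plane vectors. -/
def planeDet (e f : ℝ × ℝ) : ℝ := e.1 * f.2 - f.1 * e.2

/-- Nonnegative smooth convex functions on the plane whose Hessian dominates the area form. -/
structure AreaConvex (F : ℝ × ℝ → ℝ) : Prop where
  contDiff : ContDiff ℝ ∞ F
  nonneg : ∀ v, 0 ≤ F v
  convex : ConvexOn ℝ Set.univ F
  hessian : ∀ v e f, 2 * planeDet e f
    ≤ fderiv ℝ (fderiv ℝ F) v e e + fderiv ℝ (fderiv ℝ F) v f f

lemma hasDerivAt_comp_line {F : ℝ × ℝ → ℝ} (hF : ContDiff ℝ ∞ F) (v e : ℝ × ℝ) (t : ℝ) :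
    HasDerivAt (fun t : ℝ => F (v + t • e)) (fderiv ℝ F (v + t • e) e) t := by
  have h1 : HasDerivAt (fun t : ℝ => v + t • e) e t := by
    simpa using ((hasDerivAt_id t).smul_const e).const_add v
  exact ((hF.differentiable (by simp)) (v + t • e)).hasFDerivAt.comp_hasDerivAt t h1

lemma hasDerivAt_fderiv_comp_line {F : ℝ × ℝ → ℝ} (hF : ContDiff ℝ ∞ F) (v e : ℝ × ℝ) (t : ℝ) :
    HasDerivAt (fun t : ℝ => fderiv ℝ F (v + t • e) e)
      (fderiv ℝ (fderiv ℝ F) (v + t • e) e e) t := by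
  have h1 : HasDerivAt (fun t : ℝ => v + t • e) e t := by
    simpa using ((hasDerivAt_id t).smul_const e).const_add v
  have h2 : Differentiable ℝ (fderiv ℝ F) :=
    (hF.fderiv_right (m := 1) (by norm_cast)).differentiable (by simp)
  have h3 := (h2 (v + t • e)).hasFDerivAt.comp_hasDerivAt t h1
  simpa using h3.clm_apply (hasDerivAt_const t e)

lemma two_planeDet_le_hessian {F : ℝ × ℝ → ℝ} (hF : ContDiff ℝ ∞ F) {M r : ℝ} (hr : 0 < r)
    (hfp : ∀ v e f : ℝ × ℝ, e.1 ^ 2 + f.1 ^ 2 ≤ r ^ 2 →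
      4 * F v + 2 * planeDet e f - M * Real.sqrt (e.1 ^ 2 + f.1 ^ 2) ^ 3
        ≤ F (v + e) + F (v - e) + F (v + f) + F (v - f)) (v e f : ℝ × ℝ) :
    2 * planeDet e f ≤ fderiv ℝ (fderiv ℝ F) v e e + fderiv ℝ (fderiv ℝ F) v f f := by
  by_contra! hlt
  set H := fderiv ℝ (fderiv ℝ F) v e e + fderiv ℝ (fderiv ℝ F) v f f with hH
  set d := planeDet e f with hd
  set ε := (2 * d - H) / 2 with hε
  have hε0 : 0 < ε := by rw [hε]; linarith
  set N := Real.sqrt (e.1 ^ 2 + f.1 ^ 2) with hN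
  have hN0 : 0 ≤ N := Real.sqrt_nonneg _
  have hNsq : N ^ 2 = e.1 ^ 2 + f.1 ^ 2 := Real.sq_sqrt (by positivity)
  let G : ℝ → ℝ := fun t => F (v + t • e) + F (v + t • (-e)) + F (v + t • f) + F (v + t • (-f))
    - 4 * F v - 2 * t ^ 2 * d + ε * t ^ 2
  let G1 : ℝ → ℝ := fun t => fderiv ℝ F (v + t • e) e + fderiv ℝ F (v + t • (-e)) (-e)
    + fderiv ℝ F (v + t • f) f + fderiv ℝ F (v + t • (-f)) (-f) - 4 * t * d + 2 * ε * t
  have hG : ∀ t, HasDerivAt G (G1 t) t := by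
    intro t
    have h := ((((((hasDerivAt_comp_line hF v e t).add (hasDerivAt_comp_line hF v (-e) t)).add
      (hasDerivAt_comp_line hF v f t)).add (hasDerivAt_comp_line hF v (-f) t)).sub_const
      (4 * F v)).sub (((hasDerivAt_pow 2 t).const_mul 2).mul_const d)).add
      ((hasDerivAt_pow 2 t).const_mul ε)
    refine h.congr_deriv ?_
    simp only [G1]; push_cast; ring
  have hG1 : HasDerivAt G1 (2 * H - 4 * d + 2 * ε) 0 := by
    have h := (((((hasDerivAt_fderiv_comp_line hF v e 0).add
      (hasDerivAt_fderiv_comp_line hF v (-e) 0)).add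
      (hasDerivAt_fderiv_comp_line hF v f 0)).add
      (hasDerivAt_fderiv_comp_line hF v (-f) 0)).sub
      (((hasDerivAt_id (0 : ℝ)).const_mul 4).mul_const d)).add
      ((hasDerivAt_id (0 : ℝ)).const_mul (2 * ε))
    refine h.congr_deriv ?_
    simp only [zero_smul, add_zero, map_neg, neg_apply, neg_neg, hH]
    ring
  have hderiv : deriv G = G1 := funext fun t => (hG t).deriv
  have hdd : deriv (deriv G) 0 < 0 := by
    rw [hderiv, hG1.deriv, hε]; linarith
  have hd0 : deriv G 0 = 0 := by
    rw [hderiv]; simp [G1]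
  have hG0 : G 0 = 0 := by simp [G]; ring
  have hmax := isLocalMax_of_deriv_deriv_neg hdd hd0 (hG 0).continuousAt
  have hpos : ∀ᶠ t in nhds (0 : ℝ), 0 ≤ G t := by
    have hρ : 0 < min (r / (N + 1)) (ε / (|M| * N ^ 3 + 1)) := by positivity
    filter_upwards [Metric.ball_mem_nhds (0 : ℝ) hρ] with t ht
    rw [Metric.mem_ball, Real.dist_eq, sub_zero, lt_min_iff, lt_div_iff₀ (by positivity),
      lt_div_iff₀ (by positivity)] at ht
    obtain ⟨ht1, ht2⟩ := ht
    have hsq : Real.sqrt ((t • e).1 ^ 2 + (t • f).1 ^ 2) = |t| * N := by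
      rw [hN, ← Real.sqrt_sq_eq_abs, ← Real.sqrt_mul (sq_nonneg t)]
      congr 1; simp; ring
    have h1 : (t • e).1 ^ 2 + (t • f).1 ^ 2 ≤ r ^ 2 := by
      have : (t • e).1 ^ 2 + (t • f).1 ^ 2 = (|t| * N) ^ 2 := by
        rw [mul_pow, sq_abs, hNsq]; simp; ring
      rw [this]
      gcongr
      nlinarith [abs_nonneg t]
    have h2 := hfp v (t • e) (t • f) h1
    rw [hsq] at h2
    have hdet : planeDet (t • e) (t • f) = t ^ 2 * d := by
      rw [hd]; simp [planeDet]; ring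
    rw [hdet] at h2
    simp only [G, smul_neg, ← sub_eq_add_neg]
    have h3 : M * (|t| * N) ^ 3 ≤ ε * t ^ 2 := by
      have : M * (|t| * N) ^ 3 ≤ |t| * (|M| * N ^ 3) * t ^ 2 := by
        rw [← sq_abs t]
        have := mul_le_mul_of_nonneg_right (le_abs_self M) (show 0 ≤ (|t| * N) ^ 3 by positivity)
        linarith
      refine this.trans ?_
      gcongr
      nlinarith [abs_nonneg t]
    linarith
  have hzero : G =ᶠ[nhds 0] fun _ => 0 := by
    filter_upwards [hmax, hpos] with t h1 h2
    rw [hG0] at h1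
    exact le_antisymm h1 h2
  have : deriv (deriv G) 0 = 0 := by
    rw [hzero.deriv.deriv_eq]; simp
  linarith

lemma exists_areaConvex_mollification {B : ℝ × ℝ → ℝ} (hconv : ConvexOn ℝ Set.univ B)
    (h0 : ∀ v, 0 ≤ B v) {M r : ℝ} (hr : 0 < r)
    (hfp : ∀ v e f : ℝ × ℝ, e.1 ^ 2 + f.1 ^ 2 ≤ r ^ 2 →
      4 * B v + 2 * planeDet e f - M * Real.sqrt (e.1 ^ 2 + f.1 ^ 2) ^ 3
        ≤ B (v + e) + B (v - e) + B (v + f) + B (v - f)) {δ : ℝ} (hδ : 0 < δ) :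
    ∃ F : ℝ × ℝ → ℝ, AreaConvex F ∧
      ∀ v c, (∀ s : ℝ × ℝ, ‖s‖ ≤ δ → B (v - s) ≤ c) → F v ≤ c := by
  have hBc : Continuous B := continuousOn_univ.1 (hconv.continuousOn isOpen_univ)
  let φ : ContDiffBump (0 : ℝ × ℝ) := ⟨δ / 2, δ, by positivity, by linarith⟩
  let η : ℝ × ℝ → ℝ := φ.normed volume
  have hη0 : ∀ s, 0 ≤ η s := fun s => φ.nonneg_normed s
  have hηc : Continuous η := φ.continuous_normed
  have hηs : HasCompactSupport η := φ.hasCompactSupport_normed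
  have hη1 : ∫ s, η s = 1 := φ.integral_normed
  have hInt : ∀ g : ℝ × ℝ → ℝ, Continuous g → Integrable fun s => η s * g s := fun g hg =>
    (hηc.mul hg).integrable_of_hasCompactSupport hηs.mul_right
  let F : ℝ × ℝ → ℝ := fun v => ∫ s, η s * B (v - s)
  have hBv : ∀ v, Continuous fun s => B (v - s) := fun v => hBc.comp (by fun_prop)
  have hFs : ContDiff ℝ ∞ F := by
    have := hηs.contDiff_convolution_left (n := ⊤) (ContinuousLinearMap.lsmul ℝ ℝ)
      (μ := volume) (φ.contDiff_normed) hBc.locallyIntegrable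
    exact this
  refine ⟨F, ⟨hFs, fun v => integral_nonneg fun s => mul_nonneg (hη0 s) (h0 _), ?_, ?_⟩, ?_⟩
  · refine ⟨convex_univ, fun x _ y _ a b ha hb hab => ?_⟩
    simp only [F, smul_eq_mul]
    rw [← integral_const_mul, ← integral_const_mul, ← integral_add
      ((hInt _ (hBv x)).const_mul a) ((hInt _ (hBv y)).const_mul b)]
    refine integral_mono (hInt _ (hBv _)) (((hInt _ (hBv x)).const_mul a).add
      ((hInt _ (hBv y)).const_mul b)) fun s => ?_
    have h := hconv.2 (Set.mem_univ (x - s)) (Set.mem_univ (y - s)) ha hb hab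
    rw [show a • (x - s) + b • (y - s) = a • x + b • y - s by
      rw [smul_sub, smul_sub, sub_add_sub_comm, ← add_smul, hab, one_smul]] at h
    have := mul_le_mul_of_nonneg_left h (hη0 s)
    simp only [smul_eq_mul] at this
    linarith
  · refine two_planeDet_le_hessian (M := M) (r := r) hFs hr fun v e f hef => ?_
    simp only [F]
    have i := fun v => hInt _ (hBv v)
    have hL : 4 * ∫ s, η s * B (v - s) = ∫ s, 4 * (η s * B (v - s)) := (integral_const_mul _ _).symm
    have hη : Integrable η := φ.integrable_normed
    have hc : ∀ c : ℝ, ∫ s, η s * c = c := fun c => by rw [integral_mul_const, hη1, one_mul]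
    have j1 : Integrable fun s => η s * B (v + e - s) + η s * B (v - e - s) := (i _).add (i _)
    have j2 : Integrable fun s => η s * B (v + e - s) + η s * B (v - e - s)
        + η s * B (v + f - s) := j1.add (i _)
    rw [hL, add_sub_assoc, ← hc (2 * planeDet e f - M * _), ← integral_add ((i v).const_mul 4)
      (hη.mul_const _), ← integral_add (i _) (i _), ← integral_add j1 (i _), ← integral_add j2 (i _)]
    refine integral_mono (((i v).const_mul 4).add (hη.mul_const _))
      (j2.add (i _)) fun s => ?_
    have h := mul_le_mul_of_nonneg_left (hfp (v - s) e f hef) (hη0 s)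
    rw [show v - s + e = v + e - s by abel, show v - s - e = v - e - s by abel,
      show v - s + f = v + f - s by abel, show v - s - f = v - f - s by abel] at h
    dsimp only
    linarith
  · intro v c hc
    have hη : Integrable η := φ.integrable_normed
    calc F v ≤ ∫ s, η s * c := by
          refine integral_mono (hInt _ (hBv v)) (hη.mul_const c) fun s => ?_
          by_cases hs : η s = 0
          · simp [hs]
          · have : s ∈ Function.support η := hs
            rw [show Function.support η = Metric.ball 0 δ from φ.support_normed_eq] at this
            exact mul_le_mul_of_nonneg_left (hc s (mem_ball_zero_iff.1 this).le) (hη0 s)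
      _ = c := by rw [integral_mul_const, hη1, one_mul]

/-- The value of the Bellman function at a fixed dual parameter. -/
def bellmanTerm (p δ : ℝ) (v : ℝ × ℝ) (n : ℝ) : ℝ :=
  n * v.2 + pichoridesConst p / p * foldedPow p δ (v.1 + n * Complex.I)

/-- A convex majorant for the area form on the plane. -/
def bellman (p δ : ℝ) (v : ℝ × ℝ) : ℝ := ⨆ n : ℝ, bellmanTerm p δ v n

lemma bellmanTerm_le {p q δ : ℝ} (hp : 1 < p) (hp2 : p ≤ 2) (hpq : p.HolderConjugate q)
    (hδ : 0 < δ) (v : ℝ × ℝ) (n : ℝ) :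
    bellmanTerm p δ v n ≤ Real.tan (Real.pi / (2 * p)) ^ p * (|v.1| + δ) ^ p / p
      + |v.2| ^ q / q := by
  have hp0 : 0 < p := by linarith
  have h := pichorides_halfPlane hp hp2 (z := ((|v.1| + δ : ℝ) : ℂ) + n * Complex.I)
    (by simp; positivity)
  have hy := Real.young_inequality n v.2 hpq
  have h2 : bellmanTerm p δ v n
      = n * v.2 + (pichoridesConst p * ((((|v.1| + δ : ℝ) : ℂ) + n * Complex.I) ^ (p : ℂ)).re) / p := by
    simp [bellmanTerm, foldedPow]; ring
  rw [h2]
  simp only [Complex.add_im, Complex.ofReal_im, Complex.mul_im, Complex.ofReal_re, Complex.I_im,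
    Complex.I_re, mul_one, mul_zero, add_zero, zero_add, Complex.add_re, Complex.mul_re,
    sub_zero] at h
  have h3 := div_le_div_of_nonneg_right h hp0.le
  rw [add_div] at h3
  linarith

lemma bddAbove_bellmanTerm {p q δ : ℝ} (hp : 1 < p) (hp2 : p ≤ 2) (hpq : p.HolderConjugate q)
    (hδ : 0 < δ) (v : ℝ × ℝ) : BddAbove (Set.range (bellmanTerm p δ v)) :=
  ⟨_, by rintro _ ⟨n, rfl⟩; exact bellmanTerm_le hp hp2 hpq hδ v n⟩

lemma exists_areaConvex_le {p q δ : ℝ} (hp : 1 < p) (hp2 : p ≤ 2) (hpq : p.HolderConjugate q)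
    (hδ : 0 < δ) : ∃ F : ℝ × ℝ → ℝ, AreaConvex F ∧ ∀ v : ℝ × ℝ,
      F v ≤ Real.tan (Real.pi / (2 * p)) ^ p * (|v.1| + 2 * δ) ^ p / p
        + (|v.2| + δ) ^ q / q := by
  have hp0 : 0 < p := by linarith
  have hq0 : 0 < q := hpq.symm.pos
  have hK := pichoridesConst_pos hp
  have hbdd := bddAbove_bellmanTerm hp hp2 hpq hδ
  have htan : 0 ≤ Real.tan (Real.pi / (2 * p)) :=
    (Real.tan_pos_of_pos_of_lt_pi_div_two (pichorides_angle_mem hp).1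
      (pichorides_angle_mem hp).2).le
  obtain ⟨M, hM, hfp⟩ := foldedPow_four_point hp hp2 hδ
  have hconv : ConvexOn ℝ Set.univ (bellman p δ) := by
    refine ⟨convex_univ, fun x _ y _ a b ha hb hab => ciSup_le fun n => ?_⟩
    have h1 := (foldedPow_convexOn hp hp2 hδ n).2 (Set.mem_univ x.1) (Set.mem_univ y.1) ha hb hab
    have hx := mul_le_mul_of_nonneg_left (le_ciSup (hbdd x) n) ha
    have hy := mul_le_mul_of_nonneg_left (le_ciSup (hbdd y) n) hb
    simp only [smul_eq_mul] at h1 ⊢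
    refine le_trans ?_ (add_le_add hx hy)
    simp only [bellmanTerm, Prod.fst_add, Prod.snd_add, Prod.smul_fst, Prod.smul_snd, smul_eq_mul]
    have h2 := mul_le_mul_of_nonneg_left h1 (show 0 ≤ pichoridesConst p / p by positivity)
    linarith
  have hnn : ∀ v, 0 ≤ bellman p δ v := fun v => by
    refine le_trans ?_ (le_ciSup (hbdd v) 0)
    simp only [bellmanTerm, foldedPow]
    have : (((((|v.1| + δ : ℝ) : ℂ)) ^ (p : ℂ))).re = (|v.1| + δ) ^ p := by
      rw [← Complex.ofReal_cpow (by positivity)]; simp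
    simp only [Complex.ofReal_zero, zero_mul, add_zero, Complex.ofReal_re, Complex.ofReal_im,
      zero_add, this]
    positivity
  obtain ⟨F, hF, hFle⟩ := exists_areaConvex_mollification hconv hnn (half_pos hδ)
    (M := pichoridesConst p / p * M) (fun v e f hef => by
      set τ : ℂ := e.1 - f.1 * Complex.I with hτ
      have hnτ : ‖τ‖ = Real.sqrt (e.1 ^ 2 + f.1 ^ 2) := by
        rw [Complex.norm_eq_sqrt_sq_add_sq]; simp [hτ]
      have hle : ‖τ‖ ≤ δ / 2 := by
        rw [hnτ]; exact Real.sqrt_le_iff.2 ⟨by positivity, hef⟩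
      rw [← hnτ]
      have key : ∀ n, 4 * bellmanTerm p δ v n ≤ bellman p δ (v + e) + bellman p δ (v - e)
          + bellman p δ (v + f) + bellman p δ (v - f)
          - (2 * planeDet e f - pichoridesConst p / p * M * ‖τ‖ ^ 3) := by
        intro n
        have h1 : bellmanTerm p δ (v + e) (n - f.1) ≤ bellman p δ (v + e) := le_ciSup (hbdd (v + e)) (n - f.1)
        have h2 : bellmanTerm p δ (v - e) (n + f.1) ≤ bellman p δ (v - e) := le_ciSup (hbdd (v - e)) (n + f.1)
        have h3 : bellmanTerm p δ (v + f) (n + e.1) ≤ bellman p δ (v + f) := le_ciSup (hbdd (v + f)) (n + e.1)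
        have h4 : bellmanTerm p δ (v - f) (n - e.1) ≤ bellman p δ (v - f) := le_ciSup (hbdd (v - f)) (n - e.1)
        have h5 := mul_le_mul_of_nonneg_left (hfp (v.1 + n * Complex.I) τ hle)
          (show 0 ≤ pichoridesConst p / p by positivity)
        have e1 : (v.1 : ℂ) + n * Complex.I + τ
          = ((v + e).1 : ℝ) + ((n - f.1 : ℝ) : ℂ) * Complex.I := by
            rw [hτ]; push_cast [Prod.fst_add]; ring
        have e2 : (v.1 : ℂ) + n * Complex.I - τ
          = ((v - e).1 : ℝ) + ((n + f.1 : ℝ) : ℂ) * Complex.I := by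
            rw [hτ]; push_cast [Prod.fst_sub]; ring
        have e3 : (v.1 : ℂ) + n * Complex.I + Complex.I * τ
          = ((v + f).1 : ℝ) + ((n + e.1 : ℝ) : ℂ) * Complex.I := by
            rw [hτ]; push_cast [Prod.fst_add]
            linear_combination (-(f.1 : ℂ)) * Complex.I_sq
        have e4 : (v.1 : ℂ) + n * Complex.I - Complex.I * τ
          = ((v - f).1 : ℝ) + ((n - e.1 : ℝ) : ℂ) * Complex.I := by
            rw [hτ]; push_cast [Prod.fst_sub]
            linear_combination ((f.1 : ℂ)) * Complex.I_sq
        rw [e1, e2, e3, e4] at h5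
        simp only [bellmanTerm, planeDet, Prod.snd_add, Prod.snd_sub] at h1 h2 h3 h4 ⊢
        linarith
      have := ciSup_le (fun n => (le_div_iff₀' (show (0 : ℝ) < 4 by norm_num)).2 (key n))
      have h6 : bellman p δ v ≤ _ := this
      linarith) hδ
  refine ⟨F, hF, fun v => hFle v _ fun s hs => ciSup_le fun n =>
    (bellmanTerm_le hp hp2 hpq hδ (v - s) n).trans ?_⟩
  have hs1 : |s.1| ≤ δ := (norm_fst_le s).trans hs
  have hs2 : |s.2| ≤ δ := (norm_snd_le s).trans hs
  have a1 : |(v - s).1| + δ ≤ |v.1| + 2 * δ := by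
    have := abs_sub v.1 s.1
    simp only [Prod.fst_sub]; linarith
  have a2 : |(v - s).2| ≤ |v.2| + δ := by
    have := abs_sub v.2 s.2
    simp only [Prod.snd_sub]; linarith
  gcongr

end

lemma tangent_le_of_deriv2_nonneg {I I1 I2 : ℝ → ℝ}
    (hI : ∀ c, 0 < c → HasDerivAt I (I1 c) c) (hI1 : ∀ c, 0 < c → HasDerivAt I1 (I2 c) c)
    (h2 : ∀ c, 0 < c → 0 ≤ I2 c) {c t : ℝ} (hc : 0 < c) (ht : 0 < t) :
    I c + I1 c * (t - c) ≤ I t := by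
  have hmono : MonotoneOn I1 (Set.Ioi 0) := by
    refine monotoneOn_of_deriv_nonneg (convex_Ioi 0)
      (fun x hx => (hI1 x hx).continuousAt.continuousWithinAt) (fun x hx => ?_) (fun x hx => ?_)
    · rw [interior_Ioi] at hx
      exact (hI1 x hx).differentiableAt.differentiableWithinAt
    · rw [interior_Ioi] at hx
      rw [(hI1 x hx).deriv]; exact h2 x hx
  rcases lt_trichotomy t c with h | h | h
  · obtain ⟨x, hx, he⟩ := exists_hasDerivAt_eq_slope I I1 h
      (fun x hx => (hI x (ht.trans_le hx.1)).continuousAt.continuousWithinAt)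
      (fun x hx => hI x (ht.trans hx.1))
    have h1 := hmono (ht.trans hx.1) hc hx.2.le
    rw [he, div_le_iff₀ (by linarith)] at h1
    linarith
  · subst h; simp
  · obtain ⟨x, hx, he⟩ := exists_hasDerivAt_eq_slope I I1 h
      (fun x hx => (hI x (hc.trans_le hx.1)).continuousAt.continuousWithinAt)
      (fun x hx => hI x (hc.trans hx.1))
    have h1 := hmono hc (hc.trans hx.1) hx.1.le
    rw [he, le_div_iff₀ (by linarith)] at h1
    linarith

lemma sub_le_of_deriv_le_mul_deriv2 {I I1 I2 Ψ Ψ1 : ℝ → ℝ} {K : ℝ}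
    (hI : ∀ c, 0 < c → HasDerivAt I (I1 c) c) (hI1 : ∀ c, 0 < c → HasDerivAt I1 (I2 c) c)
    (h0 : ∀ c, 0 < c → 0 ≤ I c) (hK : ∀ c, 0 < c → I c ≤ K)
    (h2 : ∀ c, 0 < c → 0 ≤ I2 c) (hΨ : ∀ c, 0 < c → HasDerivAt Ψ (Ψ1 c) c)
    (hle : ∀ c, 0 < c → Ψ1 c ≤ c * I2 c) {ε Y : ℝ} (hε : 0 < ε) (hY : ε ≤ Y) :
    Ψ Y - Ψ ε ≤ K := by
  have tan := fun c t hc ht => tangent_le_of_deriv2_nonneg hI hI1 h2 (c := c) (t := t) hc ht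
  have hI1np : ∀ c, 0 < c → I1 c ≤ 0 := by
    intro c hc
    by_contra! hpos
    have hK0 : 0 ≤ K := (h0 1 one_pos).trans (hK 1 one_pos)
    have ht : 0 < c + (K + 1) / I1 c := by positivity
    have h1 := tan c _ hc ht
    have h3 := hK _ ht
    rw [add_sub_cancel_left, mul_div_cancel₀ _ hpos.ne'] at h1
    linarith [h0 c hc]
  have hJ : AntitoneOn (fun c => I c - c * I1 c + Ψ c) (Set.Ioi 0) := by
    have hd : ∀ c, 0 < c → HasDerivAt (fun c => I c - c * I1 c + Ψ c)
        (I1 c - (1 * I1 c + c * I2 c) + Ψ1 c) c := fun c hc =>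
      ((hI c hc).sub ((hasDerivAt_id c).mul (hI1 c hc))).add (hΨ c hc)
    refine antitoneOn_of_deriv_nonpos (convex_Ioi 0)
      (fun x hx => (hd x hx).continuousAt.continuousWithinAt) (fun x hx => ?_) (fun x hx => ?_)
    · rw [interior_Ioi] at hx
      exact (hd x hx).differentiableAt.differentiableWithinAt
    · rw [interior_Ioi] at hx
      rw [(hd x hx).deriv]; linarith [hle x hx]
  have h3 := hJ (show ε ∈ Set.Ioi 0 from hε) (show Y ∈ Set.Ioi 0 from hε.trans_le hY) hY
  have h4 : I ε - ε * I1 ε ≤ K := by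
    refine le_of_forall_pos_le_add fun η hη => ?_
    have ht : 0 < η / (1 - I1 ε) := div_pos hη (by linarith [hI1np ε hε])
    have h5 := tan ε _ hε ht
    have h6 := hK _ ht
    have h7 : -I1 ε * (η / (1 - I1 ε)) ≤ η := by
      rw [← mul_div_assoc, div_le_iff₀ (by linarith [hI1np ε hε])]
      linarith
    linarith
  have h5 := mul_nonneg (hε.trans_le hY).le (neg_nonneg.2 (hI1np Y (hε.trans_le hY)))
  have h6 := h0 Y (hε.trans_le hY)
  dsimp only at h3
  linarith

/-- The ratio `sinh (a c) / sinh c`. -/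
def sinhRatio (a c : ℝ) : ℝ := Real.sinh (a * c) / Real.sinh c

/-- The derivative of `sinhRatio a`. -/
def sinhRatioDeriv (a c : ℝ) : ℝ :=
  (a * sinhRatio (1 - a) c - (1 - a) * Real.cosh c * sinhRatio a c) / Real.sinh c

lemma hasDerivAt_sinhRatio (a : ℝ) {c : ℝ} (hc : 0 < c) :
    HasDerivAt (sinhRatio a) (sinhRatioDeriv a c) c := by
  have hS : Real.sinh c ≠ 0 := (Real.sinh_pos_iff.2 hc).ne'
  have h := (((hasDerivAt_id c).const_mul a).sinh).div (Real.hasDerivAt_sinh c) hS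
  refine h.congr_deriv ?_
  have h1 : Real.sinh ((1 - a) * c)
      = Real.sinh c * Real.cosh (a * c) - Real.cosh c * Real.sinh (a * c) := by
    rw [← Real.sinh_sub]; ring_nf
  simp only [sinhRatioDeriv, sinhRatio, h1, id]
  field_simp
  ring

/-- The second derivative of `sinhRatio a`. -/
def sinhRatioDeriv2 (a c : ℝ) : ℝ :=
  (a * sinhRatioDeriv (1 - a) c - (1 - a) * (Real.sinh c * sinhRatio a c
    + Real.cosh c * sinhRatioDeriv a c) - Real.cosh c * sinhRatioDeriv a c) / Real.sinh c

lemma hasDerivAt_sinhRatioDeriv (a : ℝ) {c : ℝ} (hc : 0 < c) :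
    HasDerivAt (sinhRatioDeriv a) (sinhRatioDeriv2 a c) c := by
  have hS : Real.sinh c ≠ 0 := (Real.sinh_pos_iff.2 hc).ne'
  have h := ((((hasDerivAt_sinhRatio (1 - a) hc).const_mul a).sub
    (((Real.hasDerivAt_cosh c).const_mul (1 - a)).mul (hasDerivAt_sinhRatio a hc))).div
    (Real.hasDerivAt_sinh c) hS)
  refine h.congr_deriv ?_
  simp only [sinhRatioDeriv2]
  rw [div_eq_div_iff (by positivity) hS]
  simp only [sinhRatioDeriv, Pi.sub_apply, Pi.mul_apply]
  field_simp

lemma sinhRatio_quadratic (a : ℝ) {c : ℝ} (hc : 0 < c) :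
    sinhRatio a c ^ 2 + sinhRatio (1 - a) c ^ 2
      + 2 * sinhRatio a c * sinhRatio (1 - a) c * Real.cosh c = 1 := by
  have hS : Real.sinh c ≠ 0 := (Real.sinh_pos_iff.2 hc).ne'
  have h1 : Real.sinh ((1 - a) * c)
      = Real.sinh c * Real.cosh (a * c) - Real.cosh c * Real.sinh (a * c) := by
    rw [← Real.sinh_sub]; ring_nf
  have h2 := Real.cosh_sq c
  have h3 := Real.cosh_sq (a * c)
  simp only [sinhRatio, h1]
  field_simp
  linear_combination (Real.sinh c ^ 2) * h3 - Real.sinh (a * c) ^ 2 * h2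

/-- The multiplier `c coth c - 1`. -/
def cothWeight (c : ℝ) : ℝ := (c * Real.cosh c - Real.sinh c) / Real.sinh c

/-- The derivative of `cothWeight`. -/
def cothWeightDeriv (c : ℝ) : ℝ := (Real.sinh c * Real.cosh c - c) / Real.sinh c ^ 2

lemma hasDerivAt_cothWeight {c : ℝ} (hc : 0 < c) :
    HasDerivAt cothWeight (cothWeightDeriv c) c := by
  have hS : Real.sinh c ≠ 0 := (Real.sinh_pos_iff.2 hc).ne'
  have h := (((hasDerivAt_id c).mul (Real.hasDerivAt_cosh c)).sub (Real.hasDerivAt_sinh c)).div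
    (Real.hasDerivAt_sinh c) hS
  refine h.congr_deriv ?_
  simp only [cothWeightDeriv, id, Pi.sub_apply, Pi.mul_apply]
  have h2 := Real.cosh_sq c
  congr 1
  linear_combination (-c) * h2

lemma hasDerivAt_cothWeightDeriv {c : ℝ} (hc : 0 < c) :
    HasDerivAt cothWeightDeriv (2 * cothWeight c / Real.sinh c ^ 2) c := by
  have hS : Real.sinh c ≠ 0 := (Real.sinh_pos_iff.2 hc).ne'
  have h := (((Real.hasDerivAt_sinh c).mul (Real.hasDerivAt_cosh c)).sub (hasDerivAt_id c)).div
    ((Real.hasDerivAt_sinh c).pow 2) (pow_ne_zero 2 hS)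
  refine h.congr_deriv ?_
  simp only [cothWeight, id, Pi.sub_apply, Pi.mul_apply, Pi.pow_apply]
  have h2 := Real.cosh_sq c
  push_cast
  field_simp
  linear_combination (-Real.sinh c) * h2

lemma sinh_le_mul_cosh {c : ℝ} (hc : 0 ≤ c) : Real.sinh c ≤ c * Real.cosh c := by
  have hd : ∀ x : ℝ, HasDerivAt (fun x => x * Real.cosh x - Real.sinh x)
      (1 * Real.cosh x + x * Real.sinh x - Real.cosh x) x := fun x =>
    ((hasDerivAt_id x).mul (Real.hasDerivAt_cosh x)).sub (Real.hasDerivAt_sinh x)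
  have : MonotoneOn (fun x => x * Real.cosh x - Real.sinh x) (Set.Ici 0) := by
    refine monotoneOn_of_deriv_nonneg (convex_Ici 0)
      (fun x _ => (hd x).continuousAt.continuousWithinAt)
      (fun x _ => (hd x).differentiableAt.differentiableWithinAt) (fun x hx => ?_)
    rw [interior_Ici] at hx
    rw [(hd x).deriv]
    have := mul_nonneg (le_of_lt hx) (Real.sinh_nonneg_iff.2 (le_of_lt hx))
    linarith
  have h := this (Set.mem_Ici.2 le_rfl) (show c ∈ Set.Ici 0 from hc) hc
  simp at h
  linarith

lemma mul_cosh_sub_sinh_le {c : ℝ} (hc : 0 ≤ c) :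
    c * Real.cosh c - Real.sinh c ≤ c * Real.sinh c := by
  have h1 : Real.cosh c - Real.sinh c = Real.exp (-c) := by
    rw [Real.cosh_eq, Real.sinh_eq]; ring
  have h2 : c ≤ Real.sinh c := Real.self_le_sinh_iff.2 hc
  have h3 : Real.exp (-c) ≤ 1 := Real.exp_le_one_iff.2 (by linarith)
  nlinarith

lemma cothWeight_nonneg {c : ℝ} (hc : 0 < c) : 0 ≤ cothWeight c :=
  div_nonneg (by linarith [sinh_le_mul_cosh hc.le]) (Real.sinh_pos_iff.2 hc).le

lemma cothWeight_le {c : ℝ} (hc : 0 < c) : cothWeight c ≤ c := by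
  rw [cothWeight, div_le_iff₀ (Real.sinh_pos_iff.2 hc)]
  exact mul_cosh_sub_sinh_le hc.le

lemma cothWeight_le_mul_sinh {c : ℝ} (hc : 0 < c) : cothWeight c ≤ c * Real.sinh c := by
  have hS := Real.sinh_pos_iff.2 hc
  rw [cothWeight, div_le_iff₀ hS]
  have h2 : c ≤ Real.sinh c := Real.self_le_sinh_iff.2 hc.le
  have h3 := Real.cosh_sq c
  have h4 := Real.one_le_cosh c
  have h5 : Real.cosh c - 1 ≤ Real.sinh c ^ 2 := by nlinarith
  nlinarith

lemma cothWeightDeriv_mem {c : ℝ} (hc : 0 < c) :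
    0 ≤ cothWeightDeriv c ∧ cothWeightDeriv c ≤ 1 := by
  have hS := Real.sinh_pos_iff.2 hc
  have h2 : c ≤ Real.sinh c := Real.self_le_sinh_iff.2 hc.le
  have h4 := Real.one_le_cosh c
  refine ⟨div_nonneg (by nlinarith) (by positivity), ?_⟩
  rw [cothWeightDeriv, div_le_one (by positivity)]
  have h1 : Real.cosh c - Real.sinh c = Real.exp (-c) := by
    rw [Real.cosh_eq, Real.sinh_eq]; ring
  have h5 : Real.sinh c * Real.exp (-c) ≤ c := by
    have h6 : Real.sinh c * Real.exp (-c) = (1 - Real.exp (-(2 * c))) / 2 := by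
      rw [Real.sinh_eq, div_mul_eq_mul_div, sub_mul, ← Real.exp_add, ← Real.exp_add]
      simp; ring_nf
    rw [h6]
    linarith [Real.add_one_le_exp (-(2 * c))]
  rw [← h1] at h5
  linarith

/-- The derivative of the difference of squares of complementary `sinhRatio`s. -/
def sinhRatioGapDeriv (a c : ℝ) : ℝ :=
  2 * ((2 * a - 1) * sinhRatio a c * sinhRatio (1 - a) c - Real.cosh c *
    ((1 - a) * sinhRatio a c ^ 2 - a * sinhRatio (1 - a) c ^ 2)) / Real.sinh c

/-- A primitive of `cothWeight` times the area density of a Fourier mode. -/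
def modePrimitive (a c : ℝ) : ℝ :=
  (cothWeightDeriv c * ((2 * a - 1) - (sinhRatio a c ^ 2 - sinhRatio (1 - a) c ^ 2))
    + cothWeight c * sinhRatioGapDeriv a c) / 4

lemma hasDerivAt_modePrimitive (a : ℝ) {c : ℝ} (hc : 0 < c) :
    HasDerivAt (modePrimitive a) (cothWeight c *
      ((1 - a) ^ 2 * sinhRatio a c ^ 2 - a ^ 2 * sinhRatio (1 - a) c ^ 2)) c := by
  have hS : Real.sinh c ≠ 0 := (Real.sinh_pos_iff.2 hc).ne'
  have hA := hasDerivAt_sinhRatio a hc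
  have hB := hasDerivAt_sinhRatio (1 - a) hc
  have hq := sinhRatio_quadratic a hc
  have h2 := Real.cosh_sq c
  have hT : HasDerivAt (fun c => sinhRatio a c ^ 2 - sinhRatio (1 - a) c ^ 2)
      (sinhRatioGapDeriv a c) c := by
    refine ((hA.pow 2).sub (hB.pow 2)).congr_deriv ?_
    simp only [sinhRatioDeriv, sinhRatioGapDeriv, sub_sub_cancel]
    field_simp
    ring
  have hgap : HasDerivAt (sinhRatioGapDeriv a)
      (4 * ((1 - a) ^ 2 * sinhRatio a c ^ 2 - a ^ 2 * sinhRatio (1 - a) c ^ 2)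
        - 2 * ((2 * a - 1) - (sinhRatio a c ^ 2 - sinhRatio (1 - a) c ^ 2))
          / Real.sinh c ^ 2) c := by
    refine (((((hA.const_mul (2 * a - 1)).mul hB).sub ((Real.hasDerivAt_cosh c).mul
      (((hA.pow 2).const_mul (1 - a)).sub ((hB.pow 2).const_mul a)))).const_mul 2).div
      (Real.hasDerivAt_sinh c) hS).congr_deriv ?_
    simp only [Pi.sub_apply, Pi.mul_apply, Pi.pow_apply, sinhRatioDeriv, sub_sub_cancel]
    set A := sinhRatio a c
    set B := sinhRatio (1 - a) c
    set S := Real.sinh c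
    set X := Real.cosh c
    push_cast
    field_simp
    linear_combination (2 - 4 * a) * hq + ((-2 * a - 4 * a ^ 2) * B ^ 2
      + (6 - 10 * a + 4 * a ^ 2) * A ^ 2) * h2
  refine ((((hasDerivAt_cothWeightDeriv hc).mul (hT.const_sub (2 * a - 1))).add
    ((hasDerivAt_cothWeight hc).mul hgap)).div_const 4).congr_deriv ?_
  field_simp
  ring

section

open Filter Topology

open Filter Topology

lemma tendsto_sinhRatio_zero (a : ℝ) : Tendsto (sinhRatio a) (𝓝[>] 0) (𝓝 a) := by
  have key : ∀ b : ℝ, Tendsto (fun c => Real.sinh (b * c) / c) (𝓝[>] 0) (𝓝 b) := by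
    intro b
    have h : HasDerivAt (fun c => Real.sinh (b * c)) b 0 := by
      simpa using ((hasDerivAt_id (0 : ℝ)).const_mul b).sinh
    have h2 := hasDerivAt_iff_tendsto_slope.1 h
    refine (h2.mono_left (nhdsWithin_mono _ fun x hx => ne_of_gt hx)).congr fun x => ?_
    simp [slope_def_field]
  have h := (key a).div (key 1) one_ne_zero
  rw [div_one] at h
  refine h.congr' ?_
  filter_upwards [self_mem_nhdsWithin] with c hc
  have hc : (0 : ℝ) < c := hc
  have hS : Real.sinh c ≠ 0 := (Real.sinh_pos_iff.2 hc).ne'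
  simp only [sinhRatio, one_mul, Pi.div_apply]
  field_simp

lemma tendsto_modePrimitive_zero (a : ℝ) : Tendsto (modePrimitive a) (𝓝[>] 0) (𝓝 0) := by
  have hA := tendsto_sinhRatio_zero a
  have hB := tendsto_sinhRatio_zero (1 - a)
  have hX : Tendsto Real.cosh (𝓝[>] 0) (𝓝 1) := by
    have := Real.continuous_cosh.tendsto 0
    rw [Real.cosh_zero] at this
    exact this.mono_left nhdsWithin_le_nhds
  have h1 : Tendsto (fun c => cothWeightDeriv c *
      ((2 * a - 1) - (sinhRatio a c ^ 2 - sinhRatio (1 - a) c ^ 2))) (𝓝[>] 0) (𝓝 0) := by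
    have hg : Tendsto (fun c => (2 * a - 1) - (sinhRatio a c ^ 2 - sinhRatio (1 - a) c ^ 2))
        (𝓝[>] 0) (𝓝 0) := by
      have := ((hA.pow 2).sub (hB.pow 2)).const_sub (2 * a - 1)
      rwa [show 2 * a - 1 - (a ^ 2 - (1 - a) ^ 2) = 0 by ring] at this
    have hg' := (tendsto_zero_iff_abs_tendsto_zero _).1 hg
    refine (tendsto_zero_iff_abs_tendsto_zero _).2
      (squeeze_zero' (Eventually.of_forall fun _ => abs_nonneg _) ?_ hg')
    filter_upwards [self_mem_nhdsWithin] with c hc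
    have hm := cothWeightDeriv_mem hc
    simp only [Function.comp]
    rw [abs_mul, abs_of_nonneg hm.1]
    exact mul_le_of_le_one_left (abs_nonneg _) hm.2
  have h2 : Tendsto (fun c => cothWeight c * sinhRatioGapDeriv a c) (𝓝[>] 0) (𝓝 0) := by
    have hw : Tendsto (fun c => cothWeight c / Real.sinh c) (𝓝[>] 0) (𝓝 0) := by
      refine squeeze_zero' ?_ ?_ (tendsto_id.mono_left nhdsWithin_le_nhds)
      · filter_upwards [self_mem_nhdsWithin] with c hc
        exact div_nonneg (cothWeight_nonneg hc) (Real.sinh_pos_iff.2 hc).le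
      · filter_upwards [self_mem_nhdsWithin] with c hc
        rw [div_le_iff₀ (Real.sinh_pos_iff.2 hc)]
        exact cothWeight_le_mul_sinh hc
    have hQ := (((hA.const_mul (2 * a - 1)).mul hB).sub (hX.mul
      (((hA.pow 2).const_mul (1 - a)).sub ((hB.pow 2).const_mul a)))).const_mul 2
    have := hw.mul hQ
    rw [zero_mul] at this
    refine this.congr fun c => ?_
    simp only [sinhRatioGapDeriv]
    ring
  have := (h1.add h2).div_const 4
  rw [add_zero, zero_div] at this
  exact this

lemma exp_div_four_le_sinh {c : ℝ} (hc : 1 ≤ c) : Real.exp c / 4 ≤ Real.sinh c := by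
  rw [Real.sinh_eq]
  have h1 : Real.exp (-c) * 2 ≤ Real.exp c := by
    have h2 := Real.add_one_le_exp (2 * c)
    have h3 : Real.exp c = Real.exp (-c) * Real.exp (2 * c) := by
      rw [← Real.exp_add]; ring_nf
    rw [h3]
    gcongr
    linarith
  linarith

lemma tendsto_mul_sinhRatio_atTop {a : ℝ} (ha1 : a < 1) :
    Tendsto (fun c => c * Real.exp (a * c) / Real.sinh c) atTop (𝓝 0) := by
  have h := (Real.tendsto_pow_mul_exp_neg_atTop_nhds_zero 1).comp
    (tendsto_id.const_mul_atTop (show 0 < 1 - a by linarith))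
  have h2 := h.const_mul (4 / (1 - a))
  rw [mul_zero] at h2
  refine squeeze_zero' ?_ ?_ h2
  · filter_upwards [eventually_gt_atTop 0] with c hc
    have := Real.sinh_pos_iff.2 hc
    positivity
  · filter_upwards [eventually_ge_atTop 1] with c hc
    have h3 := exp_div_four_le_sinh hc
    have h4 : 0 < 1 - a := by linarith
    rw [div_le_iff₀ (Real.sinh_pos_iff.2 (by linarith))]
    simp only [Function.comp, id, pow_one]
    have h5 : Real.exp (a * c) = Real.exp (-((1 - a) * c)) * Real.exp c := by
      rw [← Real.exp_add]; ring_nf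
    rw [h5]
    have h6 : 4 / (1 - a) * ((1 - a) * c * Real.exp (-((1 - a) * c))) * Real.sinh c
      = c * Real.exp (-((1 - a) * c)) * (4 * Real.sinh c) := by field_simp
    rw [h6, ← mul_assoc]
    exact mul_le_mul_of_nonneg_left (by linarith) (by positivity)

lemma tendsto_modePrimitive_atTop {a : ℝ} (ha0 : 0 < a) (ha1 : a < 1) :
    Tendsto (modePrimitive a) atTop (𝓝 ((2 * a - 1) / 4)) := by
  have hcA : ∀ b : ℝ, 0 < b → b < 1 →
      Tendsto (fun c => c * sinhRatio b c) atTop (𝓝 0) := by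
    intro b hb0 hb1
    refine squeeze_zero' ?_ ?_ (tendsto_mul_sinhRatio_atTop hb1)
    · filter_upwards [eventually_gt_atTop 0] with c hc
      have := Real.sinh_pos_iff.2 hc
      have := Real.sinh_pos_iff.2 (mul_pos hb0 hc)
      unfold sinhRatio
      positivity
    · filter_upwards [eventually_gt_atTop 0] with c hc
      have := Real.sinh_pos_iff.2 hc
      rw [sinhRatio, mul_div_assoc]
      gcongr
      rw [Real.sinh_eq]
      linarith [Real.exp_pos (b * c), Real.exp_pos (-(b * c))]
  have hA0 : ∀ b : ℝ, 0 < b → b < 1 → Tendsto (sinhRatio b) atTop (𝓝 0) := by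
    intro b hb0 hb1
    have := (hcA b hb0 hb1).mul tendsto_inv_atTop_zero
    rw [mul_zero] at this
    refine this.congr' ?_
    filter_upwards [eventually_gt_atTop 0] with c hc
    field_simp
  have hcS : Tendsto (fun c => c / Real.sinh c) atTop (𝓝 0) := by
    simpa using tendsto_mul_sinhRatio_atTop (a := 0) one_pos
  have hS : Tendsto (fun c => 1 / Real.sinh c) atTop (𝓝 0) := by
    have := hcS.mul tendsto_inv_atTop_zero
    rw [mul_zero] at this
    refine this.congr' ?_
    filter_upwards [eventually_gt_atTop 0] with c hc
    field_simp
  have hX : Tendsto (fun c => Real.cosh c / Real.sinh c) atTop (𝓝 1) := by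
    have h := (((Real.tendsto_exp_neg_atTop_nhds_zero).mul hS).const_add 1)
    rw [mul_zero, add_zero] at h
    refine h.congr' ?_
    filter_upwards [eventually_gt_atTop 0] with c hc
    have := (Real.sinh_pos_iff.2 hc).ne'
    have h1 : Real.cosh c - Real.sinh c = Real.exp (-c) := by
      rw [Real.cosh_eq, Real.sinh_eq]; ring
    rw [← h1]
    field_simp
    ring
  have hA := hA0 a ha0 ha1
  have hB := hA0 (1 - a) (by linarith) (by linarith)
  have hφ1 : Tendsto cothWeightDeriv atTop (𝓝 1) := by
    have h := hX.sub (hcS.mul hS)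
    rw [mul_zero, sub_zero] at h
    refine h.congr' ?_
    filter_upwards [eventually_gt_atTop 0] with c hc
    have := (Real.sinh_pos_iff.2 hc).ne'
    unfold cothWeightDeriv
    field_simp
  have hφA : ∀ b : ℝ, 0 < b → b < 1 →
      Tendsto (fun c => cothWeight c * sinhRatio b c) atTop (𝓝 0) := by
    intro b hb0 hb1
    have hn : ∀ c, 0 < c → 0 ≤ sinhRatio b c := fun c hc =>
      div_nonneg (Real.sinh_pos_iff.2 (mul_pos hb0 hc)).le (Real.sinh_pos_iff.2 hc).le
    refine squeeze_zero' ?_ ?_ (hcA b hb0 hb1)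
    · filter_upwards [eventually_gt_atTop 0] with c hc
      exact mul_nonneg (cothWeight_nonneg hc) (hn c hc)
    · filter_upwards [eventually_gt_atTop 0] with c hc
      exact mul_le_mul_of_nonneg_right (cothWeight_le hc) (hn c hc)
  have hφa := hφA a ha0 ha1
  have hφb := hφA (1 - a) (by linarith) (by linarith)
  have h := ((hφ1.mul (((hA.pow 2).sub (hB.pow 2)).const_sub (2 * a - 1))).add
    (((((hφa.mul hB).mul hS).const_mul (2 * a - 1)).sub (hX.mul
      (((hφa.mul hA).const_mul (1 - a)).sub ((hφb.mul hB).const_mul a)))).const_mul 2)).div_const 4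
  have h0 : (1 * (2 * a - 1 - (0 ^ 2 - 0 ^ 2)) + 2 * ((2 * a - 1) * (0 * 0 * 0)
      - 1 * ((1 - a) * (0 * 0) - a * (0 * 0)))) / 4 = (2 * a - 1) / 4 := by ring
  rw [h0] at h
  refine h.congr fun c => ?_
  simp only [modePrimitive, sinhRatioGapDeriv]
  ring

end

section

open Filter Topology

open Filter Topology

/-- The open upper half-plane in real coordinates. -/
def upperStrip : Set (ℝ × ℝ) := {x | 0 < x.2}

/-- Pure partial derivatives up to order two of a function on the upper half-plane, all of them
continuous. -/
structure StripJet {E : Type*} [NormedAddCommGroup E] [NormedSpace ℝ E]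
    (f fx fxx fy fyy : ℝ → ℝ → E) : Prop where
  dx : ∀ θ c, 0 < c → HasDerivAt (fun θ => f θ c) (fx θ c) θ
  dxx : ∀ θ c, 0 < c → HasDerivAt (fun θ => fx θ c) (fxx θ c) θ
  dy : ∀ θ c, 0 < c → HasDerivAt (fun c => f θ c) (fy θ c) c
  dyy : ∀ θ c, 0 < c → HasDerivAt (fun c => fy θ c) (fyy θ c) c
  cont : ContinuousOn (fun x : ℝ × ℝ => f x.1 x.2) upperStrip
  cont_x : ContinuousOn (fun x : ℝ × ℝ => fx x.1 x.2) upperStrip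
  cont_xx : ContinuousOn (fun x : ℝ × ℝ => fxx x.1 x.2) upperStrip
  cont_y : ContinuousOn (fun x : ℝ × ℝ => fy x.1 x.2) upperStrip
  cont_yy : ContinuousOn (fun x : ℝ × ℝ => fyy x.1 x.2) upperStrip

namespace StripJet

variable {E F : Type*} [NormedAddCommGroup E] [NormedSpace ℝ E]
  [NormedAddCommGroup F] [NormedSpace ℝ F]

lemma clm {f fx fxx fy fyy : ℝ → ℝ → E} (h : StripJet f fx fxx fy fyy) (T : E →L[ℝ] F) :
    StripJet (fun θ c => T (f θ c)) (fun θ c => T (fx θ c)) (fun θ c => T (fxx θ c))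
      (fun θ c => T (fy θ c)) (fun θ c => T (fyy θ c)) where
  dx θ c hc := T.hasFDerivAt.comp_hasDerivAt θ (h.dx θ c hc)
  dxx θ c hc := T.hasFDerivAt.comp_hasDerivAt θ (h.dxx θ c hc)
  dy θ c hc := T.hasFDerivAt.comp_hasDerivAt c (h.dy θ c hc)
  dyy θ c hc := T.hasFDerivAt.comp_hasDerivAt c (h.dyy θ c hc)
  cont := T.continuous.comp_continuousOn h.cont
  cont_x := T.continuous.comp_continuousOn h.cont_x
  cont_xx := T.continuous.comp_continuousOn h.cont_xx
  cont_y := T.continuous.comp_continuousOn h.cont_y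
  cont_yy := T.continuous.comp_continuousOn h.cont_yy

lemma sum {ι : Type*} (s : Finset ι) {f fx fxx fy fyy : ι → ℝ → ℝ → E}
    (h : ∀ i ∈ s, StripJet (f i) (fx i) (fxx i) (fy i) (fyy i)) :
    StripJet (fun θ c => ∑ i ∈ s, f i θ c) (fun θ c => ∑ i ∈ s, fx i θ c)
      (fun θ c => ∑ i ∈ s, fxx i θ c) (fun θ c => ∑ i ∈ s, fy i θ c)
      (fun θ c => ∑ i ∈ s, fyy i θ c) where
  dx θ c hc := HasDerivAt.fun_sum fun i hi => (h i hi).dx θ c hc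
  dxx θ c hc := HasDerivAt.fun_sum fun i hi => (h i hi).dxx θ c hc
  dy θ c hc := HasDerivAt.fun_sum fun i hi => (h i hi).dy θ c hc
  dyy θ c hc := HasDerivAt.fun_sum fun i hi => (h i hi).dyy θ c hc
  cont := continuousOn_finsetSum s fun i hi => (h i hi).cont
  cont_x := continuousOn_finsetSum s fun i hi => (h i hi).cont_x
  cont_xx := continuousOn_finsetSum s fun i hi => (h i hi).cont_xx
  cont_y := continuousOn_finsetSum s fun i hi => (h i hi).cont_y
  cont_yy := continuousOn_finsetSum s fun i hi => (h i hi).cont_yy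

end StripJet

/-- The Poisson kernel of the half-plane, periodized. -/
def periodicPoisson (θ c : ℝ) : ℝ := Real.sinh c / (Real.cosh c - Real.cos θ)

/-- The denominator of `periodicPoisson`. -/
def poissonDenom (θ c : ℝ) : ℝ := Real.cosh c - Real.cos θ

lemma poissonDenom_pos (θ : ℝ) {c : ℝ} (hc : 0 < c) : 0 < poissonDenom θ c := by
  have h1 : 1 < Real.cosh c := Real.one_lt_cosh.2 hc.ne'
  have h2 := Real.cos_le_one θ
  unfold poissonDenom; linarith

lemma periodicPoisson_pos (θ : ℝ) {c : ℝ} (hc : 0 < c) : 0 < periodicPoisson θ c :=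
  div_pos (Real.sinh_pos_iff.2 hc) (poissonDenom_pos θ hc)

/-- The angular derivative of `periodicPoisson`. -/
def periodicPoissonX (θ c : ℝ) : ℝ := -(Real.sinh c * Real.sin θ) / poissonDenom θ c ^ 2

/-- The second angular derivative of `periodicPoisson`. -/
def periodicPoissonXX (θ c : ℝ) : ℝ :=
  -(Real.sinh c * Real.cos θ) / poissonDenom θ c ^ 2
    + 2 * Real.sinh c * Real.sin θ ^ 2 / poissonDenom θ c ^ 3

/-- The radial derivative of `periodicPoisson`. -/
def periodicPoissonY (θ c : ℝ) : ℝ := (1 - Real.cosh c * Real.cos θ) / poissonDenom θ c ^ 2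

/-- The second radial derivative of `periodicPoisson`. -/
def periodicPoissonYY (θ c : ℝ) : ℝ :=
  -(Real.sinh c * Real.cos θ) / poissonDenom θ c ^ 2
    - 2 * (1 - Real.cosh c * Real.cos θ) * Real.sinh c / poissonDenom θ c ^ 3

lemma stripJet_periodicPoisson : StripJet periodicPoisson periodicPoissonX periodicPoissonXX
    periodicPoissonY periodicPoissonYY := by
  have hne : ∀ θ c, 0 < c → poissonDenom θ c ≠ 0 := fun θ c hc => (poissonDenom_pos θ hc).ne'
  have hDx : ∀ θ c, HasDerivAt (fun θ => poissonDenom θ c) (Real.sin θ) θ := fun θ c => by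
    simpa [poissonDenom] using (Real.hasDerivAt_cos θ).const_sub (Real.cosh c)
  have hDy : ∀ θ c, HasDerivAt (fun c => poissonDenom θ c) (Real.sinh c) c := fun θ c =>
    (Real.hasDerivAt_cosh c).sub_const _
  have hDc : Continuous (fun x : ℝ × ℝ => poissonDenom x.1 x.2) := by
    unfold poissonDenom; fun_prop
  have hcn : ∀ k : ℕ, ∀ x ∈ upperStrip, poissonDenom x.1 x.2 ^ k ≠ 0 := fun k x hx =>
    pow_ne_zero k (hne _ _ hx)
  constructor
  · intro θ c hc
    refine ((hasDerivAt_const θ (Real.sinh c)).div (hDx θ c) (hne θ c hc)).congr_deriv ?_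
    simp [periodicPoissonX]
  · intro θ c hc
    have := hne θ c hc
    refine (((Real.hasDerivAt_sin θ).const_mul (Real.sinh c)).neg.div ((hDx θ c).pow 2)
      (pow_ne_zero 2 this)).congr_deriv ?_
    simp only [Pi.neg_apply, Pi.pow_apply, periodicPoissonXX]
    push_cast
    field_simp
    ring
  · intro θ c hc
    have := hne θ c hc
    refine ((Real.hasDerivAt_sinh c).div (hDy θ c) this).congr_deriv ?_
    have h2 := Real.cosh_sq c
    congr 1
    unfold poissonDenom
    linear_combination h2
  · intro θ c hc
    have := hne θ c hc
    refine ((((Real.hasDerivAt_cosh c).mul_const (Real.cos θ)).const_sub 1).div ((hDy θ c).pow 2)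
      (pow_ne_zero 2 this)).congr_deriv ?_
    simp only [Pi.pow_apply, periodicPoissonYY]
    push_cast
    field_simp
    try ring
  · refine ContinuousOn.div (by fun_prop) hDc.continuousOn fun x hx => ?_
    exact hne _ _ hx
  · exact ContinuousOn.div (by fun_prop) (hDc.pow 2).continuousOn (hcn 2)
  · exact (ContinuousOn.div (by fun_prop) (hDc.pow 2).continuousOn (hcn 2)).add
      (ContinuousOn.div (by fun_prop) (hDc.pow 3).continuousOn (hcn 3))
  · exact ContinuousOn.div (by fun_prop) (hDc.pow 2).continuousOn (hcn 2)
  · exact (ContinuousOn.div (by fun_prop) (hDc.pow 2).continuousOn (hcn 2)).sub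
      (ContinuousOn.div (by fun_prop) (hDc.pow 3).continuousOn (hcn 3))

/-- A quasi-periodic exponential. -/
def expMode (x θ : ℝ) : ℂ := Complex.exp (x * θ * Complex.I)

lemma hasDerivAt_expMode (x θ : ℝ) :
    HasDerivAt (expMode x) (x * Complex.I * expMode x θ) θ := by
  have h : HasDerivAt (fun θ : ℝ => (x : ℂ) * (θ : ℂ) * Complex.I) (x * Complex.I) θ := by
    have := ((Complex.ofRealCLM.hasDerivAt (x := θ)).const_mul (x : ℂ)).mul_const Complex.I
    simpa using this
  refine h.cexp.congr_deriv ?_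
  simp only [expMode]; ring

lemma continuous_expMode (x : ℝ) : Continuous (expMode x) := by
  unfold expMode; fun_prop

lemma hasDerivAt_expMode_combination (ξ : ℝ) (p q : ℂ) (θ : ℝ) :
    HasDerivAt (fun θ => p * expMode ξ θ + q * expMode (-(1 - ξ)) θ)
      (p * (ξ * Complex.I) * expMode ξ θ
        + q * (-(1 - ξ) * Complex.I) * expMode (-(1 - ξ)) θ) θ := by
  refine (((hasDerivAt_expMode ξ θ).const_mul p).add
    ((hasDerivAt_expMode (-(1 - ξ)) θ).const_mul q)).congr_deriv ?_
  push_cast; ring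

/-- The Fourier modes of the cyclic model. -/
def cyclicMode (ξ θ c : ℝ) : ℂ :=
  sinhRatio (1 - ξ) c * expMode ξ θ + sinhRatio ξ c * expMode (-(1 - ξ)) θ

/-- The angular derivative of `cyclicMode`. -/
def cyclicModeX (ξ θ c : ℝ) : ℂ :=
  sinhRatio (1 - ξ) c * (ξ * Complex.I) * expMode ξ θ
    + sinhRatio ξ c * (-(1 - ξ) * Complex.I) * expMode (-(1 - ξ)) θ

/-- The second angular derivative of `cyclicMode`. -/
def cyclicModeXX (ξ θ c : ℝ) : ℂ :=
  sinhRatio (1 - ξ) c * (ξ * Complex.I) * (ξ * Complex.I) * expMode ξ θ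
    + sinhRatio ξ c * (-(1 - ξ) * Complex.I) * (-(1 - ξ) * Complex.I) * expMode (-(1 - ξ)) θ

/-- The radial derivative of `cyclicMode`. -/
def cyclicModeY (ξ θ c : ℝ) : ℂ :=
  sinhRatioDeriv (1 - ξ) c * expMode ξ θ + sinhRatioDeriv ξ c * expMode (-(1 - ξ)) θ

/-- The second radial derivative of `cyclicMode`. -/
def cyclicModeYY (ξ θ c : ℝ) : ℂ :=
  sinhRatioDeriv2 (1 - ξ) c * expMode ξ θ + sinhRatioDeriv2 ξ c * expMode (-(1 - ξ)) θ

lemma stripJet_cyclicMode (ξ : ℝ) : StripJet (cyclicMode ξ) (cyclicModeX ξ) (cyclicModeXX ξ)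
    (cyclicModeY ξ) (cyclicModeYY ξ) := by
  have hS : ∀ x ∈ upperStrip, Real.sinh x.2 ≠ 0 := fun x hx => (Real.sinh_pos_iff.2 hx).ne'
  have c0 : ∀ a : ℝ, ContinuousOn (fun x : ℝ × ℝ => sinhRatio a x.2) upperStrip := fun a =>
    ContinuousOn.div (by fun_prop) (by fun_prop) hS
  have c1 : ∀ a : ℝ, ContinuousOn (fun x : ℝ × ℝ => sinhRatioDeriv a x.2) upperStrip := fun a => by
    have h1 := c0 a
    have h2 := c0 (1 - a)
    exact ContinuousOn.div (by fun_prop) (by fun_prop) hS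
  have c2 : ∀ a : ℝ, ContinuousOn (fun x : ℝ × ℝ => sinhRatioDeriv2 a x.2) upperStrip := fun a => by
    have h0 := c0 a
    have h1 := c1 a
    have h2 := c1 (1 - a)
    exact ContinuousOn.div (by fun_prop) (by fun_prop) hS
  have cC : ∀ f : ℝ → ℝ, ContinuousOn (fun x : ℝ × ℝ => f x.2) upperStrip →
      ContinuousOn (fun x : ℝ × ℝ => ((f x.2 : ℝ) : ℂ)) upperStrip := fun f hf =>
    Complex.continuous_ofReal.comp_continuousOn hf
  have cE : ∀ y : ℝ, ContinuousOn (fun x : ℝ × ℝ => expMode y x.1) upperStrip := fun y =>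
    ((continuous_expMode y).comp continuous_fst).continuousOn
  have d1 := cC _ (c0 (1 - ξ))
  have d2 := cC _ (c0 ξ)
  have d3 := cC _ (c1 (1 - ξ))
  have d4 := cC _ (c1 ξ)
  have d5 := cC _ (c2 (1 - ξ))
  have d6 := cC _ (c2 ξ)
  have e1 := cE ξ
  have e2 := cE (-(1 - ξ))
  constructor
  · intro θ c _
    exact hasDerivAt_expMode_combination ξ _ _ θ
  · intro θ c _
    exact hasDerivAt_expMode_combination ξ _ _ θ
  · intro θ c hc
    exact ((hasDerivAt_sinhRatio (1 - ξ) hc).ofReal_comp.mul_const _).add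
      ((hasDerivAt_sinhRatio ξ hc).ofReal_comp.mul_const _)
  · intro θ c hc
    exact ((hasDerivAt_sinhRatioDeriv (1 - ξ) hc).ofReal_comp.mul_const _).add
      ((hasDerivAt_sinhRatioDeriv ξ hc).ofReal_comp.mul_const _)
  · exact (d1.mul e1).add (d2.mul e2)
  · exact ((d1.mul continuousOn_const).mul e1).add ((d2.mul continuousOn_const).mul e2)
  · exact (((d1.mul continuousOn_const).mul continuousOn_const).mul e1).add
      (((d2.mul continuousOn_const).mul continuousOn_const).mul e2)
  · exact (d3.mul e1).add (d4.mul e2)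
  · exact (d5.mul e1).add (d6.mul e2)

end

lemma periodicPoisson_harmonic (θ : ℝ) {c : ℝ} (hc : 0 < c) :
    periodicPoissonXX θ c + periodicPoissonYY θ c = 0 := by
  have hD := (poissonDenom_pos θ hc).ne'
  have h2 := Real.sin_sq_add_cos_sq θ
  have hd : poissonDenom θ c = Real.cosh c - Real.cos θ := rfl
  unfold periodicPoissonXX periodicPoissonYY
  field_simp
  rw [hd]
  linear_combination (2 * Real.sinh c) * h2

lemma expMode_ne_zero (x θ : ℝ) : expMode x θ ≠ 0 := Complex.exp_ne_zero _

lemma expMode_add_index (x y θ : ℝ) : expMode (x + y) θ = expMode x θ * expMode y θ := by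
  rw [expMode, expMode, expMode, ← Complex.exp_add]; push_cast; ring_nf

lemma expMode_add (x θ η : ℝ) : expMode x (θ + η) = expMode x θ * expMode x η := by
  rw [expMode, expMode, expMode, ← Complex.exp_add]; push_cast; ring_nf

lemma expMode_neg (x θ : ℝ) : expMode (-x) θ = (expMode x θ)⁻¹ := by
  rw [expMode, expMode, ← Complex.exp_neg]; push_cast; ring_nf

lemma cos_eq_expMode (θ : ℝ) : ((Real.cos θ : ℝ) : ℂ) = (expMode 1 θ + (expMode 1 θ)⁻¹) / 2 := by
  rw [← expMode_neg, Complex.ofReal_cos, Complex.cos, expMode, expMode]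
  push_cast; ring_nf

lemma sin_eq_expMode (θ : ℝ) :
    ((Real.sin θ : ℝ) : ℂ) = ((expMode 1 θ)⁻¹ - expMode 1 θ) * Complex.I / 2 := by
  rw [← expMode_neg, Complex.ofReal_sin, Complex.sin, expMode, expMode]
  push_cast; ring_nf

lemma expMode_sub_one (ξ θ : ℝ) : expMode (-(1 - ξ)) θ = expMode ξ θ * (expMode 1 θ)⁻¹ := by
  rw [← expMode_neg, ← expMode_add_index]; ring_nf

lemma cyclicMode_pde (ξ θ : ℝ) {c : ℝ} (hc : 0 < c) :
    periodicPoisson θ c * (cyclicModeXX ξ θ c + cyclicModeYY ξ θ c)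
      + 2 * (periodicPoissonX θ c * cyclicModeX ξ θ c
        + periodicPoissonY θ c * cyclicModeY ξ θ c) = 0 := by
  have hD : (poissonDenom θ c : ℂ) ≠ 0 := by exact_mod_cast (poissonDenom_pos θ hc).ne'
  have hS : (Real.sinh c : ℂ) ≠ 0 := by exact_mod_cast (Real.sinh_pos_iff.2 hc).ne'
  have hX : ((Real.cosh c : ℝ) : ℂ) ^ 2 = (Real.sinh c : ℂ) ^ 2 + 1 := by
    exact_mod_cast Real.cosh_sq c
  have hE := expMode_ne_zero 1 θ
  have hd : (poissonDenom θ c : ℂ)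
      = (Real.cosh c : ℂ) - (expMode 1 θ + (expMode 1 θ)⁻¹) / 2 := by
    rw [← cos_eq_expMode, poissonDenom]; push_cast; ring
  have hp : (periodicPoisson θ c : ℂ) = (Real.sinh c : ℂ) / poissonDenom θ c := by
    rw [periodicPoisson, poissonDenom]; push_cast; ring
  have hpx : (periodicPoissonX θ c : ℂ) = -((Real.sinh c : ℂ)
      * (((expMode 1 θ)⁻¹ - expMode 1 θ) * Complex.I / 2)) / (poissonDenom θ c : ℂ) ^ 2 := by
    rw [← sin_eq_expMode, periodicPoissonX]; push_cast; ring
  have hpy : (periodicPoissonY θ c : ℂ) = (1 - (Real.cosh c : ℂ)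
      * ((expMode 1 θ + (expMode 1 θ)⁻¹) / 2)) / (poissonDenom θ c : ℂ) ^ 2 := by
    rw [← cos_eq_expMode, periodicPoissonY]; push_cast; ring
  rw [hp, hpx, hpy, cyclicModeXX, cyclicModeYY, cyclicModeX, cyclicModeY]
  simp only [sinhRatioDeriv2, sinhRatioDeriv, sub_sub_cancel, expMode_sub_one]
  push_cast
  simp only [← Complex.ofReal_sinh, ← Complex.ofReal_cosh]
  generalize (poissonDenom θ c : ℂ) = D at *
  generalize expMode 1 θ = E at *
  generalize expMode ξ θ = Z at *
  generalize (sinhRatio ξ c : ℂ) = B at *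
  generalize (sinhRatio (1 - ξ) c : ℂ) = A at *
  generalize (Real.cosh c : ℂ) = X at *
  generalize (Real.sinh c : ℂ) = S at *
  generalize (ξ : ℂ) = x at *
  have hI := Complex.I_sq
  have hd' : D * (2 * E) = 2 * X * E - E ^ 2 - 1 := by rw [hd]; field_simp; ring
  field_simp
  have hS2 : S ^ 2 = X ^ 2 - 1 := by rw [hX]; ring
  rw [hI, hS2]
  linear_combination (Z / 2 * ((X ^ 2 - 1) * (-1) * (A * x ^ 2 * E + B * (1 - x) ^ 2) +
            (E *
                ((1 - x) * (A * x - B * (1 - x) * X)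
                  - x * ((X ^ 2 - 1) * A + X * (B * (1 - x) - A * x * X)) -
                  X * (B * (1 - x) - A * x * X)) +
              (x * (B * (1 - x) - A * x * X)
                - (1 - x) * ((X ^ 2 - 1) * B + X * (A * x - B * (1 - x) * X)) -
                X * (A * x - B * (1 - x) * X))))) * hd'

lemma cyclicMode_det (ξ θ : ℝ) {c : ℝ} (hc : 0 < c) :
    periodicPoisson θ c * (cyclicModeX ξ θ c * cyclicModeY (1 - ξ) θ c
      - cyclicModeX (1 - ξ) θ c * cyclicModeY ξ θ c)
      = -2 * Complex.I * (((ξ ^ 2 * sinhRatio (1 - ξ) c ^ 2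
        - (1 - ξ) ^ 2 * sinhRatio ξ c ^ 2 : ℝ) : ℂ)) := by
  have hD : (poissonDenom θ c : ℂ) ≠ 0 := by exact_mod_cast (poissonDenom_pos θ hc).ne'
  have hS : (Real.sinh c : ℂ) ≠ 0 := by exact_mod_cast (Real.sinh_pos_iff.2 hc).ne'
  have hE := expMode_ne_zero 1 θ
  have hZ := expMode_ne_zero ξ θ
  have hd : (poissonDenom θ c : ℂ)
      = (Real.cosh c : ℂ) - (expMode 1 θ + (expMode 1 θ)⁻¹) / 2 := by
    rw [← cos_eq_expMode, poissonDenom]; push_cast; ring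
  have hp : (periodicPoisson θ c : ℂ) = (Real.sinh c : ℂ) / poissonDenom θ c := by
    rw [periodicPoisson, poissonDenom]; push_cast; ring
  have h1 : expMode (1 - ξ) θ = expMode 1 θ * (expMode ξ θ)⁻¹ := by
    rw [← expMode_neg, ← expMode_add_index]; ring_nf
  rw [hp, cyclicModeX, cyclicModeY, cyclicModeX, cyclicModeY]
  simp only [sinhRatioDeriv, sub_sub_cancel, h1, expMode_neg]
  push_cast
  simp only [← Complex.ofReal_sinh, ← Complex.ofReal_cosh]
  generalize (poissonDenom θ c : ℂ) = D at *
  generalize expMode 1 θ = E at *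
  generalize expMode ξ θ = Z at *
  generalize (sinhRatio ξ c : ℂ) = B at *
  generalize (sinhRatio (1 - ξ) c : ℂ) = A at *
  generalize (Real.cosh c : ℂ) = X at *
  generalize (Real.sinh c : ℂ) = S at *
  generalize (ξ : ℂ) = x at *
  have hd' : D * (2 * E) = 2 * X * E - E ^ 2 - 1 := by rw [hd]; field_simp; ring
  field_simp
  linear_combination (A ^ 2 * x ^ 2 - B ^ 2 * (1 - x) ^ 2) * hd'

lemma periodicPoisson_mul_cyclicMode (ξ θ : ℝ) {c : ℝ} (hc : 0 < c) :
    (periodicPoisson θ c : ℂ) * cyclicMode ξ θ c =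
      Complex.exp (ξ * (-c + θ * Complex.I)) / (1 - Complex.exp (-c + θ * Complex.I))
      + Complex.exp ((1 - ξ) * (-c - θ * Complex.I)) / (1 - Complex.exp (-c - θ * Complex.I)) := by
  have hD : (poissonDenom θ c : ℂ) ≠ 0 := by exact_mod_cast (poissonDenom_pos θ hc).ne'
  have hS : (Real.sinh c : ℂ) ≠ 0 := by exact_mod_cast (Real.sinh_pos_iff.2 hc).ne'
  have hE := expMode_ne_zero 1 θ
  have hZ := expMode_ne_zero ξ θ
  have hp : (periodicPoisson θ c : ℂ) = (Real.sinh c : ℂ) / poissonDenom θ c := by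
    rw [periodicPoisson, poissonDenom]; push_cast; ring
  have hs : ∀ a : ℝ, (sinhRatio a c : ℂ) = (Complex.exp (a * c) - (Complex.exp (a * c))⁻¹) / 2
      / (Real.sinh c : ℂ) := fun a => by
    rw [sinhRatio, ← Complex.exp_neg]; push_cast; rw [Complex.sinh]
  have hch : (Real.cosh c : ℂ) = (Complex.exp c + (Complex.exp c)⁻¹) / 2 := by
    rw [← Complex.exp_neg]; push_cast; rw [Complex.cosh]
  have hd : (poissonDenom θ c : ℂ)
      = (Complex.exp c + (Complex.exp c)⁻¹) / 2 - (expMode 1 θ + (expMode 1 θ)⁻¹) / 2 := by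
    rw [← cos_eq_expMode, ← hch, poissonDenom]; push_cast; ring
  have e1 : Complex.exp (-c + θ * Complex.I) = (Complex.exp c)⁻¹ * expMode 1 θ := by
    rw [expMode, ← Complex.exp_neg, ← Complex.exp_add]; push_cast; ring_nf
  have e2 : Complex.exp (-c - θ * Complex.I) = (Complex.exp c)⁻¹ * (expMode 1 θ)⁻¹ := by
    rw [expMode, ← Complex.exp_neg, ← Complex.exp_neg, ← Complex.exp_add]; push_cast; ring_nf
  have e3 : Complex.exp (ξ * (-c + θ * Complex.I)) = (Complex.exp (ξ * c))⁻¹ * expMode ξ θ := by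
    rw [expMode, ← Complex.exp_neg, ← Complex.exp_add]; ring_nf
  have e4 : Complex.exp ((1 - ξ) * (-c - θ * Complex.I)) =
      (Complex.exp c)⁻¹ * Complex.exp (ξ * c) * (expMode 1 θ)⁻¹ * expMode ξ θ := by
    rw [expMode, expMode, ← Complex.exp_neg, ← Complex.exp_neg, ← Complex.exp_add,
      ← Complex.exp_add, ← Complex.exp_add]; push_cast; ring_nf
  have e5 : Complex.exp (((1 - ξ : ℝ) : ℂ) * c) = Complex.exp c * (Complex.exp (ξ * c))⁻¹ := by
    rw [← Complex.exp_neg, ← Complex.exp_add]; push_cast; ring_nf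
  have hn : ∀ z : ℂ, ‖z‖ < 1 → 1 - z ≠ 0 := fun z hz h => by
    rw [← sub_eq_zero.1 h] at hz; simp at hz
  have n1 : 1 - (Complex.exp c)⁻¹ * expMode 1 θ ≠ 0 := by
    rw [← e1]; apply hn; rw [Complex.norm_exp]; simpa using hc
  have n2 : 1 - (Complex.exp c)⁻¹ * (expMode 1 θ)⁻¹ ≠ 0 := by
    rw [← e2]; apply hn; rw [Complex.norm_exp]; simpa using hc
  rw [cyclicMode, hp, hs, hs, expMode_sub_one, e1, e2, e3, e4, e5]
  have hc0 := Complex.exp_ne_zero c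
  have hx0 := Complex.exp_ne_zero (ξ * c)
  have hdd : (poissonDenom θ c : ℂ) = Complex.exp c / 2 *
      ((1 - (Complex.exp c)⁻¹ * expMode 1 θ) * (1 - (Complex.exp c)⁻¹ * (expMode 1 θ)⁻¹)) := by
    rw [hd]; field_simp; ring
  rw [hdd]
  generalize expMode 1 θ = E at *
  generalize expMode ξ θ = Z at *
  generalize (Real.sinh c : ℂ) = S at *
  generalize Complex.exp c = T at *
  generalize Complex.exp (ξ * c) = R at *
  rw [div_add_div _ _ n1 n2]
  rw [div_mul_eq_mul_div, div_eq_div_iff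
    (mul_ne_zero (div_ne_zero hc0 two_ne_zero) (mul_ne_zero n1 n2)) (mul_ne_zero n1 n2)]
  field_simp
  ring

lemma cyclicMode_zero (θ : ℝ) {c : ℝ} (hc : 0 < c) : cyclicMode 0 θ c = 1 := by
  have h1 : sinhRatio (1 - 0) c = 1 := by
    rw [sinhRatio, sub_zero, one_mul, div_self (Real.sinh_pos_iff.2 hc).ne']
  have h0 : sinhRatio 0 c = 0 := by simp [sinhRatio]
  rw [cyclicMode, h1, h0]
  simp [expMode]

lemma periodicPoisson_eq (θ : ℝ) {c : ℝ} (hc : 0 < c) :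
    (periodicPoisson θ c : ℂ) =
      1 / (1 - Complex.exp (-c + θ * Complex.I))
      + Complex.exp (-c - θ * Complex.I) / (1 - Complex.exp (-c - θ * Complex.I)) := by
  have h := periodicPoisson_mul_cyclicMode 0 θ hc
  rw [cyclicMode_zero θ hc] at h
  simpa using h

lemma expMode_nat_div_two_pi (N : ℕ) (k : ℕ) (n : ℕ) :
    expMode (k / N) (2 * Real.pi * n) =
      Complex.exp (2 * Real.pi * Complex.I / N) ^ (k * n) := by
  rw [expMode, ← Complex.exp_nat_mul]; push_cast; ring_nf

lemma sum_expMode (N : ℕ) (hN : 0 < N) (k : ℕ) (hk : k < N) (hk0 : k ≠ 0) :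
    ∑ n ∈ Finset.range N, expMode (k / N) (2 * Real.pi * n) = 0 := by
  have hp := Complex.isPrimitiveRoot_exp N hN.ne'
  have h1 : (Complex.exp (2 * Real.pi * Complex.I / N)) ^ k ≠ 1 :=
    hp.pow_ne_one_of_pos_of_lt hk0 hk
  simp_rw [expMode_nat_div_two_pi, pow_mul]
  rw [geom_sum_eq h1, ← pow_mul, mul_comm k N, pow_mul, hp.pow_eq_one]
  simp

/-- The weights with which the cyclic model averages its boundary values. -/
def cyclicWeight (N : ℕ) (n : ℕ) (θ c : ℝ) : ℝ :=
  periodicPoisson ((θ - 2 * Real.pi * n) / N) (c / N) / (N * periodicPoisson θ c)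

lemma cyclicWeight_nonneg (N n : ℕ) (θ : ℝ) {c : ℝ} (hc : 0 < c) : 0 ≤ cyclicWeight N n θ c := by
  rcases Nat.eq_zero_or_pos N with h | h
  · simp [cyclicWeight, h]
  · have : (0 : ℝ) < N := by exact_mod_cast h
    exact div_nonneg (periodicPoisson_pos _ (div_pos hc this)).le
      (mul_nonneg this.le (periodicPoisson_pos _ hc).le)

lemma cyclicWeight_eq_sum {N : ℕ} (hN : 0 < N) (n : ℕ) (θ : ℝ) {c : ℝ} (hc : 0 < c) :
    (cyclicWeight N n θ c : ℂ) =
      (1 / N) * ∑ k ∈ Finset.range N, expMode (-(k / N)) (2 * Real.pi * n)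
        * cyclicMode (k / N) θ c := by
  have hN' : (N : ℂ) ≠ 0 := by exact_mod_cast hN.ne'
  have hNr : (0 : ℝ) < N := by exact_mod_cast hN
  have hh : (periodicPoisson θ c : ℂ) ≠ 0 := by exact_mod_cast (periodicPoisson_pos θ hc).ne'
  have hn : ∀ z : ℂ, ‖z‖ < 1 → 1 - z ≠ 0 := fun z hz h => by
    rw [← sub_eq_zero.1 h] at hz; simp at hz
  set w : ℂ := (-c + (θ - 2 * Real.pi * n) * Complex.I) / N with hw
  set w' : ℂ := (-c - (θ - 2 * Real.pi * n) * Complex.I) / N with hw'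
  have m1 : ‖Complex.exp w‖ < 1 := by
    rw [Complex.norm_exp, Real.exp_lt_one_iff]
    have : w.re = -c / N := by rw [hw, Complex.div_natCast_re]; simp
    rw [this, neg_div]; exact neg_neg_of_pos (div_pos hc hNr)
  have m2 : ‖Complex.exp w'‖ < 1 := by
    rw [Complex.norm_exp, Real.exp_lt_one_iff]
    have : w'.re = -c / N := by rw [hw', Complex.div_natCast_re]; simp
    rw [this, neg_div]; exact neg_neg_of_pos (div_pos hc hNr)
  have p1 : Complex.exp w ^ N = Complex.exp (-c + θ * Complex.I) := by
    rw [← Complex.exp_nat_mul, hw, mul_div_cancel₀ _ hN']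
    rw [show -(c : ℂ) + (θ - 2 * Real.pi * n) * Complex.I = (-c + θ * Complex.I)
      - n * (2 * Real.pi * Complex.I) by ring]
    exact Complex.exp_periodic.sub_nat_mul_eq n
  have p2 : Complex.exp w' ^ N = Complex.exp (-c - θ * Complex.I) := by
    rw [← Complex.exp_nat_mul, hw', mul_div_cancel₀ _ hN']
    rw [show -(c : ℂ) - (θ - 2 * Real.pi * n) * Complex.I = (-c - θ * Complex.I)
      + n * (2 * Real.pi * Complex.I) by ring]
    exact Complex.exp_periodic.nat_mul n _
  have n1 : 1 - Complex.exp (-c + θ * Complex.I) ≠ 0 := by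
    apply hn; rw [Complex.norm_exp]; simpa using hc
  have n2 : 1 - Complex.exp (-c - θ * Complex.I) ≠ 0 := by
    apply hn; rw [Complex.norm_exp]; simpa using hc
  have hterm : ∀ k ∈ Finset.range N, (periodicPoisson θ c : ℂ) *
      (expMode (-(k / N)) (2 * Real.pi * n) * cyclicMode (k / N) θ c) =
      Complex.exp w ^ k * (1 - Complex.exp (-c + θ * Complex.I))⁻¹ +
      Complex.exp w' * (Complex.exp w' ^ (N - 1 - k)
        * (1 - Complex.exp (-c - θ * Complex.I))⁻¹) := fun k hk => by
    have hk' : k < N := Finset.mem_range.1 hk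
    rw [mul_left_comm, periodicPoisson_mul_cyclicMode _ _ hc, mul_add, ← mul_assoc, ← pow_succ',
      show N - 1 - k + 1 = N - k by omega, ← mul_div_assoc, ← mul_div_assoc, div_eq_mul_inv,
      div_eq_mul_inv]
    congr 3
    · rw [expMode, ← Complex.exp_add, ← Complex.exp_nat_mul]
      congr 1
      rw [hw]; push_cast; field_simp; ring
    · rw [expMode, ← Complex.exp_add, ← Complex.exp_nat_mul]
      have : Complex.exp ((N - k : ℕ) * w') = Complex.exp ((N - k : ℕ) * w'
        - n * (2 * Real.pi * Complex.I)) := (Complex.exp_periodic.sub_nat_mul_eq n).symm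
      rw [this]
      congr 1
      rw [hw', Nat.cast_sub hk'.le]; push_cast; field_simp; ring
  have hsum : (periodicPoisson θ c : ℂ) * ∑ k ∈ Finset.range N,
      expMode (-(k / N)) (2 * Real.pi * n) * cyclicMode (k / N) θ c
      = periodicPoisson ((θ - 2 * Real.pi * n) / N) (c / N) := by
    rw [Finset.mul_sum, Finset.sum_congr rfl hterm, Finset.sum_add_distrib, ← Finset.sum_mul,
      ← Finset.mul_sum, ← Finset.sum_mul, Finset.sum_range_reflect (fun k => Complex.exp w' ^ k) N,
      geom_sum_eq (fun h => hn _ m1 (by rw [h]; ring)),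
      geom_sum_eq (fun h => hn _ m2 (by rw [h]; ring)), p1, p2,
      periodicPoisson_eq _ (div_pos hc hNr)]
    have q1 : Complex.exp (-((c / N : ℝ) : ℂ) + (((θ - 2 * Real.pi * n) / N : ℝ) : ℂ) * Complex.I)
      = Complex.exp w := by congr 1; rw [hw]; push_cast; ring
    have q2 : Complex.exp (-((c / N : ℝ) : ℂ) - (((θ - 2 * Real.pi * n) / N : ℝ) : ℂ) * Complex.I)
      = Complex.exp w' := by congr 1; rw [hw']; push_cast; ring
    rw [q1, q2]
    have r1 := hn _ m1
    have r2 := hn _ m2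
    have r1' : Complex.exp w - 1 ≠ 0 := by rw [← neg_sub]; exact neg_ne_zero.2 r1
    have r2' : Complex.exp w' - 1 ≠ 0 := by rw [← neg_sub]; exact neg_ne_zero.2 r2
    congr 1
    · rw [← neg_sub (1 : ℂ), ← neg_sub (1 : ℂ) (Complex.exp w), neg_div_neg_eq]
      field_simp
    · rw [← neg_sub (1 : ℂ), ← neg_sub (1 : ℂ) (Complex.exp w'), neg_div_neg_eq]
      field_simp
  rw [cyclicWeight]
  push_cast
  rw [← hsum]
  field_simp

lemma sum_cyclicWeight {N : ℕ} (hN : 0 < N) (θ : ℝ) {c : ℝ} (hc : 0 < c) :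
    ∑ n ∈ Finset.range N, cyclicWeight N n θ c = 1 := by
  have hN' : (N : ℂ) ≠ 0 := by exact_mod_cast hN.ne'
  have h : ∑ n ∈ Finset.range N, (cyclicWeight N n θ c : ℂ) = 1 := by
    simp_rw [cyclicWeight_eq_sum hN _ θ hc]
    rw [← Finset.mul_sum, Finset.sum_comm, Finset.sum_eq_single_of_mem 0 (Finset.mem_range.2 hN)]
    · simp [cyclicMode_zero θ hc, expMode, hN']
    · intro k hk hk0
      have hs := sum_expMode N hN k (Finset.mem_range.1 hk) hk0
      have hs' : ∑ n ∈ Finset.range N, expMode (-(k / N)) (2 * Real.pi * n) = 0 := by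
        have := congrArg (starRingEnd ℂ) hs
        rw [map_sum, map_zero] at this
        rw [← this]
        refine Finset.sum_congr rfl fun n _ => ?_
        rw [expMode, expMode, ← Complex.exp_conj, map_mul, map_mul, Complex.conj_I,
          Complex.conj_ofReal, Complex.conj_ofReal]
        congr 1; push_cast; ring
      rw [← Finset.sum_mul, hs', zero_mul]
  exact_mod_cast h

lemma integral_periodicPoisson {c : ℝ} (hc : 0 < c) :
    ∫ θ in (0 : ℝ)..2 * Real.pi, periodicPoisson θ c = 2 * Real.pi := by
  have hr : (0 : ℝ) < Real.exp (-c) := Real.exp_pos _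
  have hr1 : Real.exp (-c) < 1 := by rw [Real.exp_lt_one_iff]; linarith
  have hdiff : DiffContOnCl ℂ (fun z : ℂ => (1 + z) / (1 - z)) (Metric.ball 0 |Real.exp (-c)|) := by
    have hd : DifferentiableOn ℂ (fun z : ℂ => (1 + z) / (1 - z)) (Metric.ball 0 1) := by
      refine DifferentiableOn.div (by fun_prop) (by fun_prop) fun z hz h => ?_
      rw [← sub_eq_zero.1 h] at hz; simp at hz
    refine (hd.mono ?_).diffContOnCl (s := Metric.ball 0 |Real.exp (-c)|)
    refine Metric.closure_ball_subset_closedBall.trans ?_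
    rw [abs_of_pos hr]
    exact Metric.closedBall_subset_ball hr1
  have h := hdiff.circleAverage
  rw [Real.circleAverage_def] at h
  have hpi := Real.pi_pos
  have hInt : ∫ θ in (0 : ℝ)..2 * Real.pi, (1 + circleMap 0 (Real.exp (-c)) θ)
      / (1 - circleMap 0 (Real.exp (-c)) θ) = 2 * Real.pi := by
    have := congrArg (fun z => (2 * Real.pi) • z) h
    simp only [smul_smul] at this
    rw [mul_inv_cancel₀ (by positivity), one_smul] at this
    rw [this]; simp
  have hcm : ∀ θ : ℝ, circleMap 0 (Real.exp (-c)) θ = Complex.exp (-c + θ * Complex.I) := fun θ => by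
    rw [circleMap, Complex.exp_add]; push_cast; ring
  have hne : ∀ θ : ℝ, 1 - Complex.exp (-c + θ * Complex.I) ≠ 0 := fun θ h => by
    have : ‖Complex.exp (-c + θ * Complex.I)‖ < 1 := by
      rw [Complex.norm_exp]; simpa using hc
    rw [← sub_eq_zero.1 h] at this; simp at this
  have hre : ∀ θ : ℝ, periodicPoisson θ c =
      Complex.reCLM ((1 + circleMap 0 (Real.exp (-c)) θ) / (1 - circleMap 0 (Real.exp (-c)) θ)) := by
    intro θ
    have h0 := periodicPoisson_eq θ hc
    have hcj : Complex.exp (-c - θ * Complex.I) =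
        (starRingEnd ℂ) (Complex.exp (-c + θ * Complex.I)) := by
      rw [← Complex.exp_conj]; simp [sub_eq_add_neg]
    have h1 : Complex.exp (-c - θ * Complex.I) / (1 - Complex.exp (-c - θ * Complex.I)) =
        (starRingEnd ℂ) (Complex.exp (-c + θ * Complex.I)
          / (1 - Complex.exp (-c + θ * Complex.I))) := by
      rw [hcj]; simp
    rw [h1] at h0
    have h2 := congrArg Complex.re h0
    rw [Complex.ofReal_re, Complex.add_re, Complex.conj_re, ← Complex.add_re, ← add_div,
      ← hcm] at h2
    exact h2
  simp_rw [hre]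
  rw [ContinuousLinearMap.intervalIntegral_comp_comm, hInt]
  · simp [Complex.reCLM_apply]
  · refine Continuous.intervalIntegrable ?_ _ _
    refine Continuous.div (by fun_prop) (by fun_prop) fun θ => ?_
    rw [hcm]; exact hne θ

lemma periodicPoisson_periodic (c : ℝ) :
    Function.Periodic (fun θ => periodicPoisson θ c) (2 * Real.pi) := fun θ => by
  simp [periodicPoisson]

lemma integral_mul_cyclicWeight {N : ℕ} (hN : 0 < N) (n : ℕ) {c : ℝ} (hc : 0 < c) :
    ∫ θ in (0 : ℝ)..2 * Real.pi * N, periodicPoisson θ c * cyclicWeight N n θ c = 2 * Real.pi := by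
  have hNr : (0 : ℝ) < N := by exact_mod_cast hN
  have h1 : ∀ θ, periodicPoisson θ c * cyclicWeight N n θ c =
      (N : ℝ)⁻¹ * periodicPoisson (θ / N - 2 * Real.pi * n / N) (c / N) := fun θ => by
    have := (periodicPoisson_pos θ hc).ne'
    rw [cyclicWeight, ← sub_div]; field_simp
  simp_rw [h1]
  rw [intervalIntegral.integral_const_mul,
    intervalIntegral.inv_mul_integral_comp_div_sub
      (f := fun x => periodicPoisson x (c / N))]
  have := (periodicPoisson_periodic (c / N)).intervalIntegral_add_eq
    (0 / N - 2 * Real.pi * n / N) 0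
  rw [zero_add, integral_periodicPoisson (div_pos hc hNr)] at this
  refine Eq.trans ?_ this
  congr 1
  rw [mul_div_cancel_right₀ _ hNr.ne']; ring

lemma integral_eq_zero_of_quasiperiodic {f : ℝ → ℂ} {T : ℝ} {N : ℕ} {l : ℂ}
    (hf : ∀ x, f (x + T) = l * f x) (hl : l ≠ 1) (hN : l ^ N = 1) :
    ∫ x in (0 : ℝ)..T * N, f x = 0 := by
  have hper : Function.Periodic f (T * N) := by
    have : ∀ n : ℕ, ∀ x, f (x + T * n) = l ^ n * f x := by
      intro n
      induction n with
      | zero => intro x; simp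
      | succ n ih =>
        intro x
        rw [Nat.cast_succ, mul_add, mul_one, ← add_assoc, hf, ih, pow_succ]; ring
    intro x
    rw [this N x, hN, one_mul]
  have h1 := hper.intervalIntegral_add_eq T 0
  have h2 : ∫ x in (0 : ℝ)..T * N, f (x + T) = l * ∫ x in (0 : ℝ)..T * N, f x := by
    simp_rw [hf]; rw [intervalIntegral.integral_const_mul]
  rw [intervalIntegral.integral_comp_add_right, zero_add, add_comm (T * N) T, h1, zero_add] at h2
  have h3 : (l - 1) * ∫ x in (0 : ℝ)..T * N, f x = 0 := by linear_combination -h2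
  exact (mul_eq_zero.1 h3).resolve_left (sub_ne_zero.2 hl)

lemma expMode_quasiperiodic (ξ θ : ℝ) :
    expMode ξ (θ + 2 * Real.pi) = expMode ξ (2 * Real.pi) * expMode ξ θ := by
  rw [expMode_add, mul_comm]

lemma expMode_quasiperiodic' (ξ θ : ℝ) :
    expMode (-(1 - ξ)) (θ + 2 * Real.pi) = expMode ξ (2 * Real.pi) * expMode (-(1 - ξ)) θ := by
  have h1 : expMode 1 (2 * Real.pi) = 1 := by
    rw [expMode]; push_cast; rw [one_mul]; exact Complex.exp_two_pi_mul_I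
  rw [expMode_add, mul_comm, expMode_sub_one ξ (2 * Real.pi), h1, inv_one, mul_one]

lemma cyclicModeX_quasiperiodic (ξ θ c : ℝ) :
    cyclicModeX ξ (θ + 2 * Real.pi) c = expMode ξ (2 * Real.pi) * cyclicModeX ξ θ c := by
  rw [cyclicModeX, cyclicModeX, expMode_quasiperiodic, expMode_quasiperiodic']; ring

lemma cyclicModeY_quasiperiodic (ξ θ c : ℝ) :
    cyclicModeY ξ (θ + 2 * Real.pi) c = expMode ξ (2 * Real.pi) * cyclicModeY ξ θ c := by
  rw [cyclicModeY, cyclicModeY, expMode_quasiperiodic, expMode_quasiperiodic']; ring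

lemma cyclicMode_quasiperiodic (ξ θ c : ℝ) :
    cyclicMode ξ (θ + 2 * Real.pi) c = expMode ξ (2 * Real.pi) * cyclicMode ξ θ c := by
  rw [cyclicMode, cyclicMode, expMode_quasiperiodic, expMode_quasiperiodic']; ring

lemma cyclicModeX_zero (θ c : ℝ) : cyclicModeX 0 θ c = 0 := by
  simp [cyclicModeX, sinhRatio]

lemma cyclicModeY_zero (θ c : ℝ) : cyclicModeY 0 θ c = 0 := by
  simp [cyclicModeY, sinhRatioDeriv, sinhRatio]

/-- The integrated Jacobian of two modes of the cyclic model. -/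
def modePairing (N k l : ℕ) (c : ℝ) : ℂ :=
  ∫ θ in (0 : ℝ)..2 * Real.pi * N, (periodicPoisson θ c : ℂ) *
    (cyclicModeX (k / N) θ c * cyclicModeY (l / N) θ c
      - cyclicModeX (l / N) θ c * cyclicModeY (k / N) θ c)

lemma expMode_div_pow (N k : ℕ) : expMode (k / N) (2 * Real.pi) =
    Complex.exp (2 * Real.pi * Complex.I / N) ^ k := by
  rw [expMode, ← Complex.exp_nat_mul]; push_cast; ring_nf

lemma modePairing_eq_zero {N k l : ℕ} (hN : 0 < N) (h : ¬ N ∣ k + l) (c : ℝ) :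
    modePairing N k l c = 0 := by
  have hp := Complex.isPrimitiveRoot_exp N hN.ne'
  refine integral_eq_zero_of_quasiperiodic
    (l := Complex.exp (2 * Real.pi * Complex.I / N) ^ (k + l)) (fun θ => ?_) ?_ ?_
  · rw [cyclicModeX_quasiperiodic, cyclicModeX_quasiperiodic, cyclicModeY_quasiperiodic,
      cyclicModeY_quasiperiodic, expMode_div_pow, expMode_div_pow, pow_add]
    have : periodicPoisson (θ + 2 * Real.pi) c = periodicPoisson θ c :=
      periodicPoisson_periodic c θ
    rw [this]; ring
  · rwa [Ne, hp.pow_eq_one_iff_dvd]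
  · rw [← pow_mul, mul_comm (k + l), pow_mul, hp.pow_eq_one, one_pow]

lemma modePairing_reflect {N k : ℕ} (hN : 0 < N) (hk : k ≤ N) {c : ℝ} (hc : 0 < c) :
    modePairing N k (N - k) c = -4 * Real.pi * N * Complex.I *
      ((((k / N : ℝ)) ^ 2 * sinhRatio (1 - k / N) c ^ 2
        - (1 - k / N) ^ 2 * sinhRatio (k / N) c ^ 2 : ℝ) : ℂ) := by
  have hNr : (N : ℝ) ≠ 0 := by exact_mod_cast hN.ne'
  have h1 : (((N - k : ℕ) : ℝ) / N) = 1 - k / N := by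
    rw [Nat.cast_sub hk]; field_simp
  unfold modePairing
  rw [h1]
  simp_rw [cyclicMode_det _ _ hc]
  rw [intervalIntegral.integral_const, Complex.real_smul]
  push_cast; ring

/-- A superposition of modes of the cyclic model. -/
def modeSum (N : ℕ) (α : ℕ → ℂ) (M : ℝ → ℝ → ℝ → ℂ) (θ c : ℝ) : ℂ :=
  ∑ k ∈ Finset.range N, α k * M (k / N) θ c

lemma stripJet_modeSum (N : ℕ) (α : ℕ → ℂ) : StripJet (modeSum N α cyclicMode)
    (modeSum N α cyclicModeX) (modeSum N α cyclicModeXX) (modeSum N α cyclicModeY)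
    (modeSum N α cyclicModeYY) :=
  StripJet.sum (Finset.range N) fun k _ =>
    (stripJet_cyclicMode (k / N)).clm ((ContinuousLinearMap.mul ℝ ℂ) (α k))

lemma modeSum_pde (N : ℕ) (α : ℕ → ℂ) (θ : ℝ) {c : ℝ} (hc : 0 < c) :
    periodicPoisson θ c * (modeSum N α cyclicModeXX θ c + modeSum N α cyclicModeYY θ c)
      + 2 * (periodicPoissonX θ c * modeSum N α cyclicModeX θ c
        + periodicPoissonY θ c * modeSum N α cyclicModeY θ c) = 0 := by
  simp only [modeSum, ← Finset.sum_add_distrib, Finset.mul_sum]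
  refine Finset.sum_eq_zero fun k _ => ?_
  linear_combination α k * cyclicMode_pde (k / N) θ hc

lemma modeSum_periodic {N : ℕ} (hN : 0 < N) (α : ℕ → ℂ) {M : ℝ → ℝ → ℝ → ℂ}
    (hM : ∀ ξ θ c, M ξ (θ + 2 * Real.pi) c = expMode ξ (2 * Real.pi) * M ξ θ c) (θ c : ℝ) :
    modeSum N α M (θ + 2 * Real.pi * N) c = modeSum N α M θ c := by
  have hp := Complex.isPrimitiveRoot_exp N hN.ne'
  refine Finset.sum_congr rfl fun k _ => ?_
  have : ∀ n : ℕ, M (k / N) (θ + 2 * Real.pi * n) c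
      = expMode (k / N) (2 * Real.pi) ^ n * M (k / N) θ c := by
    intro n
    induction n with
    | zero => simp
    | succ n ih => rw [Nat.cast_succ, mul_add, mul_one, ← add_assoc, hM, ih, pow_succ]; ring
  rw [this, expMode_div_pow, ← pow_mul, mul_comm k N, pow_mul, hp.pow_eq_one, one_pow, one_mul]

lemma integral_modeSum_det {N : ℕ} (hN : 0 < N) (α β : ℕ → ℂ) {c : ℝ} (hc : 0 < c) :
    ∫ θ in (0 : ℝ)..2 * Real.pi * N, (periodicPoisson θ c : ℂ) *
      (modeSum N α cyclicModeX θ c * modeSum N β cyclicModeY θ c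
        - modeSum N β cyclicModeX θ c * modeSum N α cyclicModeY θ c)
    = ∑ k ∈ Finset.Ico 1 N, α k * β (N - k) * (-4 * Real.pi * N * Complex.I *
      ((((k / N : ℝ)) ^ 2 * sinhRatio (1 - k / N) c ^ 2
        - (1 - k / N) ^ 2 * sinhRatio (k / N) c ^ 2 : ℝ) : ℂ)) := by
  have hsec : ∀ {f : ℝ → ℝ → ℂ}, ContinuousOn (fun x : ℝ × ℝ => f x.1 x.2) upperStrip →
      Continuous fun θ => f θ c := fun {f} hf => by
    have := hf.comp_continuous (f := fun θ : ℝ => (θ, c)) (by fun_prop) (fun θ => hc)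
    exact this
  have hP : Continuous fun θ => (periodicPoisson θ c : ℂ) := by
    have := stripJet_periodicPoisson.cont.comp_continuous (f := fun θ : ℝ => (θ, c))
      (by fun_prop) (fun θ => hc)
    exact Complex.continuous_ofReal.comp this
  have hX : ∀ ξ, Continuous fun θ => cyclicModeX ξ θ c := fun ξ => hsec (stripJet_cyclicMode ξ).cont_x
  have hY : ∀ ξ, Continuous fun θ => cyclicModeY ξ θ c := fun ξ => hsec (stripJet_cyclicMode ξ).cont_y
  have hexp : ∀ θ, (periodicPoisson θ c : ℂ) *
      (modeSum N α cyclicModeX θ c * modeSum N β cyclicModeY θ c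
        - modeSum N β cyclicModeX θ c * modeSum N α cyclicModeY θ c) =
      ∑ k ∈ Finset.range N, ∑ l ∈ Finset.range N, α k * β l * ((periodicPoisson θ c : ℂ) *
        (cyclicModeX (k / N) θ c * cyclicModeY (l / N) θ c
          - cyclicModeX (l / N) θ c * cyclicModeY (k / N) θ c)) := fun θ => by
    simp only [modeSum]
    rw [mul_comm (∑ k ∈ Finset.range N, β k * cyclicModeX (k / N) θ c), Finset.sum_mul_sum,
      Finset.sum_mul_sum, ← Finset.sum_sub_distrib, Finset.mul_sum]
    refine Finset.sum_congr rfl fun k _ => ?_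
    rw [← Finset.sum_sub_distrib, Finset.mul_sum]
    refine Finset.sum_congr rfl fun l _ => ?_
    ring
  simp_rw [hexp]
  have hcont : ∀ k l : ℕ, Continuous fun θ => α k * β l * ((periodicPoisson θ c : ℂ) *
        (cyclicModeX (k / N) θ c * cyclicModeY (l / N) θ c
          - cyclicModeX (l / N) θ c * cyclicModeY (k / N) θ c)) := fun k l => by
    have h1 := hX (k / N)
    have h2 := hX (l / N)
    have h3 := hY (k / N)
    have h4 := hY (l / N)
    fun_prop
  rw [intervalIntegral.integral_finsetSum fun k _ =>
    (continuous_finsetSum _ fun l _ => hcont k l).intervalIntegrable _ _]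
  have hin : ∀ k ∈ Finset.range N, ∫ θ in (0 : ℝ)..2 * Real.pi * N, ∑ l ∈ Finset.range N,
      α k * β l * ((periodicPoisson θ c : ℂ) *
        (cyclicModeX (k / N) θ c * cyclicModeY (l / N) θ c
          - cyclicModeX (l / N) θ c * cyclicModeY (k / N) θ c)) =
      ∑ l ∈ Finset.range N, α k * β l * modePairing N k l c := fun k _ => by
    rw [intervalIntegral.integral_finsetSum fun l _ => (hcont k l).intervalIntegrable _ _]
    refine Finset.sum_congr rfl fun l _ => ?_
    rw [intervalIntegral.integral_const_mul, modePairing]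
  rw [Finset.sum_congr rfl hin]
  have hz1 : ∀ l : ℕ, modePairing N 0 l c = 0 := fun l => by
    simp [modePairing, cyclicModeX_zero, cyclicModeY_zero]
  have hz2 : ∀ k : ℕ, modePairing N k 0 c = 0 := fun l => by
    simp [modePairing, cyclicModeX_zero, cyclicModeY_zero]
  rw [← Finset.sum_subset (s₁ := Finset.Ico 1 N)]
  · refine Finset.sum_congr rfl fun k hk => ?_
    rw [Finset.mem_Ico] at hk
    rw [Finset.sum_eq_single_of_mem (N - k) (Finset.mem_range.2 (by omega)),
      modePairing_reflect hN hk.2.le hc]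
    intro l hl hne
    rw [Finset.mem_range] at hl
    rcases Nat.eq_zero_or_pos l with h0 | h0
    · rw [h0, hz2, mul_zero]
    · rw [modePairing_eq_zero hN, mul_zero]
      intro hd
      obtain ⟨d, hd⟩ := hd
      have : d = 1 := by
        have h1 : 0 < d := Nat.pos_of_ne_zero fun h => by rw [h] at hd; omega
        have h2 : d < 2 := by
          by_contra h
          have : N * 2 ≤ N * d := Nat.mul_le_mul_left _ (by omega)
          omega
        omega
      rw [this] at hd
      omega
  · intro k hk
    rw [Finset.mem_Ico] at hk
    exact Finset.mem_range.2 hk.2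
  · intro k hk hk'
    rw [Finset.mem_range] at hk
    rw [Finset.mem_Ico] at hk'
    have : k = 0 := by omega
    rw [this]
    simp [hz1]

/-- Normalized discrete Fourier coefficients. -/
def cyclicCoeff (N : ℕ) (a : ℕ → ℝ) (k : ℕ) : ℂ :=
  (1 / N) * ∑ n ∈ Finset.range N, a n * expMode (-(k / N)) (2 * Real.pi * n)

lemma modeSum_cyclicCoeff {N : ℕ} (hN : 0 < N) (a : ℕ → ℝ) (θ : ℝ) {c : ℝ} (hc : 0 < c) :
    modeSum N (cyclicCoeff N a) cyclicMode θ c =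
      ((∑ n ∈ Finset.range N, cyclicWeight N n θ c * a n : ℝ) : ℂ) := by
  push_cast
  simp_rw [cyclicWeight_eq_sum hN _ θ hc, modeSum, cyclicCoeff, Finset.mul_sum, Finset.sum_mul]
  rw [Finset.sum_comm]
  refine Finset.sum_congr rfl fun n _ => Finset.sum_congr rfl fun k _ => ?_
  ring

lemma HasDerivAt.im_eq_zero {f : ℝ → ℂ} {f' : ℂ} {x : ℝ} (h : HasDerivAt f f' x)
    (h0 : ∀ᶠ y in nhds x, (f y).im = 0) : f'.im = 0 := by
  have h1 : HasDerivAt (fun y => (f y).im) f'.im x :=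
    Complex.imCLM.hasFDerivAt.comp_hasDerivAt x h
  have h2 : HasDerivAt (fun y => (f y).im) 0 x :=
    (hasDerivAt_const x (0 : ℝ)).congr_of_eventuallyEq h0
  exact h1.unique h2

lemma modeSum_cyclicCoeff_im {N : ℕ} (hN : 0 < N) (a : ℕ → ℝ) (θ : ℝ) {c : ℝ} (hc : 0 < c) :
    (modeSum N (cyclicCoeff N a) cyclicModeX θ c).im = 0 ∧
      (modeSum N (cyclicCoeff N a) cyclicModeY θ c).im = 0 := by
  have h0 : ∀ θ c, 0 < c → (modeSum N (cyclicCoeff N a) cyclicMode θ c).im = 0 := fun θ c hc => by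
    rw [modeSum_cyclicCoeff hN a θ hc, Complex.ofReal_im]
  have hj := stripJet_modeSum N (cyclicCoeff N a)
  exact ⟨(hj.dx θ c hc).im_eq_zero (Filter.Eventually.of_forall fun y => h0 y c hc),
    (hj.dy θ c hc).im_eq_zero ((lt_mem_nhds hc).mono fun y hy => h0 θ y hy)⟩

lemma hasDerivAt_fderiv_comp {E : Type*} [NormedAddCommGroup E] [NormedSpace ℝ E] {F : E → ℝ}
    (hF : ContDiff ℝ 2 F) {V V1 : ℝ → E} {V2 : E} {x : ℝ} (hV : HasDerivAt V (V1 x) x)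
    (hV1 : HasDerivAt V1 V2 x) :
    HasDerivAt (fun x => fderiv ℝ F (V x) (V1 x))
      (fderiv ℝ (fderiv ℝ F) (V x) (V1 x) (V1 x) + fderiv ℝ F (V x) V2) x := by
  have h1 : HasFDerivAt (fderiv ℝ F) (fderiv ℝ (fderiv ℝ F) (V x)) (V x) :=
    (((hF.fderiv_right (m := 1) (by norm_num)).differentiable (by norm_num)) _).hasFDerivAt
  exact (h1.comp_hasDerivAt x hV).clm_apply hV1

lemma StripJet.mul_comp {E : Type*} [NormedAddCommGroup E] [NormedSpace ℝ E] {F : E → ℝ}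
    (hF : ContDiff ℝ 2 F) {h hx hxx hy hyy : ℝ → ℝ → ℝ} (H : StripJet h hx hxx hy hyy)
    {V Vx Vxx Vy Vyy : ℝ → ℝ → E} (J : StripJet V Vx Vxx Vy Vyy) :
    StripJet (fun θ c => h θ c * F (V θ c))
      (fun θ c => hx θ c * F (V θ c) + h θ c * fderiv ℝ F (V θ c) (Vx θ c))
      (fun θ c => hxx θ c * F (V θ c) + 2 * hx θ c * fderiv ℝ F (V θ c) (Vx θ c)
        + h θ c * (fderiv ℝ (fderiv ℝ F) (V θ c) (Vx θ c) (Vx θ c)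
          + fderiv ℝ F (V θ c) (Vxx θ c)))
      (fun θ c => hy θ c * F (V θ c) + h θ c * fderiv ℝ F (V θ c) (Vy θ c))
      (fun θ c => hyy θ c * F (V θ c) + 2 * hy θ c * fderiv ℝ F (V θ c) (Vy θ c)
        + h θ c * (fderiv ℝ (fderiv ℝ F) (V θ c) (Vy θ c) (Vy θ c)
          + fderiv ℝ F (V θ c) (Vyy θ c))) := by
  have hd : ∀ v, HasFDerivAt F (fderiv ℝ F v) v := fun v =>
    ((hF.differentiable (by norm_num)) v).hasFDerivAt
  have cF := hF.continuous
  have cF1 : Continuous (fderiv ℝ F) := hF.continuous_fderiv (by norm_num)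
  have cF2 : Continuous (fderiv ℝ (fderiv ℝ F)) :=
    (hF.fderiv_right (m := 1) (by norm_num)).continuous_fderiv (by norm_num)
  have k0 := cF.comp_continuousOn J.cont
  have k1 := cF1.comp_continuousOn J.cont
  have k2 := cF2.comp_continuousOn J.cont
  constructor
  · intro θ c hc
    exact (H.dx θ c hc).mul ((hd _).comp_hasDerivAt θ (J.dx θ c hc))
  · intro θ c hc
    refine (((H.dxx θ c hc).mul ((hd _).comp_hasDerivAt θ (J.dx θ c hc))).add
      ((H.dx θ c hc).mul (hasDerivAt_fderiv_comp hF (J.dx θ c hc) (J.dxx θ c hc)))).congr_deriv ?_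
    simp only [Function.comp_apply]
    ring
  · intro θ c hc
    exact (H.dy θ c hc).mul ((hd _).comp_hasDerivAt c (J.dy θ c hc))
  · intro θ c hc
    refine (((H.dyy θ c hc).mul ((hd _).comp_hasDerivAt c (J.dy θ c hc))).add
      ((H.dy θ c hc).mul (hasDerivAt_fderiv_comp hF (J.dy θ c hc) (J.dyy θ c hc)))).congr_deriv ?_
    simp only [Function.comp_apply]
    ring
  · exact H.cont.mul k0
  · exact (H.cont_x.mul k0).add (H.cont.mul (k1.clm_apply J.cont_x))
  · exact ((H.cont_xx.mul k0).add ((continuousOn_const.mul H.cont_x).mul (k1.clm_apply J.cont_x))).add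
      (H.cont.mul (((k2.clm_apply J.cont_x).clm_apply J.cont_x).add (k1.clm_apply J.cont_xx)))
  · exact (H.cont_y.mul k0).add (H.cont.mul (k1.clm_apply J.cont_y))
  · exact ((H.cont_yy.mul k0).add ((continuousOn_const.mul H.cont_y).mul (k1.clm_apply J.cont_y))).add
      (H.cont.mul (((k2.clm_apply J.cont_y).clm_apply J.cont_y).add (k1.clm_apply J.cont_yy)))

lemma continuous_slice {E : Type*} [TopologicalSpace E] {f : ℝ → ℝ → E}
    (hf : ContinuousOn (fun x : ℝ × ℝ => f x.1 x.2) upperStrip) {c : ℝ} (hc : 0 < c) :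
    Continuous fun θ => f θ c :=
  hf.comp_continuous (f := fun θ : ℝ => (θ, c)) (by fun_prop) (fun _ => hc)

lemma hasDerivAt_integral_slice {f g : ℝ → ℝ → ℝ} (L : ℝ)
    (hf : ContinuousOn (fun x : ℝ × ℝ => f x.1 x.2) upperStrip)
    (hg : ContinuousOn (fun x : ℝ × ℝ => g x.1 x.2) upperStrip)
    (hd : ∀ θ c, 0 < c → HasDerivAt (fun c => f θ c) (g θ c) c) {c : ℝ} (hc : 0 < c) :
    HasDerivAt (fun c => ∫ θ in (0 : ℝ)..L, f θ c) (∫ θ in (0 : ℝ)..L, g θ c) c := by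
  have hK : IsCompact (Set.uIcc 0 L ×ˢ Set.Icc (c / 2) (2 * c)) :=
    isCompact_uIcc.prod isCompact_Icc
  have hsub : Set.uIcc 0 L ×ˢ Set.Icc (c / 2) (2 * c) ⊆ upperStrip := fun x hx => by
    have := hx.2.1
    change 0 < x.2
    linarith
  obtain ⟨B, hB⟩ := hK.exists_bound_of_continuousOn (hg.mono hsub)
  have hs : Set.Ioo (c / 2) (2 * c) ∈ nhds c := Ioo_mem_nhds (by linarith) (by linarith)
  refine (intervalIntegral.hasDerivAt_integral_of_dominated_loc_of_deriv_le
    (F := fun c θ => f θ c) (F' := fun c θ => g θ c) (bound := fun _ => B) hs ?_ ?_ ?_ ?_ ?_ ?_).2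
  · filter_upwards [lt_mem_nhds hc] with y hy
    exact (continuous_slice hf hy).aestronglyMeasurable
  · exact (continuous_slice hf hc).intervalIntegrable _ _
  · exact (continuous_slice hg hc).aestronglyMeasurable
  · refine Filter.Eventually.of_forall fun t ht x hx => ?_
    exact hB (t, x) ⟨Set.uIoc_subset_uIcc ht, ⟨hx.1.le, hx.2.le⟩⟩
  · exact intervalIntegrable_const
  · refine Filter.Eventually.of_forall fun t ht x hx => ?_
    exact hd t x (by have := hx.1; linarith)

lemma StripJet.integral_deriv2 {f fx fxx fy fyy : ℝ → ℝ → ℝ} (H : StripJet f fx fxx fy fyy) (L : ℝ)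
    {c : ℝ} (hc : 0 < c) :
    HasDerivAt (fun c => ∫ θ in (0 : ℝ)..L, f θ c) (∫ θ in (0 : ℝ)..L, fy θ c) c ∧
      HasDerivAt (fun c => ∫ θ in (0 : ℝ)..L, fy θ c) (∫ θ in (0 : ℝ)..L, fyy θ c) c :=
  ⟨hasDerivAt_integral_slice L H.cont H.cont_y H.dy hc,
    hasDerivAt_integral_slice L H.cont_y H.cont_yy H.dyy hc⟩

lemma StripJet.integral_xx {f fx fxx fy fyy : ℝ → ℝ → ℝ} (H : StripJet f fx fxx fy fyy) (L : ℝ)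
    {c : ℝ} (hc : 0 < c) : ∫ θ in (0 : ℝ)..L, fxx θ c = fx L c - fx 0 c :=
  intervalIntegral.integral_eq_sub_of_hasDerivAt (fun θ _ => H.dxx θ c hc)
    ((continuous_slice H.cont_xx hc).intervalIntegrable _ _)

lemma StripJet.intervalIntegrable_xx {f fx fxx fy fyy : ℝ → ℝ → ℝ}
    (H : StripJet f fx fxx fy fyy) (L : ℝ) {c : ℝ} (hc : 0 < c) :
    IntervalIntegrable (fun θ => fxx θ c) volume 0 L :=
  (continuous_slice H.cont_xx hc).intervalIntegrable _ _

lemma StripJet.intervalIntegrable_yy {f fx fxx fy fyy : ℝ → ℝ → ℝ}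
    (H : StripJet f fx fxx fy fyy) (L : ℝ) {c : ℝ} (hc : 0 < c) :
    IntervalIntegrable (fun θ => fyy θ c) volume 0 L :=
  (continuous_slice H.cont_yy hc).intervalIntegrable _ _

/-- The second radial derivative of an integral mean, in terms of the Hessian. -/
lemma integral_deriv2_eq_hessian {E : Type*} [NormedAddCommGroup E] [NormedSpace ℝ E] {F : E → ℝ}
    (hF : ContDiff ℝ 2 F) {h hx hxx hy hyy : ℝ → ℝ → ℝ} (H : StripJet h hx hxx hy hyy)
    {V Vx Vxx Vy Vyy : ℝ → ℝ → E} (J : StripJet V Vx Vxx Vy Vyy) {L c : ℝ} (hc : 0 < c)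
    (hharm : ∀ θ, hxx θ c + hyy θ c = 0)
    (hpde : ∀ θ, h θ c • (Vxx θ c + Vyy θ c)
      + (2 : ℝ) • (hx θ c • Vx θ c + hy θ c • Vy θ c) = 0)
    (p0 : h L c = h 0 c) (p1 : hx L c = hx 0 c) (p2 : V L c = V 0 c) (p3 : Vx L c = Vx 0 c) :
    (∫ θ in (0 : ℝ)..L, (hyy θ c * F (V θ c) + 2 * hy θ c * fderiv ℝ F (V θ c) (Vy θ c)
        + h θ c * (fderiv ℝ (fderiv ℝ F) (V θ c) (Vy θ c) (Vy θ c)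
          + fderiv ℝ F (V θ c) (Vyy θ c)))) =
    ∫ θ in (0 : ℝ)..L, h θ c * (fderiv ℝ (fderiv ℝ F) (V θ c) (Vx θ c) (Vx θ c)
      + fderiv ℝ (fderiv ℝ F) (V θ c) (Vy θ c) (Vy θ c)) := by
  have K := StripJet.mul_comp hF H J
  have h0 := K.integral_xx L hc
  rw [p0, p1, p2, p3, sub_self] at h0
  have i1 := K.intervalIntegrable_xx L hc
  have i2 := K.intervalIntegrable_yy L hc
  have h1 := intervalIntegral.integral_add i1 i2
  rw [h0, zero_add] at h1
  rw [← h1]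
  refine intervalIntegral.integral_congr fun θ _ => ?_
  have e := congrArg (fderiv ℝ F (V θ c)) (hpde θ)
  simp only [map_add, map_smul, map_zero, smul_eq_mul] at e
  linear_combination e + F (V θ c) * hharm θ

lemma sum_nat_mul_pow (l : ℂ) (N : ℕ) :
    (∑ k ∈ Finset.range N, (k : ℂ) * l ^ k) * (l - 1)
      = N * l ^ N - l * ∑ k ∈ Finset.range N, l ^ k := by
  induction N with
  | zero => simp
  | succ n ih =>
    rw [Finset.sum_range_succ, Finset.sum_range_succ, add_mul, ih]
    push_cast; ring

lemma sum_sawtooth_pow {N : ℕ} (hN : 0 < N) {l : ℂ} (hl : l ^ N = 1) (h1 : l ≠ 1) :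
    ∑ k ∈ Finset.Ico 1 N, (1 - 2 * (k / N : ℂ)) * l ^ k = (l + 1) / (1 - l) := by
  have hN' : (N : ℂ) ≠ 0 := by exact_mod_cast hN.ne'
  have h2 : (1 : ℂ) - l ≠ 0 := sub_ne_zero.2 h1.symm
  have hg : ∑ k ∈ Finset.range N, l ^ k = 0 := by
    rw [geom_sum_eq h1, hl, sub_self, zero_div]
  have hs := sum_nat_mul_pow l N
  rw [hg, hl] at hs
  have hr : ∑ k ∈ Finset.range N, (1 - 2 * (k / N : ℂ)) * l ^ k
      = ∑ k ∈ Finset.range N, l ^ k - 2 / N * ∑ k ∈ Finset.range N, (k : ℂ) * l ^ k := by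
    rw [Finset.mul_sum, ← Finset.sum_sub_distrib]
    exact Finset.sum_congr rfl fun k _ => by ring
  rw [Finset.range_eq_Ico, Finset.sum_eq_sum_Ico_succ_bot hN, ← Finset.range_eq_Ico, hg] at hr
  rw [eq_div_iff h2]
  have h3 : (∑ k ∈ Finset.Ico 1 N, (1 - 2 * (k / N : ℂ)) * l ^ k)
      = -1 - 2 / N * ∑ k ∈ Finset.range N, (k : ℂ) * l ^ k := by
    simp only [zero_add, pow_zero, Nat.cast_zero, zero_div, mul_zero, sub_zero, one_mul] at hr
    linear_combination hr
  rw [h3]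
  field_simp
  linear_combination 2 * hs

lemma sum_sawtooth {N : ℕ} (hN : 0 < N) :
    ∑ k ∈ Finset.Ico 1 N, (1 - 2 * (k / N : ℂ)) = 0 := by
  have hN' : (N : ℂ) ≠ 0 := by exact_mod_cast hN.ne'
  have h2 := Finset.sum_range_id_mul_two N
  have h3 : (∑ k ∈ Finset.range N, (k : ℂ)) * 2 = N * (N - 1) := by
    have := congrArg (Nat.cast : ℕ → ℂ) h2
    push_cast [Nat.cast_sub hN] at this
    simpa using this
  have hr : ∑ k ∈ Finset.range N, (1 - 2 * (k / N : ℂ)) = 1 := by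
    have : ∀ k ∈ Finset.range N, (1 - 2 * (k / N : ℂ)) = 1 - 2 / N * k := fun k _ => by ring
    rw [Finset.sum_congr rfl this, Finset.sum_sub_distrib, ← Finset.mul_sum]
    simp only [Finset.sum_const, Finset.card_range, nsmul_eq_mul, mul_one]
    field_simp
    linear_combination -h3
  rw [Finset.range_eq_Ico, Finset.sum_eq_sum_Ico_succ_bot hN] at hr
  simp only [zero_add, Nat.cast_zero, zero_div, mul_zero, sub_zero] at hr
  linear_combination hr

lemma sum_sawtooth_exp {N : ℕ} (hN : 0 < N) {m n : ℕ} (hm : m < N) (hn : n < N) :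
    ∑ k ∈ Finset.Ico 1 N, (1 - 2 * (k / N : ℂ)) *
      Complex.exp (2 * Complex.I * ((Real.pi * ((n : ℝ) - m) / N : ℝ) : ℂ)) ^ k
      = Complex.I * (Real.cot (Real.pi * ((n : ℝ) - m) / N) : ℂ) := by
  have hN' : (N : ℂ) ≠ 0 := by exact_mod_cast hN.ne'
  rcases eq_or_ne n m with h | h
  · subst h
    simp [sum_sawtooth hN, Real.cot_eq_cos_div_sin]
  · rw [sum_sawtooth_pow hN, Complex.ofReal_cot, Complex.cot_eq_exp_ratio]
    · have := Complex.I_ne_zero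
      field_simp
    · rw [← Complex.exp_nat_mul, Complex.exp_eq_one_iff]
      refine ⟨(n : ℤ) - m, ?_⟩
      push_cast; field_simp
    · rw [Ne, Complex.exp_eq_one_iff]
      rintro ⟨j, hj⟩
      have hpi : (Real.pi : ℂ) ≠ 0 := by exact_mod_cast Real.pi_ne_zero
      have h1 : ((n : ℂ) - m) = j * N := by
        have hI := Complex.I_ne_zero
        push_cast at hj
        field_simp at hj
        linear_combination hj
      have h2 : (n : ℤ) - m = j * N := by exact_mod_cast h1
      have h3 : (N : ℤ) ∣ (n : ℤ) - m := ⟨j, by rw [h2, mul_comm]⟩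
      have h4 := Int.eq_zero_of_abs_lt_dvd h3 (by rw [abs_lt]; constructor <;> omega)
      omega

lemma cyclicCoeff_pairing {N : ℕ} (hN : 0 < N) (a b : ℕ → ℝ) :
    ∑ k ∈ Finset.Ico 1 N, cyclicCoeff N a k * cyclicCoeff N b (N - k) * (1 - 2 * (k / N : ℂ)) =
      Complex.I / N ^ 2 * ((∑ m ∈ Finset.range N, ∑ n ∈ Finset.range N,
        a m * b n * Real.cot (Real.pi * ((n : ℝ) - m) / N) : ℝ) : ℂ) := by
  have hN' : (N : ℂ) ≠ 0 := by exact_mod_cast hN.ne'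
  have hterm : ∀ k ∈ Finset.Ico 1 N,
      cyclicCoeff N a k * cyclicCoeff N b (N - k) * (1 - 2 * (k / N : ℂ)) =
      ∑ m ∈ Finset.range N, ∑ n ∈ Finset.range N, 1 / (N : ℂ) ^ 2 * (a m * b n) *
        ((1 - 2 * (k / N : ℂ)) *
          Complex.exp (2 * Complex.I * ((Real.pi * ((n : ℝ) - m) / N : ℝ) : ℂ)) ^ k) := by
    intro k hk
    rw [Finset.mem_Ico] at hk
    rw [cyclicCoeff, cyclicCoeff, mul_mul_mul_comm, Finset.sum_mul_sum, mul_assoc, Finset.sum_mul,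
      Finset.mul_sum]
    refine Finset.sum_congr rfl fun m _ => ?_
    rw [Finset.sum_mul, Finset.mul_sum]
    refine Finset.sum_congr rfl fun n _ => ?_
    have he : expMode (-(k / N)) (2 * Real.pi * m) * expMode (-((N - k : ℕ) / N)) (2 * Real.pi * n)
        = Complex.exp (2 * Complex.I * ((Real.pi * ((n : ℝ) - m) / N : ℝ) : ℂ)) ^ k := by
      rw [expMode, expMode, ← Complex.exp_add, ← Complex.exp_nat_mul]
      refine ((Complex.exp_periodic.nat_mul n) _).symm.trans (congrArg Complex.exp ?_)
      rw [Nat.cast_sub hk.2.le]; push_cast; field_simp; ring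
    rw [← he]; ring
  rw [Finset.sum_congr rfl hterm, Finset.sum_comm]
  push_cast
  rw [Finset.mul_sum]
  refine Finset.sum_congr rfl fun m hm => ?_
  rw [Finset.sum_comm, Finset.mul_sum]
  refine Finset.sum_congr rfl fun n hn => ?_
  have hs := sum_sawtooth_exp hN (Finset.mem_range.1 hm) (Finset.mem_range.1 hn)
  push_cast at hs
  rw [← Finset.mul_sum, hs]
  ring

section

open Filter Topology

open Filter Topology

lemma StripJet.prodMk {E E' : Type*} [NormedAddCommGroup E] [NormedSpace ℝ E]
    [NormedAddCommGroup E'] [NormedSpace ℝ E'] {f fx fxx fy fyy : ℝ → ℝ → E}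
    {g gx gxx gy gyy : ℝ → ℝ → E'} (hf : StripJet f fx fxx fy fyy)
    (hg : StripJet g gx gxx gy gyy) :
    StripJet (fun θ c => (f θ c, g θ c)) (fun θ c => (fx θ c, gx θ c))
      (fun θ c => (fxx θ c, gxx θ c)) (fun θ c => (fy θ c, gy θ c))
      (fun θ c => (fyy θ c, gyy θ c)) where
  dx θ c hc := (hf.dx θ c hc).prodMk (hg.dx θ c hc)
  dxx θ c hc := (hf.dxx θ c hc).prodMk (hg.dxx θ c hc)
  dy θ c hc := (hf.dy θ c hc).prodMk (hg.dy θ c hc)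
  dyy θ c hc := (hf.dyy θ c hc).prodMk (hg.dyy θ c hc)
  cont := hf.cont.prodMk hg.cont
  cont_x := hf.cont_x.prodMk hg.cont_x
  cont_xx := hf.cont_xx.prodMk hg.cont_xx
  cont_y := hf.cont_y.prodMk hg.cont_y
  cont_yy := hf.cont_yy.prodMk hg.cont_yy

/-- The real parts of a pair of superpositions of cyclic modes. -/
def modePair (N : ℕ) (α β : ℕ → ℂ) (M : ℝ → ℝ → ℝ → ℂ) (θ c : ℝ) : ℝ × ℝ :=
  ((modeSum N α M θ c).re, (modeSum N β M θ c).re)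

lemma stripJet_modePair (N : ℕ) (α β : ℕ → ℂ) : StripJet (modePair N α β cyclicMode)
    (modePair N α β cyclicModeX) (modePair N α β cyclicModeXX) (modePair N α β cyclicModeY)
    (modePair N α β cyclicModeYY) :=
  ((stripJet_modeSum N α).clm Complex.reCLM).prodMk ((stripJet_modeSum N β).clm Complex.reCLM)

lemma modePair_pde (N : ℕ) (α β : ℕ → ℂ) (θ : ℝ) {c : ℝ} (hc : 0 < c) :
    periodicPoisson θ c • (modePair N α β cyclicModeXX θ c + modePair N α β cyclicModeYY θ c)
      + (2 : ℝ) • (periodicPoissonX θ c • modePair N α β cyclicModeX θ c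
        + periodicPoissonY θ c • modePair N α β cyclicModeY θ c) = 0 := by
  have key : ∀ α : ℕ → ℂ, periodicPoisson θ c *
      ((modeSum N α cyclicModeXX θ c).re + (modeSum N α cyclicModeYY θ c).re)
      + 2 * (periodicPoissonX θ c * (modeSum N α cyclicModeX θ c).re
        + periodicPoissonY θ c * (modeSum N α cyclicModeY θ c).re) = 0 := fun α => by
    have := congrArg Complex.re (modeSum_pde N α θ hc)
    simpa using this
  ext
  · simpa [modePair] using key α
  · simpa [modePair] using key β

lemma modePair_cyclicCoeff {N : ℕ} (hN : 0 < N) (a b : ℕ → ℝ) (θ : ℝ) {c : ℝ} (hc : 0 < c) :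
    modePair N (cyclicCoeff N a) (cyclicCoeff N b) cyclicMode θ c =
      ∑ n ∈ Finset.range N, cyclicWeight N n θ c • (a n, b n) := by
  rw [modePair, modeSum_cyclicCoeff hN a θ hc, modeSum_cyclicCoeff hN b θ hc]
  ext <;> simp [Prod.fst_sum, Prod.snd_sum, -Complex.ofReal_sum]

lemma planeDet_modePair {N : ℕ} (hN : 0 < N) (a b : ℕ → ℝ) (θ : ℝ) {c : ℝ} (hc : 0 < c) :
    planeDet (modePair N (cyclicCoeff N a) (cyclicCoeff N b) cyclicModeX θ c)
        (modePair N (cyclicCoeff N a) (cyclicCoeff N b) cyclicModeY θ c) =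
      (modeSum N (cyclicCoeff N a) cyclicModeX θ c * modeSum N (cyclicCoeff N b) cyclicModeY θ c
        - modeSum N (cyclicCoeff N b) cyclicModeX θ c
          * modeSum N (cyclicCoeff N a) cyclicModeY θ c).re := by
  obtain ⟨h1, h2⟩ := modeSum_cyclicCoeff_im hN a θ hc
  obtain ⟨h3, h4⟩ := modeSum_cyclicCoeff_im hN b θ hc
  simp [planeDet, modePair, h1, h2, h3, h4]
  ring

/-- The integral of a convex energy density over one full period of the cyclic model. -/
def cyclicEnergy (F : ℝ × ℝ → ℝ) (N : ℕ) (a b : ℕ → ℝ) (c : ℝ) : ℝ :=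
  ∫ θ in (0 : ℝ)..2 * Real.pi * N, periodicPoisson θ c *
    F (modePair N (cyclicCoeff N a) (cyclicCoeff N b) cyclicMode θ c)

lemma continuous_periodicPoisson {c : ℝ} (hc : 0 < c) :
    Continuous fun θ => periodicPoisson θ c :=
  continuous_slice stripJet_periodicPoisson.cont hc

lemma continuous_mul_cyclicWeight (N n : ℕ) {c : ℝ} (hN : 0 < N) (hc : 0 < c) :
    Continuous fun θ => periodicPoisson θ c * cyclicWeight N n θ c := by
  have hNr : (0 : ℝ) < N := by exact_mod_cast hN
  have h1 : ∀ θ, periodicPoisson θ c * cyclicWeight N n θ c =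
      (N : ℝ)⁻¹ * periodicPoisson ((θ - 2 * Real.pi * n) / N) (c / N) := fun θ => by
    have := (periodicPoisson_pos θ hc).ne'
    rw [cyclicWeight]; field_simp
  simp_rw [h1]
  have := continuous_periodicPoisson (div_pos hc hNr)
  exact continuous_const.mul (this.comp (by fun_prop))

lemma cyclicEnergy_bounds {F : ℝ × ℝ → ℝ} (hF : AreaConvex F) {N : ℕ} (hN : 0 < N)
    (a b : ℕ → ℝ) {c : ℝ} (hc : 0 < c) : 0 ≤ cyclicEnergy F N a b c ∧
      cyclicEnergy F N a b c ≤ 2 * Real.pi * ∑ n ∈ Finset.range N, F (a n, b n) := by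
  have hL : (0 : ℝ) ≤ 2 * Real.pi * N := by positivity
  constructor
  · exact intervalIntegral.integral_nonneg hL fun θ _ =>
      mul_nonneg (periodicPoisson_pos θ hc).le (hF.nonneg _)
  have hsum : ∫ θ in (0 : ℝ)..2 * Real.pi * N,
      ∑ n ∈ Finset.range N, (periodicPoisson θ c * cyclicWeight N n θ c) * F (a n, b n) =
      2 * Real.pi * ∑ n ∈ Finset.range N, F (a n, b n) := by
    have hi : ∀ n ∈ Finset.range N, IntervalIntegrable
        (fun θ => (periodicPoisson θ c * cyclicWeight N n θ c) * F (a n, b n)) volume 0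
        (2 * Real.pi * N) := fun n _ =>
      ((continuous_mul_cyclicWeight N n hN hc).mul continuous_const).intervalIntegrable _ _
    rw [intervalIntegral.integral_finsetSum hi]
    simp_rw [intervalIntegral.integral_mul_const, integral_mul_cyclicWeight hN _ hc, Finset.mul_sum]
  rw [← hsum]
  have hJ := stripJet_modePair N (cyclicCoeff N a) (cyclicCoeff N b)
  refine intervalIntegral.integral_mono_on hL
    (((continuous_periodicPoisson hc).mul
      (hF.contDiff.continuous.comp (continuous_slice hJ.cont hc))).intervalIntegrable _ _)
    ((continuous_finsetSum _ fun n _ =>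
      (continuous_mul_cyclicWeight N n hN hc).mul continuous_const).intervalIntegrable _ _)
    fun θ _ => ?_
  rw [modePair_cyclicCoeff hN a b θ hc]
  have := hF.convex.map_sum_le (t := Finset.range N) (w := fun n => cyclicWeight N n θ c)
    (p := fun n => (a n, b n)) (fun n _ => cyclicWeight_nonneg N n θ hc)
    (sum_cyclicWeight hN θ hc) (fun _ _ => Set.mem_univ _)
  calc _ ≤ _ := mul_le_mul_of_nonneg_left this (periodicPoisson_pos θ hc).le
    _ = _ := by
      rw [Finset.mul_sum]
      exact Finset.sum_congr rfl fun n _ => by rw [smul_eq_mul, mul_assoc]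

/-- The area form of the cyclic model at height `c`. -/
def cyclicArea (N : ℕ) (a b : ℕ → ℝ) (c : ℝ) : ℝ :=
  ∫ θ in (0 : ℝ)..2 * Real.pi * N, periodicPoisson θ c *
    planeDet (modePair N (cyclicCoeff N a) (cyclicCoeff N b) cyclicModeX θ c)
        (modePair N (cyclicCoeff N a) (cyclicCoeff N b) cyclicModeY θ c)

/-- An explicit primitive of twice the weighted area form. -/
def cyclicPrimitive (N : ℕ) (a b : ℕ → ℝ) (c : ℝ) : ℝ :=
  ∑ k ∈ Finset.Ico 1 N, (cyclicCoeff N a k * cyclicCoeff N b (N - k) *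
    (-8 * Real.pi * N * Complex.I)).re * modePrimitive (1 - k / N) c

lemma cyclicArea_eq {N : ℕ} (hN : 0 < N) (a b : ℕ → ℝ) {c : ℝ} (hc : 0 < c) :
    cyclicArea N a b c = ∑ k ∈ Finset.Ico 1 N, (cyclicCoeff N a k * cyclicCoeff N b (N - k) *
      (-4 * Real.pi * N * Complex.I)).re * (((k / N : ℝ)) ^ 2 * sinhRatio (1 - k / N) c ^ 2
        - (1 - k / N) ^ 2 * sinhRatio (k / N) c ^ 2) := by
  have h := congrArg Complex.re
    (integral_modeSum_det hN (cyclicCoeff N a) (cyclicCoeff N b) hc)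
  have hs := fun α => stripJet_modeSum N α
  have hci : IntervalIntegrable (fun θ => (periodicPoisson θ c : ℂ) *
      (modeSum N (cyclicCoeff N a) cyclicModeX θ c * modeSum N (cyclicCoeff N b) cyclicModeY θ c
        - modeSum N (cyclicCoeff N b) cyclicModeX θ c
          * modeSum N (cyclicCoeff N a) cyclicModeY θ c)) volume 0 (2 * Real.pi * N) :=
    (((Complex.continuous_ofReal.comp (continuous_periodicPoisson hc)).mul
      (((continuous_slice (hs _).cont_x hc).mul (continuous_slice (hs _).cont_y hc)).sub
      ((continuous_slice (hs _).cont_x hc).mul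
        (continuous_slice (hs _).cont_y hc))))).intervalIntegrable _ _
  have h2 := Complex.reCLM.intervalIntegral_comp_comm hci
  rw [Complex.reCLM_apply, h] at h2
  rw [cyclicArea]
  simp_rw [planeDet_modePair hN a b _ hc, ← Complex.re_ofReal_mul]
  refine h2.trans ?_
  rw [Complex.re_sum]
  refine Finset.sum_congr rfl fun k _ => ?_
  rw [← mul_assoc, Complex.re_mul_ofReal]

lemma hasDerivAt_cyclicPrimitive {N : ℕ} (hN : 0 < N) (a b : ℕ → ℝ) {c : ℝ} (hc : 0 < c) :
    HasDerivAt (cyclicPrimitive N a b) (cothWeight c * (2 * cyclicArea N a b c)) c := by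
  have h : HasDerivAt (cyclicPrimitive N a b) _ c :=
    HasDerivAt.fun_sum fun k (_ : k ∈ Finset.Ico 1 N) =>
      (hasDerivAt_modePrimitive (1 - k / N) hc).const_mul _
  convert h using 1
  rw [cyclicArea_eq hN a b hc, Finset.mul_sum, Finset.mul_sum]
  refine Finset.sum_congr rfl fun k _ => ?_
  have : cyclicCoeff N a k * cyclicCoeff N b (N - k) * (-8 * Real.pi * N * Complex.I) =
    ((2 : ℝ) : ℂ) * (cyclicCoeff N a k * cyclicCoeff N b (N - k) *
      (-4 * Real.pi * N * Complex.I)) := by push_cast; ring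
  rw [this, Complex.re_ofReal_mul]
  ring_nf

lemma tendsto_cyclicPrimitive_zero (N : ℕ) (a b : ℕ → ℝ) :
    Tendsto (cyclicPrimitive N a b) (𝓝[>] 0) (𝓝 0) := by
  have := tendsto_finsetSum (Finset.Ico 1 N) fun k _ =>
    (tendsto_modePrimitive_zero (1 - k / N)).const_mul
      (cyclicCoeff N a k * cyclicCoeff N b (N - k) * (-8 * Real.pi * N * Complex.I)).re
  simp only [mul_zero, Finset.sum_const_zero] at this
  exact this

lemma tendsto_cyclicPrimitive_atTop {N : ℕ} (hN : 0 < N) (a b : ℕ → ℝ) :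
    Tendsto (cyclicPrimitive N a b) atTop (𝓝 (2 * Real.pi / N *
      ∑ m ∈ Finset.range N, ∑ n ∈ Finset.range N,
        a m * b n * Real.cot (Real.pi * ((n : ℝ) - m) / N))) := by
  have hNr : (0 : ℝ) < N := by exact_mod_cast hN
  have hN' : (N : ℂ) ≠ 0 := by exact_mod_cast hN.ne'
  have := tendsto_finsetSum (Finset.Ico 1 N) fun k hk =>
    (tendsto_modePrimitive_atTop (a := 1 - k / N)
      (by
        have : (k : ℝ) < N := by exact_mod_cast (Finset.mem_Ico.1 hk).2
        rw [sub_pos, div_lt_one hNr]; exact this)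
      (by
        have : (0 : ℝ) < k := by exact_mod_cast (Finset.mem_Ico.1 hk).1
        have := div_pos this hNr
        linarith)).const_mul
      (cyclicCoeff N a k * cyclicCoeff N b (N - k) * (-8 * Real.pi * N * Complex.I)).re
  convert! this using 2
  have h := congrArg (fun z => (z * (-2 * Real.pi * N * Complex.I)).re)
    (cyclicCoeff_pairing hN a b)
  set S : ℝ := ∑ m ∈ Finset.range N, ∑ n ∈ Finset.range N,
        a m * b n * Real.cot (Real.pi * ((n : ℝ) - m) / N)
  have e : Complex.I / N ^ 2 * (S : ℂ) * (-2 * Real.pi * N * Complex.I) =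
      ((2 * Real.pi / N * S : ℝ) : ℂ) := by
    push_cast; field_simp; linear_combination (-(S : ℂ)) * Complex.I_sq
  simp only [e, Complex.ofReal_re, Finset.sum_mul, Complex.re_sum] at h
  rw [← h]
  refine Finset.sum_congr rfl fun k _ => ?_
  rw [← Complex.re_mul_ofReal]
  congr 1
  push_cast; ring

lemma cyclicEnergy_deriv2 {F : ℝ × ℝ → ℝ} (hF : AreaConvex F) {N : ℕ} (hN : 0 < N)
    (a b : ℕ → ℝ) : ∃ I1 I2 : ℝ → ℝ, ∀ c, 0 < c → HasDerivAt (cyclicEnergy F N a b) (I1 c) c ∧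
      HasDerivAt I1 (I2 c) c ∧ 0 ≤ I2 c ∧ 2 * cyclicArea N a b c ≤ I2 c := by
  have hJ := stripJet_modePair N (cyclicCoeff N a) (cyclicCoeff N b)
  have hH := stripJet_periodicPoisson
  have hF2 : ContDiff ℝ 2 F := hF.contDiff.of_le (by norm_cast)
  have K := StripJet.mul_comp hF2 hH hJ
  refine ⟨_, _, fun c hc => ⟨(K.integral_deriv2 (2 * Real.pi * N) hc).1,
    (K.integral_deriv2 (2 * Real.pi * N) hc).2, ?_⟩⟩
  have hper : Function.Periodic (fun θ => periodicPoisson θ c) (2 * Real.pi * N) := by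
    have := (periodicPoisson_periodic c).nat_mul N
    rwa [mul_comm] at this
  have hperX : Function.Periodic (fun θ => periodicPoissonX θ c) (2 * Real.pi * N) := by
    have h0 : Function.Periodic (fun θ => periodicPoissonX θ c) (2 * Real.pi) := fun θ => by
      simp [periodicPoissonX, poissonDenom]
    have := h0.nat_mul N
    rwa [mul_comm] at this
  have hpair : ∀ {M : ℝ → ℝ → ℝ → ℂ},
      (∀ ξ θ c, M ξ (θ + 2 * Real.pi) c = expMode ξ (2 * Real.pi) * M ξ θ c) →
      modePair N (cyclicCoeff N a) (cyclicCoeff N b) M (2 * Real.pi * N) c =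
      modePair N (cyclicCoeff N a) (cyclicCoeff N b) M 0 c := fun {M} hM => by
    have h1 := modeSum_periodic hN (cyclicCoeff N a) hM 0 c
    have h2 := modeSum_periodic hN (cyclicCoeff N b) hM 0 c
    rw [zero_add] at h1 h2
    rw [modePair, modePair, h1, h2]
  have hhess := integral_deriv2_eq_hessian hF2 hH hJ hc (L := 2 * Real.pi * N)
    (fun θ => periodicPoisson_harmonic θ hc) (fun θ => modePair_pde N _ _ θ hc)
    (by simpa using hper 0) (by simpa using hperX 0)
    (hpair cyclicMode_quasiperiodic) (hpair cyclicModeX_quasiperiodic)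
  rw [hhess]
  have hL : (0 : ℝ) ≤ 2 * Real.pi * N := by positivity
  have c1 : Continuous fun θ => modePair N (cyclicCoeff N a) (cyclicCoeff N b) cyclicMode θ c :=
    continuous_slice hJ.cont hc
  have c2 : Continuous fun θ => modePair N (cyclicCoeff N a) (cyclicCoeff N b) cyclicModeX θ c :=
    continuous_slice hJ.cont_x hc
  have c3 : Continuous fun θ => modePair N (cyclicCoeff N a) (cyclicCoeff N b) cyclicModeY θ c :=
    continuous_slice hJ.cont_y hc
  have cF : Continuous (fderiv ℝ (fderiv ℝ F)) := by
    have h1 : ContDiff ℝ 1 (fderiv ℝ F) := hF2.fderiv_right (by norm_num)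
    exact h1.continuous_fderiv (by norm_num)
  have c0 := continuous_periodicPoisson hc
  constructor
  · refine intervalIntegral.integral_nonneg hL fun θ _ =>
      mul_nonneg (periodicPoisson_pos θ hc).le ?_
    have h1 := hF.hessian (modePair N (cyclicCoeff N a) (cyclicCoeff N b) cyclicMode θ c)
      (modePair N (cyclicCoeff N a) (cyclicCoeff N b) cyclicModeX θ c)
      (modePair N (cyclicCoeff N a) (cyclicCoeff N b) cyclicModeY θ c)
    have h2 := hF.hessian (modePair N (cyclicCoeff N a) (cyclicCoeff N b) cyclicMode θ c)
      (modePair N (cyclicCoeff N a) (cyclicCoeff N b) cyclicModeY θ c)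
      (modePair N (cyclicCoeff N a) (cyclicCoeff N b) cyclicModeX θ c)
    simp only [planeDet] at h1 h2
    linarith
  · rw [cyclicArea, ← intervalIntegral.integral_const_mul]
    refine intervalIntegral.integral_mono_on hL (Continuous.intervalIntegrable ?_ _ _)
      (Continuous.intervalIntegrable ?_ _ _) fun θ _ => ?_
    · simp only [planeDet]
      exact continuous_const.mul (c0.mul ((c2.fst.mul c3.snd).sub (c3.fst.mul c2.snd)))
    · exact c0.mul ((((cF.comp c1).clm_apply c2).clm_apply c2).add
        (((cF.comp c1).clm_apply c3).clm_apply c3))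
    · have h1 := hF.hessian (modePair N (cyclicCoeff N a) (cyclicCoeff N b) cyclicMode θ c)
        (modePair N (cyclicCoeff N a) (cyclicCoeff N b) cyclicModeX θ c)
        (modePair N (cyclicCoeff N a) (cyclicCoeff N b) cyclicModeY θ c)
      have := mul_le_mul_of_nonneg_left h1 (periodicPoisson_pos θ hc).le
      linarith

/-- The discrete bilinear estimate on a cyclic group. -/
theorem AreaConvex.sum_cot_le {F : ℝ × ℝ → ℝ} (hF : AreaConvex F) {N : ℕ} (hN : 0 < N)
    (a b : ℕ → ℝ) :
    1 / N * ∑ m ∈ Finset.range N, ∑ n ∈ Finset.range N,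
        a m * b n * Real.cot (Real.pi * ((n : ℝ) - m) / N)
      ≤ ∑ n ∈ Finset.range N, F (a n, b n) := by
  obtain ⟨I1, I2, hI⟩ := cyclicEnergy_deriv2 hF hN a b
  set K := 2 * Real.pi * ∑ n ∈ Finset.range N, F (a n, b n)
  have hle : ∀ ε Y, 0 < ε → ε ≤ Y → cyclicPrimitive N a b Y - cyclicPrimitive N a b ε ≤ K :=
    fun ε Y hε hY => sub_le_of_deriv_le_mul_deriv2 (fun c hc => (hI c hc).1)
      (fun c hc => (hI c hc).2.1) (fun c hc => (cyclicEnergy_bounds hF hN a b hc).1)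
      (fun c hc => (cyclicEnergy_bounds hF hN a b hc).2) (fun c hc => (hI c hc).2.2.1)
      (fun c hc => hasDerivAt_cyclicPrimitive hN a b hc)
      (fun c hc => (mul_le_mul_of_nonneg_left (hI c hc).2.2.2 (cothWeight_nonneg hc)).trans
        (mul_le_mul_of_nonneg_right (cothWeight_le hc) (hI c hc).2.2.1)) hε hY
  have h1 : ∀ Y, 0 < Y → cyclicPrimitive N a b Y ≤ K := fun Y hY => by
    have h := (tendsto_const_nhds (x := cyclicPrimitive N a b Y)).sub
      (tendsto_cyclicPrimitive_zero N a b)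
    rw [sub_zero] at h
    refine le_of_tendsto h ?_
    filter_upwards [Ioo_mem_nhdsGT hY] with ε hε
    exact hle ε Y hε.1 hε.2.le
  have h2 := le_of_tendsto (tendsto_cyclicPrimitive_atTop hN a b)
    ((eventually_gt_atTop 0).mono fun Y hY => h1 Y hY)
  have hpi := Real.pi_pos
  have : 2 * Real.pi * (1 / N * ∑ m ∈ Finset.range N, ∑ n ∈ Finset.range N,
        a m * b n * Real.cot (Real.pi * ((n : ℝ) - m) / N)) ≤ K := by
    rw [← mul_assoc, mul_one_div]; exact h2
  exact le_of_mul_le_mul_left this (by positivity)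

end

section

open Filter Topology

open Filter Topology

lemma sum_cot_le_of_le_two {p q : ℝ} (hp : 1 < p) (hp2 : p ≤ 2) (hpq : p.HolderConjugate q)
    {N : ℕ} (hN : 0 < N) (a b : ℕ → ℝ) :
    1 / N * ∑ m ∈ Finset.range N, ∑ n ∈ Finset.range N,
        a m * b n * Real.cot (Real.pi * ((n : ℝ) - m) / N)
      ≤ ∑ n ∈ Finset.range N,
        (Real.tan (Real.pi / (2 * p)) ^ p * |a n| ^ p / p + |b n| ^ q / q) := by
  have hp0 : 0 < p := one_pos.trans hp
  have hq0 : 0 < q := hpq.symm.pos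
  have hlim : Tendsto (fun δ : ℝ => ∑ n ∈ Finset.range N,
      (Real.tan (Real.pi / (2 * p)) ^ p * (|a n| + 2 * δ) ^ p / p + (|b n| + δ) ^ q / q))
      (𝓝[>] 0) (𝓝 (∑ n ∈ Finset.range N,
        (Real.tan (Real.pi / (2 * p)) ^ p * |a n| ^ p / p + |b n| ^ q / q))) := by
    have hc : Continuous fun δ : ℝ => ∑ n ∈ Finset.range N,
        (Real.tan (Real.pi / (2 * p)) ^ p * (|a n| + 2 * δ) ^ p / p + (|b n| + δ) ^ q / q) := by
      refine continuous_finsetSum _ fun n _ => ?_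
      refine Continuous.add (Continuous.div_const (continuous_const.mul ?_) _)
        (Continuous.div_const ?_ _)
      · exact (by fun_prop : Continuous fun δ : ℝ => |a n| + 2 * δ).rpow_const
          fun _ => Or.inr hp0.le
      · exact (by fun_prop : Continuous fun δ : ℝ => |b n| + δ).rpow_const
          fun _ => Or.inr hq0.le
    have := (hc.tendsto 0).mono_left (nhdsWithin_le_nhds (s := Set.Ioi 0))
    simpa using this
  refine ge_of_tendsto hlim ?_
  filter_upwards [self_mem_nhdsWithin] with δ hδ
  obtain ⟨F, hF, hle⟩ := exists_areaConvex_le hp hp2 hpq hδ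
  exact (hF.sum_cot_le hN a b).trans (Finset.sum_le_sum fun n _ => hle (a n, b n))

lemma tendsto_cot_div (x : ℝ) :
    Tendsto (fun N : ℕ => 1 / (N : ℝ) * Real.cot (Real.pi * x / N)) atTop
      (𝓝 (1 / (Real.pi * x))) := by
  rcases eq_or_ne x 0 with rfl | hx
  · simp [Real.cot_eq_cos_div_sin]
  have hy : Real.pi * x ≠ 0 := mul_ne_zero Real.pi_ne_zero hx
  have h0 : Tendsto (fun N : ℕ => Real.pi * x / N) atTop (𝓝 0) :=
    tendsto_const_div_atTop_nhds_zero_nat _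
  have h1 : Tendsto (fun t : ℝ => Real.cos t / Real.sinc t) (𝓝 0) (𝓝 1) := by
    have := (Real.continuous_cos.tendsto 0).div (Real.continuous_sinc.tendsto 0) (by simp)
    rw [Real.cos_zero, Real.sinc_zero, div_one] at this
    exact this
  have h2 := (h1.comp h0).const_mul (1 / (Real.pi * x))
  rw [mul_one] at h2
  refine h2.congr' ?_
  filter_upwards [eventually_gt_atTop 0] with N hN
  have hN' : (N : ℝ) ≠ 0 := by exact_mod_cast hN.ne'
  have hz : Real.pi * x / N ≠ 0 := div_ne_zero hy hN'
  simp only [Function.comp]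
  rw [Real.sinc_of_ne_zero hz, Real.cot_eq_cos_div_sin]
  field_simp

lemma sum_range_hilbert_le_of_le_two {p q : ℝ} (hp : 1 < p) (hp2 : p ≤ 2)
    (hpq : p.HolderConjugate q) (M : ℕ) (a b : ℕ → ℝ) :
    ∑ m ∈ Finset.range M, ∑ n ∈ Finset.range M, a m * b n * (1 / (Real.pi * ((n : ℝ) - m)))
      ≤ ∑ n ∈ Finset.range M,
        (Real.tan (Real.pi / (2 * p)) ^ p * |a n| ^ p / p + |b n| ^ q / q) := by
  have hp0 : p ≠ 0 := (one_pos.trans hp).ne'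
  have hq0 : q ≠ 0 := hpq.symm.pos.ne'
  have hlim : Tendsto (fun N : ℕ => ∑ m ∈ Finset.range M, ∑ n ∈ Finset.range M,
      a m * b n * (1 / (N : ℝ) * Real.cot (Real.pi * ((n : ℝ) - m) / N))) atTop
      (𝓝 (∑ m ∈ Finset.range M, ∑ n ∈ Finset.range M,
        a m * b n * (1 / (Real.pi * ((n : ℝ) - m))))) :=
    tendsto_finsetSum _ fun m _ => tendsto_finsetSum _ fun n _ =>
      (tendsto_cot_div ((n : ℝ) - m)).const_mul _
  refine le_of_tendsto hlim ?_
  filter_upwards [eventually_gt_atTop M] with N hN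
  have hsub : Finset.range M ⊆ Finset.range N := Finset.range_subset_range.2 hN.le
  have key := sum_cot_le_of_le_two hp hp2 hpq (Nat.zero_lt_of_lt hN)
    (fun n => if n ∈ Finset.range M then a n else 0)
    (fun n => if n ∈ Finset.range M then b n else 0)
  have e1 : ∀ f : ℕ → ℝ, (∀ n, n ∉ Finset.range M → f n = 0) →
      ∑ n ∈ Finset.range N, f n = ∑ n ∈ Finset.range M, f n := fun f hf =>
    (Finset.sum_subset hsub fun n _ hn => hf n hn).symm
  rw [e1 _ (fun m hm => Finset.sum_eq_zero fun n _ => by simp only [if_neg hm]; ring),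
    e1 (fun n => _ + _) (fun n hn => by
      simp only [if_neg hn, abs_zero, Real.zero_rpow hp0, Real.zero_rpow hq0]; simp)] at key
  have e2 : ∀ m ∈ Finset.range M, ∑ n ∈ Finset.range N,
      (if m ∈ Finset.range M then a m else 0) * (if n ∈ Finset.range M then b n else 0) *
        Real.cot (Real.pi * ((n : ℝ) - m) / N) =
      ∑ n ∈ Finset.range M, a m * b n * Real.cot (Real.pi * ((n : ℝ) - m) / N) := fun m hm => by
    rw [e1 _ fun n hn => by simp only [if_neg hn]; ring]
    exact Finset.sum_congr rfl fun n hn => by rw [if_pos hm, if_pos hn]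
  rw [Finset.sum_congr rfl e2] at key
  refine le_trans (le_of_eq ?_) (key.trans (le_of_eq (Finset.sum_congr rfl fun n hn => ?_)))
  · rw [Finset.mul_sum]
    refine Finset.sum_congr rfl fun m _ => ?_
    rw [Finset.mul_sum]
    exact Finset.sum_congr rfl fun n _ => by ring
  · simp only [if_pos hn]

lemma sum_hilbert_le_of_le_two {p q : ℝ} (hp : 1 < p) (hp2 : p ≤ 2)
    (hpq : p.HolderConjugate q) (S : Finset ℤ) (a b : ℤ → ℝ) :
    ∑ m ∈ S, ∑ n ∈ S, a m * b n * (1 / (Real.pi * ((n : ℝ) - m)))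
      ≤ ∑ n ∈ S, (Real.tan (Real.pi / (2 * p)) ^ p * |a n| ^ p / p + |b n| ^ q / q) := by
  have hp0 : p ≠ 0 := (one_pos.trans hp).ne'
  have hq0 : q ≠ 0 := hpq.symm.pos.ne'
  obtain ⟨M, hM⟩ : ∃ M : ℕ, ∀ n ∈ S, -(M : ℤ) ≤ n ∧ n < M := by
    refine ⟨∑ n ∈ S, (n.natAbs + 1), fun n hn => ?_⟩
    have := Finset.single_le_sum (f := fun n : ℤ => n.natAbs + 1) (fun _ _ => Nat.zero_le _) hn
    omega
  have e1 : ∀ f : ℤ → ℝ, (∀ n, n ∉ S → f n = 0) →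
      ∑ k ∈ Finset.range (2 * M), f ((k : ℤ) - M) = ∑ n ∈ S, f n := fun f hf => by
    have h1 : ∑ k ∈ Finset.range (2 * M), f ((k : ℤ) - M) =
        ∑ n ∈ Finset.Ico (-(M : ℤ)) M, f n := by
      refine Finset.sum_nbij' (fun k => (k : ℤ) - M) (fun n => (n + M).toNat) ?_ ?_ ?_ ?_ ?_
      · intro k hk; simp only [Finset.mem_range, Finset.mem_Ico] at hk ⊢; omega
      · intro k hk; simp only [Finset.mem_range, Finset.mem_Ico] at hk ⊢; omega
      · intro k hk; simp
      · intro k hk; simp only [Finset.mem_Ico] at hk; omega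
      · intro k hk; rfl
    rw [h1]
    exact (Finset.sum_subset (fun n hn => Finset.mem_Ico.2 (hM n hn)) fun n _ hn => hf n hn).symm
  set a' : ℤ → ℝ := fun n => if n ∈ S then a n else 0
  set b' : ℤ → ℝ := fun n => if n ∈ S then b n else 0
  have key := sum_range_hilbert_le_of_le_two hp hp2 hpq (2 * M) (fun k => a' ((k : ℤ) - M))
    (fun k => b' ((k : ℤ) - M))
  have e2 := e1 (fun n => Real.tan (Real.pi / (2 * p)) ^ p * |a' n| ^ p / p + |b' n| ^ q / q)
    fun n hn => by
      simp only [a', b', if_neg hn, abs_zero, Real.zero_rpow hp0, Real.zero_rpow hq0]; simp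
  have e3 := e1 (fun m => ∑ n ∈ S, a' m * b' n * (1 / (Real.pi * ((n : ℝ) - m))))
    fun m hm => Finset.sum_eq_zero fun n _ => by simp only [a', if_neg hm]; ring
  have e4 : ∀ k : ℕ, ∑ l ∈ Finset.range (2 * M), a' ((k : ℤ) - M) * b' ((l : ℤ) - M) *
      (1 / (Real.pi * ((l : ℝ) - k))) = ∑ n ∈ S, a' ((k : ℤ) - M) * b' n *
      (1 / (Real.pi * ((n : ℝ) - ((k : ℤ) - M : ℤ)))) := fun k => by
    rw [← e1 (fun n => a' ((k : ℤ) - M) * b' n *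
      (1 / (Real.pi * ((n : ℝ) - ((k : ℤ) - M : ℤ)))))
      fun n hn => by simp only [b', if_neg hn]; ring]
    refine Finset.sum_congr rfl fun l _ => ?_
    push_cast; ring_nf
  simp_rw [e4] at key
  rw [e2, e3] at key
  refine le_trans (le_of_eq ?_) (key.trans (le_of_eq ?_))
  · exact Finset.sum_congr rfl fun m hm => Finset.sum_congr rfl fun n hn => by
      simp only [a', b', if_pos hm, if_pos hn]
  · exact Finset.sum_congr rfl fun n hn => by simp only [a', b', if_pos hn]

lemma cot_pi_div_two_sub (x : ℝ) : Real.cot (Real.pi / 2 - x) = Real.tan x := by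
  rw [Real.cot_eq_cos_div_sin, Real.cos_pi_div_two_sub, Real.sin_pi_div_two_sub,
    Real.tan_eq_sin_div_cos]

lemma Cconst_of_two_le {p : ℝ} (hp : 2 ≤ p) : Cconst p = Real.cot (Real.pi / (2 * p)) := by
  have : p / (p - 1) ≤ p := by
    rw [div_le_iff₀ (by linarith)]; nlinarith
  rw [Cconst, pstar, max_eq_left this]

lemma Cconst_of_le_two {p : ℝ} (hp : 1 < p) (hp2 : p ≤ 2) :
    Cconst p = Real.tan (Real.pi / (2 * p)) := by
  have : p ≤ p / (p - 1) := by
    rw [le_div_iff₀ (by linarith)]; nlinarith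
  rw [Cconst, pstar, max_eq_right this, ← cot_pi_div_two_sub]
  congr 1
  have h1 : p - 1 ≠ 0 := by linarith
  have h0 : p ≠ 0 := by linarith
  field_simp

lemma Cconst_conj {p q : ℝ} (hpq : p.HolderConjugate q) : Cconst p = Cconst q := by
  have hp := hpq.lt
  have hq := hpq.symm.lt
  rw [Cconst, Cconst, pstar, pstar, ← hpq.conjugate_eq, ← hpq.symm.conjugate_eq, max_comm]

lemma Cconst_pos {p : ℝ} (hp : 1 < p) : 0 < Cconst p := by
  have h : ∀ {p : ℝ}, 1 < p → p ≤ 2 → 0 < Cconst p := fun hp hp2 => by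
    rw [Cconst_of_le_two hp hp2]
    obtain ⟨h1, h2⟩ := pichorides_angle_mem hp
    exact Real.tan_pos_of_pos_of_lt_pi_div_two h1 h2
  rcases le_total p 2 with h2 | h2
  · exact h hp h2
  · have hpq := Real.HolderConjugate.conjExponent hp
    rw [Cconst_conj hpq]
    refine h hpq.symm.lt ?_
    rw [Real.conjExponent, div_le_iff₀ (by linarith)]; linarith

/-- The bilinear form estimate for the discrete Hilbert transform with the sharp constant. -/
lemma sum_hilbert_le {p q : ℝ} (hpq : p.HolderConjugate q) (S : Finset ℤ) (a b : ℤ → ℝ) :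
    ∑ m ∈ S, ∑ n ∈ S, a m * b n * (1 / (Real.pi * ((n : ℝ) - m)))
      ≤ ∑ n ∈ S, (Cconst p ^ p * |a n| ^ p / p + |b n| ^ q / q) := by
  have hp := hpq.lt
  have hq := hpq.symm.lt
  rcases le_total p 2 with h2 | h2
  · rw [Cconst_of_le_two hp h2]
    exact sum_hilbert_le_of_le_two hp h2 hpq S a b
  · have hq2 : q ≤ 2 := by
      rw [hpq.conjugate_eq, div_le_iff₀ (by linarith)]; linarith
    have hD := Cconst_pos hp
    have key := sum_hilbert_le_of_le_two hq hq2 hpq.symm S (fun n => b n / Cconst p)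
      (fun n => -(Cconst p * a n))
    rw [← Cconst_of_le_two hq hq2, ← Cconst_conj hpq, Finset.sum_comm] at key
    refine le_trans (le_of_eq ?_) (key.trans (le_of_eq ?_))
    · refine Finset.sum_congr rfl fun m _ => Finset.sum_congr rfl fun n _ => ?_
      rw [show Real.pi * ((m : ℝ) - n) = -(Real.pi * ((n : ℝ) - m)) by ring, one_div_neg_eq_neg_one_div]
      field_simp
    · refine Finset.sum_congr rfl fun n _ => ?_
      rw [abs_neg, abs_div, abs_mul, abs_of_pos hD, Real.div_rpow (abs_nonneg _) hD.le,
        Real.mul_rpow hD.le (abs_nonneg _)]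
      have := (Real.rpow_pos_of_pos hD q).ne'
      field_simp
      ring

end

section

open Filter Topology

open Filter Topology

lemma sum_abs_hilbert_rpow_le {p : ℝ} (hp : 1 < p) (S : Finset ℤ) (a : ℤ → ℝ) :
    ∑ n ∈ S, |∑ m ∈ S, a m * (1 / (Real.pi * ((n : ℝ) - m)))| ^ p
      ≤ Cconst p ^ p * ∑ n ∈ S, |a n| ^ p := by
  have hpq := Real.HolderConjugate.conjExponent hp
  set q := p.conjExponent
  set f : ℤ → ℝ := fun n => ∑ m ∈ S, a m * (1 / (Real.pi * ((n : ℝ) - m))) with hf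
  have hp0 : 0 < p := one_pos.trans hp
  have hp1 : 0 < p - 1 := sub_pos.2 hp
  have key := sum_hilbert_le hpq S a (fun n => SignType.sign (f n) * |f n| ^ (p - 1))
  have e1 : ∀ n, f n * (SignType.sign (f n) * |f n| ^ (p - 1)) = |f n| ^ p := fun n => by
    rcases eq_or_ne (f n) 0 with h | h
    · simp [h, hp0.ne']
    · rw [← mul_assoc, mul_comm (f n), sign_mul_self, mul_comm]
      rw [Real.rpow_sub_one (abs_ne_zero.2 h), div_mul_cancel₀ _ (abs_ne_zero.2 h)]
  have e2 : ∀ n, |(SignType.sign (f n) : ℝ) * |f n| ^ (p - 1)| ^ q = |f n| ^ p := fun n => by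
    rcases eq_or_ne (f n) 0 with h | h
    · simp [h, hp0.ne', hp1.ne', hpq.symm.pos.ne']
    · have hs : |(SignType.sign (f n) : ℝ)| = 1 := by
        rcases lt_or_gt_of_ne h with h | h
        · simp [sign_neg h]
        · simp [sign_pos h]
      rw [abs_mul, hs, one_mul, abs_of_nonneg (Real.rpow_nonneg (abs_nonneg _) _),
        ← Real.rpow_mul (abs_nonneg _), hpq.sub_one_mul_conj]
  have e3 : ∑ m ∈ S, ∑ n ∈ S, a m * (SignType.sign (f n) * |f n| ^ (p - 1)) *
      (1 / (Real.pi * ((n : ℝ) - m))) = ∑ n ∈ S, |f n| ^ p := by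
    rw [Finset.sum_comm]
    refine Finset.sum_congr rfl fun n _ => ?_
    rw [← e1 n]
    conv_rhs => rw [hf]
    simp only
    rw [Finset.sum_mul]
    exact Finset.sum_congr rfl fun m _ => by ring
  rw [e3] at key
  simp_rw [e2] at key
  rw [Finset.sum_add_distrib, ← Finset.sum_div, ← Finset.sum_div, ← Finset.mul_sum] at key
  have h1 := hpq.inv_add_inv_eq_one
  set A := ∑ n ∈ S, |f n| ^ p
  have h2 : A / p ≤ Cconst p ^ p * (∑ n ∈ S, |a n| ^ p) / p := by
    have : A = A / p + A / q := by
      rw [div_eq_mul_inv, div_eq_mul_inv, ← mul_add, h1, mul_one]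
    linarith
  exact (div_le_div_iff_of_pos_right hp0).1 h2

/-- The mean of `|Re (e^{iφ} z)|^p` over all rotations is a fixed multiple of `|z|^p`. -/
lemma integral_abs_re_rotate_rpow (p : ℝ) (z : ℂ) :
    ∫ φ in (0 : ℝ)..2 * Real.pi, |(Complex.exp (φ * Complex.I) * z).re| ^ p =
      (∫ φ in (0 : ℝ)..2 * Real.pi, |Real.cos φ| ^ p) * ‖z‖ ^ p := by
  have h : ∀ φ : ℝ, |(Complex.exp (φ * Complex.I) * z).re| ^ p =
      |Real.cos (φ + z.arg)| ^ p * ‖z‖ ^ p := fun φ => by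
    have : Complex.exp (φ * Complex.I) * z = (‖z‖ : ℂ) * Complex.exp ((φ + z.arg : ℝ) * Complex.I) := by
      conv_lhs => rw [← Complex.norm_mul_exp_arg_mul_I z]
      rw [mul_left_comm, ← Complex.exp_add]; push_cast; ring_nf
    rw [this, Complex.re_ofReal_mul, Complex.exp_ofReal_mul_I_re, abs_mul, abs_norm,
      Real.mul_rpow (norm_nonneg _) (abs_nonneg _), mul_comm]
  simp_rw [h]
  rw [intervalIntegral.integral_mul_const]
  congr 1
  have hper : Function.Periodic (fun φ => |Real.cos φ| ^ p) (2 * Real.pi) := fun φ => by simp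
  rw [intervalIntegral.integral_comp_add_right (fun φ => |Real.cos φ| ^ p)]
  have := hper.intervalIntegral_add_eq z.arg 0
  rw [zero_add] at this ⊢
  rw [add_comm (2 * Real.pi)]
  exact this

lemma continuous_abs_cos_rpow {p : ℝ} (hp : 0 < p) : Continuous fun φ => |Real.cos φ| ^ p :=
  (Real.continuous_cos.abs).rpow_const fun _ => Or.inr hp.le

lemma integral_abs_cos_rpow_pos {p : ℝ} (hp : 0 < p) :
    0 < ∫ φ in (0 : ℝ)..2 * Real.pi, |Real.cos φ| ^ p := by
  refine intervalIntegral.integral_pos Real.two_pi_pos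
    (continuous_abs_cos_rpow hp).continuousOn (fun φ _ => Real.rpow_nonneg (abs_nonneg _) _)
    ⟨0, ⟨le_rfl, Real.two_pi_pos.le⟩, ?_⟩
  simp

lemma sum_norm_hilbert_rpow_le {p : ℝ} (hp : 1 < p) (S : Finset ℤ) (a : ℤ → ℂ) :
    ∑ n ∈ S, ‖∑ m ∈ S, a m * ((1 / (Real.pi * ((n : ℝ) - m)) : ℝ) : ℂ)‖ ^ p
      ≤ Cconst p ^ p * ∑ n ∈ S, ‖a n‖ ^ p := by
  have hp0 : 0 < p := one_pos.trans hp
  set f : ℤ → ℂ := fun n => ∑ m ∈ S, a m * ((1 / (Real.pi * ((n : ℝ) - m)) : ℝ) : ℂ) with hf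
  have hcont : ∀ z : ℂ, Continuous fun φ : ℝ => |(Complex.exp (φ * Complex.I) * z).re| ^ p :=
    fun z => Continuous.rpow_const (by fun_prop) fun _ => Or.inr hp0.le
  have hpt : ∀ φ : ℝ, ∑ n ∈ S, |(Complex.exp (φ * Complex.I) * f n).re| ^ p ≤
      Cconst p ^ p * ∑ n ∈ S, |(Complex.exp (φ * Complex.I) * a n).re| ^ p := fun φ => by
    refine le_trans (le_of_eq ?_)
      (sum_abs_hilbert_rpow_le hp S fun n => (Complex.exp (φ * Complex.I) * a n).re)
    refine Finset.sum_congr rfl fun n _ => ?_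
    congr 2
    rw [hf, Finset.mul_sum, Complex.re_sum]
    exact Finset.sum_congr rfl fun m _ => by rw [← mul_assoc, Complex.re_mul_ofReal]
  have hI := intervalIntegral.integral_mono_on (μ := volume) Real.two_pi_pos.le
    ((continuous_finsetSum S fun n _ => hcont (f n)).intervalIntegrable _ _)
    ((continuous_const.mul (continuous_finsetSum S fun n _ => hcont (a n))).intervalIntegrable _ _)
    fun φ _ => hpt φ
  simp only [Pi.mul_apply] at hI
  rw [intervalIntegral.integral_const_mul,
    intervalIntegral.integral_finsetSum fun n _ => (hcont (f n)).intervalIntegrable _ _,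
    intervalIntegral.integral_finsetSum fun n _ => (hcont (a n)).intervalIntegrable _ _] at hI
  simp_rw [integral_abs_re_rotate_rpow, ← Finset.mul_sum] at hI
  have hk := integral_abs_cos_rpow_pos hp0
  refine le_of_mul_le_mul_left ?_ hk
  linarith

lemma summable_one_div_abs_rpow {q : ℝ} (hq : 1 < q) : Summable fun m : ℤ => |1 / (m : ℝ)| ^ q := by
  refine (Real.summable_abs_int_rpow hq).congr fun m => ?_
  rw [abs_div, abs_one, Real.div_rpow zero_le_one (abs_nonneg _), Real.one_rpow,
    Real.rpow_neg (abs_nonneg _), one_div]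

lemma summable_norm_mul_hilbert {p : ℝ} (hp : 1 < p) {a : ℤ → ℂ} (ha : MemLpZ p a) (n : ℤ) :
    Summable fun m : ℤ => ‖a m * ((1 / (Real.pi * ((n : ℝ) - m)) : ℝ) : ℂ)‖ := by
  have hpq := Real.HolderConjugate.conjExponent hp
  have h1 : Summable fun m : ℤ => |1 / ((n : ℝ) - m)| ^ p.conjExponent := by
    have := (Equiv.subLeft n).summable_iff.2 (summable_one_div_abs_rpow hpq.symm.lt)
    refine this.congr fun m => ?_
    simp
  have h2 := Real.summable_mul_of_Lp_Lq_of_nonneg hpq (fun m => norm_nonneg (a m))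
    (fun m => abs_nonneg (1 / ((n : ℝ) - m))) ha h1
  refine (h2.mul_left (1 / Real.pi)).congr fun m => ?_
  rw [norm_mul, Complex.norm_real, Real.norm_eq_abs, ← one_div_mul_one_div, abs_mul,
    abs_of_pos (by positivity : 0 < 1 / Real.pi)]
  ring

lemma H0T_eq_tsum (a : ℤ → ℂ) (n : ℤ) :
    H0T a n = ∑' m : ℤ, a m * ((1 / (Real.pi * ((n : ℝ) - m)) : ℝ) : ℂ) := by
  have h1 : ∑' m : {m : ℤ // m ≠ 0}, a (n - (m : ℤ)) / ((m : ℤ) : ℂ) =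
      ∑' m : ℤ, a (n - m) / (m : ℂ) :=
    tsum_subtype_eq_of_support_subset (f := fun m : ℤ => a (n - m) / (m : ℂ))
      (s := {m : ℤ | m ≠ 0}) fun m hm h0 => hm (by simp [h0])
  rw [H0T, h1, ← (Equiv.subLeft n).tsum_eq, ← tsum_mul_left]
  refine tsum_congr fun m => ?_
  simp only [Equiv.subLeft_apply, sub_sub_cancel]
  push_cast
  rw [← one_div_mul_one_div]
  ring

lemma hasSum_H0T {p : ℝ} (hp : 1 < p) {a : ℤ → ℂ} (ha : MemLpZ p a) (n : ℤ) :
    HasSum (fun m : ℤ => a m * ((1 / (Real.pi * ((n : ℝ) - m)) : ℝ) : ℂ)) (H0T a n) := by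
  rw [H0T_eq_tsum]
  exact (summable_norm_mul_hilbert hp ha n).of_norm.hasSum

lemma sum_norm_H0T_rpow_le {p : ℝ} (hp : 1 < p) {a : ℤ → ℂ} (ha : MemLpZ p a) (T : Finset ℤ) :
    ∑ n ∈ T, ‖H0T a n‖ ^ p ≤ Cconst p ^ p * ∑' n, ‖a n‖ ^ p := by
  have hp0 : 0 < p := one_pos.trans hp
  have hlim := tendsto_finsetSum T fun n _ =>
    ((hasSum_H0T hp ha n).norm).rpow_const (p := p) (Or.inr hp0.le)
  refine le_of_tendsto hlim ?_
  filter_upwards [eventually_ge_atTop T] with S hS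
  calc _ ≤ ∑ n ∈ S, ‖∑ m ∈ S, a m * ((1 / (Real.pi * ((n : ℝ) - m)) : ℝ) : ℂ)‖ ^ p :=
        Finset.sum_le_sum_of_subset_of_nonneg hS fun n _ _ => Real.rpow_nonneg (norm_nonneg _) _
    _ ≤ Cconst p ^ p * ∑ n ∈ S, ‖a n‖ ^ p := sum_norm_hilbert_rpow_le hp S a
    _ ≤ _ := mul_le_mul_of_nonneg_left
        (Summable.sum_le_tsum _ (fun n _ => Real.rpow_nonneg (norm_nonneg _) _) ha)
        (Real.rpow_nonneg (Cconst_pos hp).le _)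

lemma memLpZ_H0T {p : ℝ} (hp : 1 < p) {a : ℤ → ℂ} (ha : MemLpZ p a) : MemLpZ p (H0T a) :=
  summable_of_sum_le (fun n => Real.rpow_nonneg (norm_nonneg _) _)
    fun T => sum_norm_H0T_rpow_le hp ha T

/-- The discrete Hilbert transform is bounded by the constant of Pichorides. -/
lemma lpNorm_H0T_le {p : ℝ} (hp : 1 < p) {a : ℤ → ℂ} (ha : MemLpZ p a) :
    _root_.lpNorm p (H0T a) ≤ Cconst p * _root_.lpNorm p a := by
  have hp0 : 0 < p := one_pos.trans hp
  have h := (memLpZ_H0T hp ha).tsum_le_of_sum_le fun T => sum_norm_H0T_rpow_le hp ha T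
  have h0 : ∀ b : ℤ → ℂ, 0 ≤ ∑' n, ‖b n‖ ^ p := fun b =>
    tsum_nonneg fun n => Real.rpow_nonneg (norm_nonneg _) _
  rw [_root_.lpNorm, _root_.lpNorm]
  refine (Real.rpow_le_rpow (h0 _) h (by positivity)).trans (le_of_eq ?_)
  rw [Real.mul_rpow (Real.rpow_nonneg (Cconst_pos hp).le _) (h0 a), one_div,
    Real.rpow_rpow_inv (Cconst_pos hp).le hp0.ne']

end

section

open Filter Topology

lemma measurable_rpow_neg_div_add (s ε : ℝ) : Measurable fun x : ℝ => x ^ (-s) / (x + ε) :=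
  (measurable_id.pow_const _).div (measurable_id.add_const _)

lemma integrableOn_rpow_neg_div_add {s ε : ℝ} (hs : 0 < s) (hs1 : s < 1) (hε : 0 < ε) :
    IntegrableOn (fun x : ℝ => x ^ (-s) / (x + ε)) (Set.Ioi 0) := by
  rw [← Set.Ioc_union_Ioi_eq_Ioi zero_le_one]
  refine IntegrableOn.union ?_ ?_
  · have h := ((intervalIntegral.intervalIntegrable_rpow' (a := 0) (b := 1)
      (by linarith : -1 < -s)).1).div_const ε
    refine Integrable.mono' h (measurable_rpow_neg_div_add s ε).aestronglyMeasurable ?_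
    filter_upwards [ae_restrict_mem measurableSet_Ioc] with x hx
    have hx0 : 0 < x := hx.1
    rw [Real.norm_of_nonneg (by positivity)]
    gcongr
    linarith
  · have h := integrableOn_Ioi_rpow_of_lt (by linarith : -s - 1 < -1) zero_lt_one
    refine Integrable.mono' h (measurable_rpow_neg_div_add s ε).aestronglyMeasurable ?_
    filter_upwards [ae_restrict_mem measurableSet_Ioi] with x hx
    have hx0 : 0 < x := zero_lt_one.trans hx
    rw [Real.norm_of_nonneg (by positivity), Real.rpow_sub_one hx0.ne']
    gcongr
    linarith

lemma add_le_norm_ofReal_add {x ε : ℝ} {w : ℂ} (hx : 0 ≤ x) (hε : 0 ≤ ε) (hw : ε ≤ w.re) :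
    x + ε ≤ ‖(x : ℂ) + w‖ := by
  refine le_trans ?_ (Complex.abs_re_le_norm _)
  simp only [Complex.add_re, Complex.ofReal_re]
  rw [abs_of_nonneg (by linarith)]
  linarith

lemma measurable_ofReal_rpow_neg_div_add (s : ℝ) (w : ℂ) :
    Measurable fun x : ℝ => ((x ^ (-s) : ℝ) : ℂ) / ((x : ℂ) + w) :=
  (Complex.measurable_ofReal.comp (measurable_id.pow_const _)).div
    (Complex.measurable_ofReal.add_const _)

lemma integrableOn_ofReal_rpow_neg_div_add {s : ℝ} (hs : 0 < s) (hs1 : s < 1) {w : ℂ}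
    (hw : 0 < w.re) :
    IntegrableOn (fun x : ℝ => ((x ^ (-s) : ℝ) : ℂ) / ((x : ℂ) + w)) (Set.Ioi 0) := by
  refine Integrable.mono' (integrableOn_rpow_neg_div_add hs hs1 hw)
    (measurable_ofReal_rpow_neg_div_add s w).aestronglyMeasurable ?_
  filter_upwards [ae_restrict_mem measurableSet_Ioi] with x hx
  have hx0 : 0 < x := hx
  rw [norm_div, Complex.norm_of_nonneg (by positivity)]
  have := add_le_norm_ofReal_add hx0.le hw.le le_rfl
  gcongr

/-- The normalising constant in the Stieltjes representation of `w ↦ w ^ (-s)`. -/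
def stieltjesConst (s : ℝ) : ℝ := ∫ x in Set.Ioi (0 : ℝ), x ^ (-s) / (x + 1)

lemma stieltjesConst_pos {s : ℝ} (hs : 0 < s) (hs1 : s < 1) : 0 < stieltjesConst s := by
  refine (setIntegral_pos_iff_support_of_nonneg_ae ?_
    (integrableOn_rpow_neg_div_add hs hs1 zero_lt_one)).2 ?_
  · filter_upwards [ae_restrict_mem measurableSet_Ioi] with x hx
    have hx0 : 0 < x := hx
    simp only [Pi.zero_apply]
    positivity
  · have : Set.Ioi (0 : ℝ) ⊆ (Function.support fun x : ℝ => x ^ (-s) / (x + 1)) ∩ Set.Ioi 0 := by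
      intro x hx
      have hx0 : 0 < x := hx
      refine ⟨?_, hx⟩
      simp only [Function.mem_support]
      positivity
    exact lt_of_lt_of_le (by simp) (measure_mono this)

lemma integral_rpow_neg_div_add {s ε : ℝ} (hε : 0 < ε) :
    ∫ x in Set.Ioi (0 : ℝ), x ^ (-s) / (x + ε) = stieltjesConst s * ε ^ (-s) := by
  have h := integral_comp_mul_left_Ioi (fun x : ℝ => x ^ (-s) / (x + ε)) 0 hε
  rw [mul_zero, smul_eq_mul] at h
  have h2 : ∫ x in Set.Ioi (0 : ℝ), (ε * x) ^ (-s) / (ε * x + ε)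
      = ε⁻¹ * ε ^ (-s) * stieltjesConst s := by
    rw [stieltjesConst, ← integral_const_mul]
    refine setIntegral_congr_fun measurableSet_Ioi fun x hx => ?_
    have hx0 : 0 < x := hx
    rw [Real.mul_rpow hε.le hx0.le]
    field_simp
  rw [h2] at h
  have := mul_left_cancel₀ (inv_ne_zero hε.ne') (by rw [← h]; ring :
    ε⁻¹ * ∫ x in Set.Ioi (0 : ℝ), x ^ (-s) / (x + ε) = ε⁻¹ * (stieltjesConst s * ε ^ (-s)))
  exact this

lemma differentiableOn_stieltjes {s : ℝ} (hs : 0 < s) (hs1 : s < 1) :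
    DifferentiableOn ℂ (fun w : ℂ => ∫ x in Set.Ioi (0 : ℝ), ((x ^ (-s) : ℝ) : ℂ) / ((x : ℂ) + w))
      {w | 0 < w.re} := by
  intro w₀ hw₀
  have hw₀' : 0 < w₀.re := hw₀
  set ε := w₀.re / 2 with hε
  have hε0 : 0 < ε := by positivity
  have hball : ∀ w ∈ Metric.ball w₀ ε, ε ≤ w.re := by
    intro w hw
    have h1 := Complex.abs_re_le_norm (w - w₀)
    rw [Metric.mem_ball, dist_eq_norm] at hw
    have h2 := abs_le.1 (h1.trans hw.le)
    simp only [Complex.sub_re] at h2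
    linarith [h2.1]
  have key := hasDerivAt_integral_of_dominated_loc_of_deriv_le
    (μ := volume.restrict (Set.Ioi (0 : ℝ))) (𝕜 := ℂ)
    (F := fun w (x : ℝ) => ((x ^ (-s) : ℝ) : ℂ) / ((x : ℂ) + w))
    (F' := fun w (x : ℝ) => -((x ^ (-s) : ℝ) : ℂ) / ((x : ℂ) + w) ^ 2)
    (bound := fun x => x ^ (-s) / (x + ε) / ε) (x₀ := w₀)
    (Metric.ball_mem_nhds w₀ hε0)
    (Eventually.of_forall fun w => (measurable_ofReal_rpow_neg_div_add s w).aestronglyMeasurable)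
    (integrableOn_ofReal_rpow_neg_div_add hs hs1 hw₀)
    (Measurable.aestronglyMeasurable (by fun_prop))
    ?_ ((integrableOn_rpow_neg_div_add hs hs1 hε0).div_const ε) ?_
  · exact key.2.differentiableAt.differentiableWithinAt
  · filter_upwards [ae_restrict_mem measurableSet_Ioi] with x hx w hw
    have hx0 : 0 < x := hx
    have hn := add_le_norm_ofReal_add hx0.le hε0.le (hball w hw)
    rw [norm_div, norm_neg, norm_pow, Complex.norm_of_nonneg (by positivity), div_div]
    have : (x + ε) * ε ≤ ‖(x : ℂ) + w‖ ^ 2 := by nlinarith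
    gcongr
  · filter_upwards [ae_restrict_mem measurableSet_Ioi] with x hx w hw
    have hx0 : 0 < x := hx
    have hn := add_le_norm_ofReal_add hx0.le hε0.le (hball w hw)
    have hne : (x : ℂ) + w ≠ 0 := by
      rw [← norm_pos_iff]; linarith
    have h := ((hasDerivAt_id w).const_add (x : ℂ)).inv hne
    have h' := h.const_mul (((x ^ (-s) : ℝ) : ℂ))
    simp only [id] at h'
    convert! h' using 1
    rw [mul_div_assoc', mul_neg_one]

lemma integral_ofReal_rpow_neg_div_add {s : ℝ} (hs : 0 < s) (hs1 : s < 1) {w : ℂ}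
    (hw : 0 < w.re) :
    ∫ x in Set.Ioi (0 : ℝ), ((x ^ (-s) : ℝ) : ℂ) / ((x : ℂ) + w)
      = (stieltjesConst s : ℂ) * w ^ ((-s : ℝ) : ℂ) := by
  have hopen : IsOpen {w : ℂ | 0 < w.re} := isOpen_lt continuous_const Complex.continuous_re
  have hF := (differentiableOn_stieltjes hs hs1).analyticOnNhd hopen
  have hG : AnalyticOnNhd ℂ (fun w : ℂ => (stieltjesConst s : ℂ) * w ^ ((-s : ℝ) : ℂ))
      {w | 0 < w.re} := by
    refine DifferentiableOn.analyticOnNhd (fun w hw => ?_) hopen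
    exact ((differentiableAt_id.cpow_const (Or.inl hw)).const_mul _).differentiableWithinAt
  have hconn : IsPreconnected {w : ℂ | 0 < w.re} :=
    (convex_halfSpace_re_gt 0).isPreconnected
  refine hF.eqOn_of_preconnected_of_frequently_eq hG hconn (z₀ := 1) (by simp) ?_ hw
  have hreal : ∀ y : ℝ, 0 < y →
      ∫ x in Set.Ioi (0 : ℝ), ((x ^ (-s) : ℝ) : ℂ) / ((x : ℂ) + (y : ℂ))
        = (stieltjesConst s : ℂ) * (y : ℂ) ^ ((-s : ℝ) : ℂ) := by
    intro y hy
    rw [← Complex.ofReal_cpow hy.le, ← Complex.ofReal_mul, ← integral_rpow_neg_div_add hy,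
      ← integral_complex_ofReal]
    refine integral_congr_ae (Eventually.of_forall fun x => ?_)
    simp only [Complex.ofReal_div, Complex.ofReal_add]
  have ht : Tendsto (fun y : ℝ => (y : ℂ)) (𝓝[>] 1) (𝓝[≠] 1) := by
    refine tendsto_nhdsWithin_iff.2 ⟨?_, ?_⟩
    · have := (Complex.continuous_ofReal.tendsto 1).mono_left
        (nhdsWithin_le_nhds (s := Set.Ioi (1 : ℝ)))
      simpa using this
    · filter_upwards [self_mem_nhdsWithin] with y hy
      have : (1 : ℝ) < y := hy
      simp only [Set.mem_compl_iff, Set.mem_singleton_iff]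
      norm_cast
      linarith
  refine ht.frequently (Eventually.frequently ?_)
  filter_upwards [self_mem_nhdsWithin] with y hy
  exact hreal y (zero_lt_one.trans hy)

end

section

open Filter Topology

lemma summable_one_add_abs_int_rpow_neg {q : ℝ} (hq : 1 < q) :
    Summable fun m : ℤ => (1 + |(m : ℝ)|) ^ (-q) := by
  refine Summable.of_norm_bounded_eventually (Real.summable_abs_int_rpow hq) ?_
  have h0 : ∀ᶠ m : ℤ in cofinite, m ≠ 0 := (Set.finite_singleton (0 : ℤ)).compl_mem_cofinite
  filter_upwards [h0] with m hm
  rw [Real.norm_of_nonneg (by positivity)]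
  have hm' : 0 < |(m : ℝ)| := abs_pos.2 (by exact_mod_cast hm)
  exact Real.rpow_le_rpow_of_nonpos hm' (by linarith) (by linarith)

lemma memLpZ_one_add_abs_int_rpow_neg {p s : ℝ} (h : 1 < s * p) :
    MemLpZ p fun m : ℤ => (((1 + |(m : ℝ)|) ^ (-s) : ℝ) : ℂ) := by
  refine (summable_one_add_abs_int_rpow_neg h).congr fun m => ?_
  rw [Complex.norm_of_nonneg (by positivity), ← Real.rpow_mul (by positivity), neg_mul]

lemma MemLpZ.of_norm_le {p C : ℝ} (hp : 0 ≤ p) {a b : ℤ → ℂ}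
    (h : ∀ n, ‖a n‖ ≤ C * ‖b n‖) (hC : 0 ≤ C) (hb : MemLpZ p b) : MemLpZ p a := by
  refine Summable.of_nonneg_of_le (fun n => Real.rpow_nonneg (norm_nonneg _) _) (fun n => ?_)
    (hb.mul_left (C ^ p))
  rw [← Real.mul_rpow hC (norm_nonneg _)]
  exact Real.rpow_le_rpow (norm_nonneg _) (h n) hp

lemma le_norm_ofReal_sub_I_mul {y t : ℝ} (hy : 0 ≤ y) : (y + |t|) / 2 ≤ ‖(y : ℂ) - Complex.I * t‖ := by
  have h1 := Complex.abs_re_le_norm ((y : ℂ) - Complex.I * t)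
  have h2 := Complex.abs_im_le_norm ((y : ℂ) - Complex.I * t)
  simp only [Complex.sub_re, Complex.ofReal_re, Complex.mul_re, Complex.I_re, Complex.I_im,
    Complex.ofReal_im, Complex.sub_im, Complex.mul_im] at h1 h2
  norm_num at h1 h2
  rw [abs_of_nonneg hy] at h1
  linarith

lemma norm_cot_pi_mul_add_I_le {z : ℂ} (hz : 0 < z.im) :
    ‖Complex.cot (Real.pi * z) + Complex.I‖ ≤ 1 / z.im := by
  set q := Complex.exp (2 * Real.pi * Complex.I * z) with hq
  have hπ := Real.pi_pos
  have hqn : ‖q‖ = Real.exp (-(2 * Real.pi * z.im)) := by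
    rw [hq, Complex.norm_exp]
    congr 1
    simp
  have hE := Real.add_one_le_exp (2 * Real.pi * z.im)
  have hpos : 0 < 2 * Real.pi * z.im := by positivity
  have hq1 : ‖q‖ < 1 := by
    simpa [hqn] using hpos
  have hne : 1 - q ≠ 0 := by
    intro h
    rw [← sub_eq_zero.1 h] at hq1
    simp at hq1
  have heq : Complex.cot (Real.pi * z) + Complex.I = -Complex.I * (2 * q / (1 - q)) := by
    rw [Complex.cot_pi_eq_exp_ratio, ← hq]
    field_simp
    linear_combination (1 - q) * Complex.I_sq + 2 * q * Complex.I_sq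
  rw [heq, norm_mul, norm_neg, Complex.norm_I, one_mul, norm_div, norm_mul, Complex.norm_ofNat]
  have h1 : 1 - ‖q‖ ≤ ‖1 - q‖ := by
    have := norm_sub_norm_le (1 : ℂ) q
    rwa [norm_one] at this
  have h2 : 2 * ‖q‖ / (1 - ‖q‖) ≤ 1 / z.im := by
    rw [div_le_div_iff₀ (by linarith) hz]
    have h3 : ‖q‖ * Real.exp (2 * Real.pi * z.im) = 1 := by
      rw [hqn, ← Real.exp_add]; simp
    have h4 := Real.pi_gt_three
    have h5 : ‖q‖ * (2 * Real.pi * z.im + 1) ≤ 1 := by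
      exact (mul_le_mul_of_nonneg_left hE (norm_nonneg q)).trans_eq h3
    have h6 : 0 ≤ ‖q‖ * z.im := by positivity
    nlinarith
  refine le_trans ?_ h2
  have : 0 < 1 - ‖q‖ := by linarith
  gcongr

lemma memLpZ_two_one_div_sub {y : ℝ} (hy : 1 ≤ y) :
    MemLpZ 2 fun m : ℤ => 1 / ((y : ℂ) - Complex.I * (m : ℝ)) := by
  refine MemLpZ.of_norm_le zero_le_two (C := 2) (fun m => ?_) zero_le_two
    (memLpZ_one_add_abs_int_rpow_neg (s := 1) (by norm_num))
  rw [Complex.norm_of_nonneg (by positivity), Real.rpow_neg_one, norm_div, norm_one,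
    ← div_eq_mul_inv]
  have h := le_norm_ofReal_sub_I_mul (y := y) (t := m) (by linarith)
  rw [div_le_div_iff₀ (by linarith [abs_nonneg (m : ℝ)]) (by positivity)]
  linarith

lemma tsum_one_div_add_I_mul {w : ℂ} (hw : 0 < w.re)
    (hsum : Summable fun j : ℤ => 1 / (w + Complex.I * (j : ℝ)) * (1 / ((Real.pi * j : ℝ) : ℂ))) :
    ∑' j : ℤ, 1 / (w + Complex.I * (j : ℝ)) * (1 / ((Real.pi * j : ℝ) : ℂ))
      = Complex.cot (Real.pi * (Complex.I * w)) / w + Complex.I / (Real.pi * w ^ 2) := by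
  have him : ∀ r : ℝ, Complex.I * w + r ≠ 0 := by
    intro r h
    have := congrArg Complex.im h
    simp at this
    linarith
  have hz : Complex.I * w ∈ Complex.integerComplement := by
    rintro ⟨k, hk⟩
    apply him (-k)
    rw [← hk]; simp
  have hw0 : w ≠ 0 := by rintro rfl; simp at hw
  have hπ : (Real.pi : ℂ) ≠ 0 := by exact_mod_cast Real.pi_ne_zero
  obtain ⟨T, hT⟩ := hsum
  rw [hT.tsum_eq]
  have h1 := hT.nat_add_neg
  rw [← hasSum_nat_add_iff' 1] at h1
  have h2 := h1.tsum_eq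
  have h3 : ∀ n : ℕ,
      1 / (w + Complex.I * (((n + 1 : ℕ) : ℤ) : ℝ)) * (1 / ((Real.pi * ((n + 1 : ℕ) : ℤ) : ℝ) : ℂ)) +
      1 / (w + Complex.I * ((-((n + 1 : ℕ) : ℤ) : ℤ) : ℝ)) *
        (1 / ((Real.pi * (-((n + 1 : ℕ) : ℤ) : ℤ) : ℝ) : ℂ))
      = 1 / (Real.pi * w) *
        (1 / (Complex.I * w - (n + 1)) + 1 / (Complex.I * w + (n + 1))) := by
    intro n
    have e1 : Complex.I * w - (n + 1) ≠ 0 := by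
      have := him (-(n + 1)); push_cast at this; rwa [← sub_eq_add_neg] at this
    have e2 : Complex.I * w + (n + 1) ≠ 0 := by
      have := him (n + 1); push_cast at this; exact this
    have e3 : w + Complex.I * (n + 1) ≠ 0 := by
      intro h; apply e1; linear_combination Complex.I * h - (n + 1) * Complex.I_sq
    have e4 : w - Complex.I * (n + 1) ≠ 0 := by
      intro h; apply e2; linear_combination Complex.I * h + (n + 1) * Complex.I_sq
    have e5 : (n : ℂ) + 1 ≠ 0 := by exact_mod_cast Nat.succ_ne_zero n
    have f1 : w + Complex.I * (n + 1) = -Complex.I * (Complex.I * w - (n + 1)) := by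
      linear_combination w * Complex.I_sq
    have f2 : w - Complex.I * (n + 1) = -Complex.I * (Complex.I * w + (n + 1)) := by
      linear_combination w * Complex.I_sq
    push_cast
    rw [show w + Complex.I * -((n : ℂ) + 1) = w - Complex.I * (n + 1) by ring, f1, f2]
    have hI := Complex.I_ne_zero
    field_simp
    ring_nf
    simp only [Complex.I_sq]
    ring
  rw [tsum_congr h3, tsum_mul_left, ← cot_series_rep' hz] at h2
  simp only [Finset.range_one, Finset.sum_singleton, Int.cast_zero, mul_zero, Complex.ofReal_zero,
    div_zero, Nat.cast_zero, neg_zero, add_zero, sub_zero] at h2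
  rw [← h2]
  have hI := Complex.I_ne_zero
  field_simp
  ring_nf
  rw [Complex.I_sq]
  ring

end

section

open Filter Topology

/-- The kernel of `𝓗₀ + i`, as a function of the summation index. -/
def hilbertAddIKernel (n m : ℤ) : ℂ :=
  ((1 / (Real.pi * ((n : ℝ) - m)) : ℝ) : ℂ) + if m = n then Complex.I else 0

lemma hasSum_mul_hilbertAddIKernel {p : ℝ} (hp : 1 < p) {a : ℤ → ℂ} (ha : MemLpZ p a) (n : ℤ) :
    HasSum (fun m => a m * hilbertAddIKernel n m) (H0T a n + Complex.I * a n) := by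
  have h := (hasSum_H0T hp ha n).add (hasSum_ite_eq n (Complex.I * a n))
  refine h.congr_fun fun m => ?_
  rw [hilbertAddIKernel, mul_add]
  congr 1
  split_ifs with hm
  · rw [hm, mul_comm]
  · simp

lemma norm_H0T_one_div_sub_add_le {y : ℝ} (hy : 1 ≤ y) (n : ℤ) :
    ‖∑' m : ℤ, 1 / ((y : ℂ) - Complex.I * (m : ℝ)) * hilbertAddIKernel n m‖
      ≤ 4 / (y * (1 + |(n : ℝ)|)) := by
  have hy0 : 0 < y := by linarith
  have hmem := memLpZ_two_one_div_sub hy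
  rw [(hasSum_mul_hilbertAddIKernel one_lt_two hmem n).tsum_eq, H0T_eq_tsum]
  set w : ℂ := (y : ℂ) - Complex.I * (n : ℝ) with hw
  have hwre : w.re = y := by simp [hw]
  have hwpos : 0 < w.re := by rw [hwre]; exact hy0
  have hterm : ∀ j : ℤ, (fun m : ℤ => 1 / ((y : ℂ) - Complex.I * (m : ℝ)) *
      ((1 / (Real.pi * ((n : ℝ) - m)) : ℝ) : ℂ)) (Equiv.subLeft n j)
      = 1 / (w + Complex.I * (j : ℝ)) * (1 / ((Real.pi * j : ℝ) : ℂ)) := by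
    intro j
    simp only [Equiv.subLeft_apply, hw]
    push_cast
    congr 2
    · ring
    · ring
  have hs : Summable fun j : ℤ => 1 / (w + Complex.I * (j : ℝ)) * (1 / ((Real.pi * j : ℝ) : ℂ)) :=
    ((Equiv.subLeft n).summable_iff.2 (hasSum_H0T one_lt_two hmem n).summable).congr hterm
  rw [← (Equiv.subLeft n).tsum_eq, tsum_congr hterm, tsum_one_div_add_I_mul hwpos hs]
  have hwn := le_norm_ofReal_sub_I_mul (y := y) (t := n) hy0.le
  rw [← hw] at hwn
  have hwy : y ≤ ‖w‖ := by
    rw [← hwre]; exact (le_abs_self _).trans (Complex.abs_re_le_norm w)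
  have hw0 : 0 < ‖w‖ := hy0.trans_le hwy
  have hcot := norm_cot_pi_mul_add_I_le (z := Complex.I * w) (by simpa using hwpos)
  rw [show (Complex.I * w).im = y by simp [hwre]] at hcot
  have heq : Complex.cot (Real.pi * (Complex.I * w)) / w + Complex.I / (Real.pi * w ^ 2)
      + Complex.I * (1 / w) = (Complex.cot (Real.pi * (Complex.I * w)) + Complex.I) / w
        + Complex.I / (Real.pi * w ^ 2) := by ring
  rw [heq]
  have h1 : ‖(Complex.cot (Real.pi * (Complex.I * w)) + Complex.I) / w‖ ≤ 1 / (y * ‖w‖) := by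
    rw [norm_div, ← div_div]
    gcongr
  have h2 : ‖Complex.I / (Real.pi * w ^ 2)‖ ≤ 1 / (y * ‖w‖) := by
    rw [norm_div, Complex.norm_I, norm_mul, norm_pow, Complex.norm_of_nonneg Real.pi_pos.le]
    have := Real.pi_gt_three
    have h3 : y * ‖w‖ ≤ Real.pi * ‖w‖ ^ 2 := by
      have : y * ‖w‖ ≤ ‖w‖ ^ 2 := by nlinarith
      nlinarith [sq_nonneg ‖w‖]
    gcongr
  refine (norm_add_le_of_le h1 h2).trans ?_
  rw [← add_div, div_le_div_iff₀ (by positivity) (by positivity)]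
  have : 1 + |(n : ℝ)| ≤ 2 * ‖w‖ := by linarith
  nlinarith

/-- The extremal sequences `(1 - i n) ^ (-s)`. -/
def testSeq (s : ℝ) (n : ℤ) : ℂ := (1 - Complex.I * (n : ℝ)) ^ ((-s : ℝ) : ℂ)

lemma norm_testSeq (s : ℝ) (n : ℤ) : ‖testSeq s n‖ = ‖1 - Complex.I * (n : ℝ)‖ ^ (-s) :=
  Complex.norm_cpow_real _ _

lemma memLpZ_testSeq {p s : ℝ} (hp : 0 < p) (hs : 0 < s) (h : 1 < s * p) :
    MemLpZ p (testSeq s) := by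
  refine MemLpZ.of_norm_le hp.le (C := 2 ^ s) (fun m => ?_) (by positivity)
    (memLpZ_one_add_abs_int_rpow_neg h)
  rw [Complex.norm_of_nonneg (by positivity), norm_testSeq]
  have h1 := le_norm_ofReal_sub_I_mul (y := 1) (t := m) zero_le_one
  rw [Complex.ofReal_one] at h1
  have h2 : 0 < (1 + |(m : ℝ)|) / 2 := by positivity
  refine (Real.rpow_le_rpow_of_nonpos h2 h1 (by linarith)).trans_eq ?_
  rw [Real.div_rpow (by positivity) zero_le_two, Real.rpow_neg zero_le_two, div_inv_eq_mul, mul_comm]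

lemma norm_H0T_testSeq_add_le {s : ℝ} (hs : 0 < s) (hs1 : s < 1) (n : ℤ) :
    ‖H0T (testSeq s) n + Complex.I * testSeq s n‖ ≤ 4 / (1 + |(n : ℝ)|) := by
  have hc := stieltjesConst_pos hs hs1
  have hq : 1 < 2 / s := by rw [lt_div_iff₀ hs]; linarith
  have hsq : 1 < s * (2 / s) := by rw [mul_div_cancel₀ _ hs.ne']; norm_num
  have hA := hasSum_mul_hilbertAddIKernel hq (memLpZ_testSeq (by positivity) hs hsq) n
  set F : ℤ → ℝ → ℂ := fun m x =>
    ((x ^ (-s) : ℝ) : ℂ) / ((x : ℂ) + (1 - Complex.I * (m : ℝ))) * hilbertAddIKernel n m with hF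
  have hre : ∀ m : ℤ, 0 < (1 - Complex.I * ((m : ℝ) : ℂ)).re := fun m => by simp
  have hInt : ∀ m, Integrable (F m) (volume.restrict (Set.Ioi 0)) := fun m =>
    (integrableOn_ofReal_rpow_neg_div_add hs hs1 (hre m)).mul_const _
  have hval : ∀ m, ∫ x in Set.Ioi (0 : ℝ), F m x
      = stieltjesConst s * (testSeq s m * hilbertAddIKernel n m) := fun m => by
    rw [hF, integral_mul_const, integral_ofReal_rpow_neg_div_add hs hs1 (hre m), testSeq, mul_assoc]
  have hnorm : Summable fun m => ∫ x in Set.Ioi (0 : ℝ), ‖F m x‖ := by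
    have hB := ((hasSum_mul_hilbertAddIKernel hq
      (memLpZ_one_add_abs_int_rpow_neg hsq) n).summable.norm).mul_left (2 * stieltjesConst s)
    refine Summable.of_nonneg_of_le (fun m => integral_nonneg fun x => norm_nonneg _)
      (fun m => ?_) hB
    have hm : 0 < 1 + |(m : ℝ)| := by positivity
    calc ∫ x in Set.Ioi (0 : ℝ), ‖F m x‖
        ≤ ∫ x in Set.Ioi (0 : ℝ), x ^ (-s) / (x + (1 + |(m : ℝ)|)) * (2 * ‖hilbertAddIKernel n m‖) := by
          refine setIntegral_mono_on (hInt m).norm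
            ((integrableOn_rpow_neg_div_add hs hs1 hm).mul_const _) measurableSet_Ioi fun x hx => ?_
          have hx0 : 0 < x := hx
          have h1 := le_norm_ofReal_sub_I_mul (y := x + 1) (t := m) (by linarith)
          rw [Complex.ofReal_add, Complex.ofReal_one, ← add_sub] at h1
          rw [hF, norm_mul, norm_div, Complex.norm_of_nonneg (by positivity), ← mul_assoc]
          refine mul_le_mul_of_nonneg_right ?_ (norm_nonneg _)
          rw [div_mul_eq_mul_div, div_le_div_iff₀ (by linarith) (by positivity)]
          have h2 : 0 ≤ x ^ (-s) := by positivity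
          nlinarith
      _ = _ := by
          rw [integral_mul_const, integral_rpow_neg_div_add hm, norm_mul,
            Complex.norm_of_nonneg (by positivity)]
          ring
  have hswap := hasSum_integral_of_summable_integral_norm hInt hnorm
  simp only [hval] at hswap
  have heq := hswap.unique (hA.mul_left (stieltjesConst s : ℂ))
  have hbound : ‖∫ x in Set.Ioi (0 : ℝ), ∑' m, F m x‖
      ≤ ∫ x in Set.Ioi (0 : ℝ), x ^ (-s) / (x + 1) * (4 / (1 + |(n : ℝ)|)) := by
    refine norm_integral_le_of_norm_le
      ((integrableOn_rpow_neg_div_add hs hs1 zero_lt_one).mul_const _) ?_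
    filter_upwards [ae_restrict_mem measurableSet_Ioi] with x hx
    have hx0 : 0 < x := hx
    have h1 := norm_H0T_one_div_sub_add_le (y := x + 1) (by linarith) n
    have h2 : ∑' m, F m x = ((x ^ (-s) : ℝ) : ℂ) * ∑' m : ℤ,
        1 / (((x + 1 : ℝ) : ℂ) - Complex.I * (m : ℝ)) * hilbertAddIKernel n m := by
      rw [← tsum_mul_left]
      refine tsum_congr fun m => ?_
      rw [hF, Complex.ofReal_add, Complex.ofReal_one, ← add_sub]
      ring
    rw [h2, norm_mul, Complex.norm_of_nonneg (by positivity)]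
    refine (mul_le_mul_of_nonneg_left h1 (by positivity)).trans_eq ?_
    field_simp
  rw [heq, norm_mul, Complex.norm_of_nonneg hc.le, integral_mul_const, ← stieltjesConst] at hbound
  exact le_of_mul_le_mul_left hbound hc

end

section

open Filter Topology

/-- The `ℓ^p` norm of a nonnegative real sequence. -/
def nonnegLpNorm (p : ℝ) (f : ℤ → ℝ) : ℝ := (∑' n, f n ^ p) ^ (1 / p)

lemma nonnegLpNorm_nonneg (p : ℝ) {f : ℤ → ℝ} (hf : ∀ n, 0 ≤ f n) : 0 ≤ nonnegLpNorm p f :=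
  Real.rpow_nonneg (tsum_nonneg fun n => Real.rpow_nonneg (hf n) p) _

lemma nonnegLpNorm_mono {p : ℝ} (hp : 0 < p) {f g : ℤ → ℝ} (hf : ∀ n, 0 ≤ f n)
    (hfg : ∀ n, f n ≤ g n) (hg : Summable fun n => g n ^ p) :
    nonnegLpNorm p f ≤ nonnegLpNorm p g := by
  have h : ∀ n, f n ^ p ≤ g n ^ p := fun n => Real.rpow_le_rpow (hf n) (hfg n) hp.le
  have hs := Summable.of_nonneg_of_le (fun n => Real.rpow_nonneg (hf n) p) h hg
  exact Real.rpow_le_rpow (tsum_nonneg fun n => Real.rpow_nonneg (hf n) p)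
    (hs.tsum_le_tsum h hg) (by positivity)

lemma nonnegLpNorm_const_mul {p c : ℝ} (hp : 0 < p) (hc : 0 ≤ c) {f : ℤ → ℝ} (hf : ∀ n, 0 ≤ f n) :
    nonnegLpNorm p (fun n => c * f n) = c * nonnegLpNorm p f := by
  simp only [nonnegLpNorm]
  rw [tsum_congr fun n => Real.mul_rpow hc (hf n), tsum_mul_left,
    Real.mul_rpow (by positivity) (tsum_nonneg fun n => Real.rpow_nonneg (hf n) p),
    ← Real.rpow_mul hc, mul_one_div_cancel hp.ne', Real.rpow_one]

lemma summable_const_mul_rpow {p c : ℝ} (hc : 0 ≤ c) {f : ℤ → ℝ} (hf : ∀ n, 0 ≤ f n)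
    (hs : Summable fun n => f n ^ p) : Summable fun n => (c * f n) ^ p :=
  (hs.mul_left (c ^ p)).congr fun n => (Real.mul_rpow hc (hf n)).symm

lemma not_summable_norm_one_sub_I_mul_inv :
    ¬ Summable fun n : ℤ => ‖1 - Complex.I * ((n : ℝ) : ℂ)‖⁻¹ := by
  intro h
  have h1 : Summable fun n : ℕ => ‖1 - Complex.I * (((n : ℤ) : ℝ) : ℂ)‖⁻¹ :=
    h.comp_injective Nat.cast_injective
  refine Real.not_summable_natCast_inv ((summable_nat_add_iff 1).1
    (Summable.of_nonneg_of_le (fun n => by positivity) (fun n => ?_) h1))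
  have h2 : ‖1 - Complex.I * (((n : ℤ) : ℝ) : ℂ)‖ ≤ ((n + 1 : ℕ) : ℝ) := by
    refine (norm_sub_le _ _).trans ?_
    rw [norm_one, norm_mul, Complex.norm_I, one_mul, Complex.norm_of_nonneg (by positivity)]
    push_cast
    linarith
  have h3 : 0 < ‖1 - Complex.I * (((n : ℤ) : ℝ) : ℂ)‖ := by
    rw [norm_pos_iff]
    intro h0
    simpa using congrArg Complex.re h0
  gcongr

lemma norm_one_sub_I_mul_pos (n : ℤ) : 0 < ‖1 - Complex.I * ((n : ℝ) : ℂ)‖ := by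
  rw [norm_pos_iff]
  intro h0
  simpa using congrArg Complex.re h0

lemma le_mul_of_lpNorm_bound {p C K : ℝ} (hp : 1 < p) (hC : 0 ≤ C) (hK : 0 ≤ K)
    (hadm : ∀ a : ℤ → ℂ, MemLpZ p a → _root_.lpNorm p (H0T a) ≤ C * _root_.lpNorm p a)
    {A B : ℝ → ℝ} (hAc : Continuous A) (hBc : Continuous B)
    {b : ℝ → ℤ → ℂ} (hA : ∀ s, 1 / p < s → s < 1 → 0 ≤ A s) (hB : ∀ s, 1 / p < s → s < 1 → 0 ≤ B s)
    (hb : ∀ s, 1 / p < s → s < 1 → ∀ n : ℤ,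
      ‖b s n‖ ≤ A s * ‖1 - Complex.I * ((n : ℝ) : ℂ)‖ ^ (-s) + K * (1 + |(n : ℝ)|)⁻¹)
    (hHb : ∀ s, 1 / p < s → s < 1 → ∀ n : ℤ,
      B s * ‖1 - Complex.I * ((n : ℝ) : ℂ)‖ ^ (-s) ≤ ‖H0T (b s) n‖ + K * (1 + |(n : ℝ)|)⁻¹) :
    B (1 / p) ≤ C * A (1 / p) := by
  have hp0 : 0 < p := one_pos.trans hp
  set W : ℝ → ℤ → ℝ := fun s n => ‖1 - Complex.I * ((n : ℝ) : ℂ)‖ ^ (-s) with hW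
  set u : ℤ → ℝ := fun n => (1 + |(n : ℝ)|)⁻¹ with hu
  have hW0 : ∀ s n, 0 ≤ W s n := fun s n => by positivity
  have hu0 : ∀ n, 0 ≤ u n := fun n => by positivity
  have hus : Summable fun n => u n ^ p := by
    refine (summable_one_add_abs_int_rpow_neg hp).congr fun n => ?_
    rw [hu, Real.inv_rpow (by positivity), Real.rpow_neg (by positivity)]
  have hWs : ∀ s, 1 / p < s → Summable fun n => W s n ^ p := by
    intro s hs
    have h0 : 0 < s := lt_trans (by positivity) hs
    have := memLpZ_testSeq hp0 h0 ((div_lt_iff₀ hp0).1 hs)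
    refine this.congr fun n => ?_
    rw [norm_testSeq]
  have hKu := summable_const_mul_rpow hK hu0 hus
  have hKu0 : ∀ n, 0 ≤ K * u n := fun n => mul_nonneg hK (hu0 n)
  have hmain : ∀ s, 1 / p < s → s < 1 →
      (B s - C * A s) * nonnegLpNorm p (W s) ≤ (C + 1) * (K * nonnegLpNorm p u) := by
    intro s hs hs1
    have hAs := hA s hs hs1
    have hBs := hB s hs hs1
    have hAW := summable_const_mul_rpow hAs (hW0 s) (hWs s hs)
    have hAW0 : ∀ n, 0 ≤ A s * W s n := fun n => mul_nonneg hAs (hW0 s n)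
    obtain ⟨hsum, hle⟩ := Real.Lp_add_le_tsum_of_nonneg hp.le hAW0 hKu0 hAW hKu
    have hbmem : MemLpZ p (b s) := by
      refine Summable.of_nonneg_of_le (fun n => Real.rpow_nonneg (norm_nonneg _) _) (fun n => ?_) hsum
      exact Real.rpow_le_rpow (norm_nonneg _) (hb s hs hs1 n) hp0.le
    have h1 : _root_.lpNorm p (b s) ≤ A s * nonnegLpNorm p (W s) + K * nonnegLpNorm p u := by
      rw [← nonnegLpNorm_const_mul hp0 hAs (hW0 s), ← nonnegLpNorm_const_mul hp0 hK hu0]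
      exact (nonnegLpNorm_mono hp0 (fun n => norm_nonneg _) (hb s hs hs1) hsum).trans hle
    obtain ⟨hsum2, hle2⟩ := Real.Lp_add_le_tsum_of_nonneg hp.le (fun n => norm_nonneg (H0T (b s) n))
      hKu0 (memLpZ_H0T hp hbmem) hKu
    have h2 : B s * nonnegLpNorm p (W s) ≤ _root_.lpNorm p (H0T (b s)) + K * nonnegLpNorm p u := by
      rw [← nonnegLpNorm_const_mul hp0 hBs (hW0 s), ← nonnegLpNorm_const_mul hp0 hK hu0]
      exact (nonnegLpNorm_mono hp0 (fun n => mul_nonneg hBs (hW0 s n)) (hHb s hs hs1) hsum2).trans hle2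
    have h3 := hadm (b s) hbmem
    have h4 := mul_le_mul_of_nonneg_left h1 hC
    linarith
  by_contra! hlt
  set D := B (1 / p) - C * A (1 / p) with hD
  have hD0 : 0 < D := sub_pos.2 hlt
  set M := (C + 1) * (K * nonnegLpNorm p u) with hM
  have hM0 : 0 ≤ M := by have := nonnegLpNorm_nonneg p hu0; positivity
  obtain ⟨T, hT⟩ : ∃ T : Finset ℤ, ((M + 1) / D) ^ p < ∑ n ∈ T, W (1 / p) n ^ p := by
    by_contra! hcon
    refine not_summable_norm_one_sub_I_mul_inv ?_
    have := summable_of_sum_le (fun n => Real.rpow_nonneg (hW0 (1 / p) n) p) hcon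
    refine this.congr fun n => ?_
    rw [hW, ← Real.rpow_mul (norm_nonneg _), neg_mul, one_div_mul_cancel hp0.ne',
      Real.rpow_neg_one]
  have hT2 : (M + 1) / D < (∑ n ∈ T, W (1 / p) n ^ p) ^ (1 / p) := by
    have := Real.rpow_lt_rpow (by positivity) hT (by positivity : 0 < 1 / p)
    rwa [← Real.rpow_mul (by positivity), mul_one_div_cancel hp0.ne', Real.rpow_one] at this
  have hcont : Continuous fun s => (B s - C * A s) * (∑ n ∈ T, W s n ^ p) ^ (1 / p) := by
    refine (hBc.sub (hAc.const_mul C)).mul ?_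
    refine Continuous.rpow_const ?_ fun _ => Or.inr (by positivity)
    refine continuous_finsetSum T fun n _ => ?_
    refine Continuous.rpow_const ?_ fun _ => Or.inr hp0.le
    exact continuous_const.rpow continuous_neg fun _ => Or.inl (norm_one_sub_I_mul_pos n).ne'
  have hlim := (hcont.tendsto (1 / p)).mono_left (nhdsWithin_le_nhds (s := Set.Ioi (1 / p)))
  have hDc := (((hBc.sub (hAc.const_mul C)).tendsto (1 / p)).mono_left
    (nhdsWithin_le_nhds (s := Set.Ioi (1 / p)))).eventually (lt_mem_nhds hD0)
  have h1p : 1 / p < 1 := by rw [div_lt_one hp0]; exact hp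
  have hle : D * (∑ n ∈ T, W (1 / p) n ^ p) ^ (1 / p) ≤ M := by
    refine le_of_tendsto hlim ?_
    filter_upwards [hDc, Ioo_mem_nhdsGT h1p] with s hs hs2
    refine le_trans (mul_le_mul_of_nonneg_left ?_ (le_of_lt hs)) (hmain s hs2.1 hs2.2)
    refine Real.rpow_le_rpow (Finset.sum_nonneg fun n _ => Real.rpow_nonneg (hW0 s n) p) ?_
      (by positivity)
    exact (hWs s hs2.1).sum_le_tsum T fun n _ => Real.rpow_nonneg (hW0 s n) p
  rw [div_lt_iff₀ hD0] at hT2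
  linarith

end

section

open Filter Topology

lemma H0T_re {p : ℝ} (hp : 1 < p) {a : ℤ → ℂ} (ha : MemLpZ p a) (n : ℤ) :
    H0T (fun m => ((a m).re : ℂ)) n = ((H0T a n).re : ℂ) := by
  have h := Complex.hasSum_ofReal.2 (Complex.hasSum_re (hasSum_H0T hp ha n))
  rw [H0T_eq_tsum, ← h.tsum_eq]
  refine tsum_congr fun m => ?_
  rw [Complex.re_mul_ofReal, Complex.ofReal_mul]

lemma H0T_im {p : ℝ} (hp : 1 < p) {a : ℤ → ℂ} (ha : MemLpZ p a) (n : ℤ) :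
    H0T (fun m => ((a m).im : ℂ)) n = ((H0T a n).im : ℂ) := by
  have h := Complex.hasSum_ofReal.2 (Complex.hasSum_im (hasSum_H0T hp ha n))
  rw [H0T_eq_tsum, ← h.tsum_eq]
  refine tsum_congr fun m => ?_
  rw [Complex.im_mul_ofReal, Complex.ofReal_mul]

lemma abs_arg_one_sub_I_mul_le (n : ℤ) :
    |Complex.arg (1 - Complex.I * ((n : ℝ) : ℂ))| ≤ Real.pi / 2 :=
  Complex.abs_arg_le_pi_div_two_iff.2 (by simp)

lemma pi_div_two_sub_abs_arg_le (n : ℤ) :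
    Real.pi / 2 - |Complex.arg (1 - Complex.I * ((n : ℝ) : ℂ))| ≤ 4 * (1 + |(n : ℝ)|)⁻¹ := by
  set θ := |Complex.arg (1 - Complex.I * ((n : ℝ) : ℂ))| with hθ
  have h1 : θ ≤ Real.pi / 2 := abs_arg_one_sub_I_mul_le n
  have h0 : 0 ≤ θ := abs_nonneg _
  have hpos := norm_one_sub_I_mul_pos n
  have h2 := Real.mul_le_sin (x := Real.pi / 2 - θ) (by linarith) (by linarith)
  rw [Real.sin_pi_div_two_sub, hθ, Real.cos_abs, ← hθ, Complex.cos_arg (norm_pos_iff.1 hpos)] at h2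
  have h3 := le_norm_ofReal_sub_I_mul (y := 1) (t := n) zero_le_one
  rw [Complex.ofReal_one] at h3
  have hre : (1 - Complex.I * ((n : ℝ) : ℂ)).re = 1 := by simp
  rw [hre] at h2
  have h4 : 1 / ‖1 - Complex.I * ((n : ℝ) : ℂ)‖ ≤ 2 * (1 + |(n : ℝ)|)⁻¹ := by
    rw [← div_eq_mul_inv, div_le_div_iff₀ hpos (by positivity)]
    linarith
  have hπ := Real.pi_pos
  have hπ4 := Real.pi_le_four
  have h5 : Real.pi / 2 - θ ≤ Real.pi / 2 * (2 * (1 + |(n : ℝ)|)⁻¹) := by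
    have := mul_le_mul_of_nonneg_left (h2.trans h4) (by positivity : 0 ≤ Real.pi / 2)
    refine le_trans (le_of_eq ?_) this
    field_simp
  have h6 : 0 ≤ (1 + |(n : ℝ)|)⁻¹ := by positivity
  nlinarith

lemma abs_testSeq_re (s : ℝ) (n : ℤ) :
    |(testSeq s n).re| = ‖1 - Complex.I * ((n : ℝ) : ℂ)‖ ^ (-s) *
      |Real.cos (s * |Complex.arg (1 - Complex.I * ((n : ℝ) : ℂ))|)| := by
  rw [testSeq, Complex.cpow_ofReal_re, abs_mul, abs_of_nonneg (Real.rpow_nonneg (norm_nonneg _) (-s))]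
  congr 2
  rw [mul_neg, Real.cos_neg]
  rcases abs_choice (Complex.arg (1 - Complex.I * ((n : ℝ) : ℂ))) with h | h <;> rw [h]
  · rw [mul_comm]
  · rw [mul_neg, Real.cos_neg, mul_comm]

lemma abs_testSeq_im (s : ℝ) (n : ℤ) :
    |(testSeq s n).im| = ‖1 - Complex.I * ((n : ℝ) : ℂ)‖ ^ (-s) *
      |Real.sin (s * |Complex.arg (1 - Complex.I * ((n : ℝ) : ℂ))|)| := by
  rw [testSeq, Complex.cpow_ofReal_im, abs_mul, abs_of_nonneg (Real.rpow_nonneg (norm_nonneg _) (-s))]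
  congr 1
  rw [mul_neg, Real.sin_neg, abs_neg]
  rcases abs_choice (Complex.arg (1 - Complex.I * ((n : ℝ) : ℂ))) with h | h <;> rw [h]
  · rw [mul_comm]
  · rw [mul_neg, Real.sin_neg, abs_neg, mul_comm]

lemma norm_one_sub_I_mul_rpow_neg_le_one {s : ℝ} (hs : 0 ≤ s) (n : ℤ) :
    ‖1 - Complex.I * ((n : ℝ) : ℂ)‖ ^ (-s) ≤ 1 := by
  have h : 1 ≤ ‖1 - Complex.I * ((n : ℝ) : ℂ)‖ := by
    refine le_trans ?_ (Complex.abs_re_le_norm _)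
    simp
  exact Real.rpow_le_one_of_one_le_of_nonpos h (by linarith)

lemma abs_testSeq_im_le {s : ℝ} (hs : 0 < s) (hs1 : s < 1) (n : ℤ) : |(testSeq s n).im| ≤
    Real.sin (s * (Real.pi / 2)) * ‖1 - Complex.I * ((n : ℝ) : ℂ)‖ ^ (-s) := by
  have h1 := abs_arg_one_sub_I_mul_le n
  have h0 := abs_nonneg (Complex.arg (1 - Complex.I * ((n : ℝ) : ℂ)))
  have hπ := Real.pi_pos
  have h2 := mul_le_mul_of_nonneg_left h1 hs.le
  have h3 : s * (Real.pi / 2) ≤ Real.pi / 2 := by nlinarith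
  have h4 := mul_nonneg hs.le h0
  rw [abs_testSeq_im, mul_comm, abs_of_nonneg (Real.sin_nonneg_of_nonneg_of_le_pi h4 (by linarith))]
  refine mul_le_mul_of_nonneg_right ?_ (by positivity)
  exact Real.sin_le_sin_of_le_of_le_pi_div_two (by linarith) h3 h2

lemma le_abs_testSeq_re {s : ℝ} (hs : 0 < s) (hs1 : s < 1) (n : ℤ) : Real.cos (s * (Real.pi / 2)) * ‖1 - Complex.I * ((n : ℝ) : ℂ)‖ ^ (-s) ≤
    |(testSeq s n).re| := by
  have h1 := abs_arg_one_sub_I_mul_le n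
  have h0 := abs_nonneg (Complex.arg (1 - Complex.I * ((n : ℝ) : ℂ)))
  have hπ := Real.pi_pos
  have h2 := mul_le_mul_of_nonneg_left h1 hs.le
  have h3 : s * (Real.pi / 2) ≤ Real.pi / 2 := by nlinarith
  have h4 := mul_nonneg hs.le h0
  rw [abs_testSeq_re, mul_comm]
  refine mul_le_mul_of_nonneg_left (le_trans ?_ (le_abs_self _)) (by positivity)
  exact Real.cos_le_cos_of_nonneg_of_le_pi h4 (by linarith) h2

lemma abs_testSeq_re_le {s : ℝ} (hs : 0 < s) (hs1 : s < 1) (n : ℤ) : |(testSeq s n).re| ≤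
    Real.cos (s * (Real.pi / 2)) * ‖1 - Complex.I * ((n : ℝ) : ℂ)‖ ^ (-s)
      + 4 * (1 + |(n : ℝ)|)⁻¹ := by
  have h1 := pi_div_two_sub_abs_arg_le n
  have h2 := abs_arg_one_sub_I_mul_le n
  set θ := |Complex.arg (1 - Complex.I * ((n : ℝ) : ℂ))| with hθ
  have h3 := Real.abs_cos_sub_cos_le (s * θ) (s * (Real.pi / 2))
  rw [← mul_sub, abs_mul, abs_of_pos hs, abs_of_nonpos (by linarith : θ - Real.pi / 2 ≤ 0)] at h3
  have h4 : |Real.cos (s * θ)| ≤ Real.cos (s * (Real.pi / 2)) + 4 * (1 + |(n : ℝ)|)⁻¹ := by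
    have hc : 0 ≤ Real.cos (s * (Real.pi / 2)) :=
      Real.cos_nonneg_of_mem_Icc ⟨by nlinarith [Real.pi_pos], by nlinarith [Real.pi_pos]⟩
    have h5 := abs_sub_abs_le_abs_sub (Real.cos (s * θ)) (Real.cos (s * (Real.pi / 2)))
    rw [abs_of_nonneg hc] at h5
    nlinarith
  have hW := norm_one_sub_I_mul_rpow_neg_le_one hs.le n
  have hu : 0 ≤ (1 + |(n : ℝ)|)⁻¹ := by positivity
  have hW0 : 0 ≤ ‖1 - Complex.I * ((n : ℝ) : ℂ)‖ ^ (-s) := by positivity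
  rw [abs_testSeq_re, ← hθ]
  nlinarith

lemma le_abs_testSeq_im {s : ℝ} (hs : 0 < s) (hs1 : s < 1) (n : ℤ) :
    Real.sin (s * (Real.pi / 2)) * ‖1 - Complex.I * ((n : ℝ) : ℂ)‖ ^ (-s) ≤
    |(testSeq s n).im| + 4 * (1 + |(n : ℝ)|)⁻¹ := by
  have h1 := pi_div_two_sub_abs_arg_le n
  have h2 := abs_arg_one_sub_I_mul_le n
  set θ := |Complex.arg (1 - Complex.I * ((n : ℝ) : ℂ))| with hθ
  have h3 := Real.abs_sin_sub_sin_le (s * (Real.pi / 2)) (s * θ)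
  rw [← mul_sub, abs_mul, abs_of_pos hs, abs_of_nonneg (by linarith : 0 ≤ Real.pi / 2 - θ)] at h3
  have h4 : Real.sin (s * (Real.pi / 2)) ≤ |Real.sin (s * θ)| + 4 * (1 + |(n : ℝ)|)⁻¹ := by
    have h5 := (le_abs_self _).trans h3
    have h6 := le_abs_self (Real.sin (s * θ))
    nlinarith
  have hW := norm_one_sub_I_mul_rpow_neg_le_one hs.le n
  have hu : 0 ≤ (1 + |(n : ℝ)|)⁻¹ := by positivity
  have hW0 : 0 ≤ ‖1 - Complex.I * ((n : ℝ) : ℂ)‖ ^ (-s) := by positivity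
  rw [abs_testSeq_im, ← hθ]
  nlinarith

lemma abs_testSeq_im_le_H0T_re {s : ℝ} (hs : 0 < s) (hs1 : s < 1) (n : ℤ) :
    |(testSeq s n).im| ≤ |(H0T (testSeq s) n).re| + 4 * (1 + |(n : ℝ)|)⁻¹ := by
  have h := (Complex.abs_re_le_norm _).trans (norm_H0T_testSeq_add_le hs hs1 n)
  rw [← div_eq_mul_inv]
  have hre : (H0T (testSeq s) n + Complex.I * testSeq s n).re
      = (H0T (testSeq s) n).re - (testSeq s n).im := by simp [sub_eq_add_neg]
  rw [hre, abs_sub_comm] at h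
  linarith [abs_sub_abs_le_abs_sub (testSeq s n).im (H0T (testSeq s) n).re]

lemma abs_testSeq_re_le_H0T_im {s : ℝ} (hs : 0 < s) (hs1 : s < 1) (n : ℤ) :
    |(testSeq s n).re| ≤ |(H0T (testSeq s) n).im| + 4 * (1 + |(n : ℝ)|)⁻¹ := by
  have h := (Complex.abs_im_le_norm _).trans (norm_H0T_testSeq_add_le hs hs1 n)
  rw [← div_eq_mul_inv]
  have him : (H0T (testSeq s) n + Complex.I * testSeq s n).im
      = (testSeq s n).re - -(H0T (testSeq s) n).im := by simp [add_comm]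
  rw [him] at h
  have h2 := abs_sub_abs_le_abs_sub (testSeq s n).re (-(H0T (testSeq s) n).im)
  rw [abs_neg] at h2
  linarith


lemma Cconst_le_of_lpNorm_bound {p C : ℝ} (hp : 1 < p) (hC : 0 ≤ C)
    (hadm : ∀ a : ℤ → ℂ, MemLpZ p a → _root_.lpNorm p (H0T a) ≤ C * _root_.lpNorm p a) :
    Cconst p ≤ C := by
  have hp0 : 0 < p := one_pos.trans hp
  have hang := pichorides_angle_mem hp
  have hs0 : ∀ s, 1 / p < s → 0 < s := fun s hs => lt_trans (by positivity) hs
  have hmem : ∀ s, 1 / p < s → MemLpZ p (testSeq s) := fun s hs =>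
    memLpZ_testSeq hp0 (hs0 s hs) ((div_lt_iff₀ hp0).1 hs)
  have hsin : ∀ s, 1 / p < s → s < 1 → 0 ≤ Real.sin (s * (Real.pi / 2)) := fun s hs hs1 =>
    Real.sin_nonneg_of_nonneg_of_le_pi (by have := hs0 s hs; positivity)
      (by nlinarith [Real.pi_pos])
  have hcos : ∀ s, 1 / p < s → s < 1 → 0 ≤ Real.cos (s * (Real.pi / 2)) := fun s hs hs1 =>
    Real.cos_nonneg_of_mem_Icc
      ⟨by nlinarith [Real.pi_pos, hs0 s hs], by nlinarith [Real.pi_pos]⟩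
  have hsc : Continuous fun s : ℝ => Real.sin (s * (Real.pi / 2)) := by fun_prop
  have hcc : Continuous fun s : ℝ => Real.cos (s * (Real.pi / 2)) := by fun_prop
  have harg : 1 / p * (Real.pi / 2) = Real.pi / (2 * p) := by field_simp
  have hsp : 0 < Real.sin (Real.pi / (2 * p)) :=
    Real.sin_pos_of_pos_of_lt_pi hang.1 (by linarith [hang.2, Real.pi_pos])
  have hcp : 0 < Real.cos (Real.pi / (2 * p)) :=
    Real.cos_pos_of_mem_Ioo ⟨by linarith [hang.1, Real.pi_pos], hang.2⟩
  rcases le_total 2 p with h2 | h2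
  · rw [Cconst_of_two_le h2, Real.cot_eq_cos_div_sin, div_le_iff₀ hsp, ← harg]
    refine le_mul_of_lpNorm_bound (K := 8) hp hC (by norm_num) hadm hsc hcc
      (b := fun s n => ((testSeq s n).im : ℂ)) hsin hcos (fun s hs hs1 n => ?_)
      (fun s hs hs1 n => ?_)
    · rw [Complex.norm_real, Real.norm_eq_abs]
      have hu : 0 ≤ (1 + |(n : ℝ)|)⁻¹ := by positivity
      linarith [abs_testSeq_im_le (hs0 s hs) hs1 n]
    · rw [H0T_im hp (hmem s hs), Complex.norm_real, Real.norm_eq_abs]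
      have hu : 0 ≤ (1 + |(n : ℝ)|)⁻¹ := by positivity
      linarith [le_abs_testSeq_re (hs0 s hs) hs1 n, abs_testSeq_re_le_H0T_im (hs0 s hs) hs1 n]
  · rw [Cconst_of_le_two hp h2, Real.tan_eq_sin_div_cos, div_le_iff₀ hcp, ← harg]
    refine le_mul_of_lpNorm_bound (K := 8) hp hC (by norm_num) hadm hcc hsc
      (b := fun s n => ((testSeq s n).re : ℂ)) hcos hsin (fun s hs hs1 n => ?_)
      (fun s hs hs1 n => ?_)
    · rw [Complex.norm_real, Real.norm_eq_abs]
      have hu : 0 ≤ (1 + |(n : ℝ)|)⁻¹ := by positivity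
      linarith [abs_testSeq_re_le (hs0 s hs) hs1 n]
    · rw [H0T_re hp (hmem s hs), Complex.norm_real, Real.norm_eq_abs]
      linarith [le_abs_testSeq_im (hs0 s hs) hs1 n, abs_testSeq_im_le_H0T_re (hs0 s hs) hs1 n]

end

/-- The ℓ^p norm of the discrete Hilbert transform 𝓗₀ equals cot(π/(2p*)). -/
theorem discrete_hilbert_norm (p : ℝ) (hp : 1 < p) :
    opNormOn p H0T = Real.cot (Real.pi / (2 * pstar p)) := by
  have hmem : Cconst p ∈ {C : ℝ | 0 ≤ C ∧ ∀ a : ℤ → ℂ, MemLpZ p a →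
      _root_.lpNorm p (H0T a) ≤ C * _root_.lpNorm p a} :=
    ⟨(Cconst_pos hp).le, fun _ ha => lpNorm_H0T_le hp ha⟩
  exact le_antisymm (csInf_le ⟨0, fun _ hC => hC.1⟩ hmem)
    (le_csInf ⟨_, hmem⟩ fun _ hC => Cconst_le_of_lpNorm_bound hp hC.1 hC.2)

end
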